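/- Fix an integer g ≥ 1. For each n ≥ 2, let μₙ^{g−1} denote the uniform probability distribution on 𝔽ₙ^{g−1}, let μₙ^{g} denote the uniform probability distribution on 𝔽ₙᵍ (viewed as a distribution on 𝔽ₙᵍ ∪ {†}), and let Λ(μₙ^{g−1}) denote the output distribution on 𝔽ₙᵍ ∪ {†} of the randomized map Λ applied to a uniform element of 𝔽ₙ^{g−1}. Then the total variation distance d_TV(Λ(μₙ^{g−1}), μₙ^{g}) tends to 0 as n → ∞. -/

import Mathlib

/-- Left-to-right product of a list of permutations: the leftmost entry is applied first. -/
def prodLR {n : ℕ} (l : List (Equiv.Perm (Fin n))) : Equiv.Perm (Fin n) :=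
  l.reverse.prod

/-- The set `𝔽ₙᵍ` of genus-`g` factorizations of the `n`-cycle `(1 2 ⋯ n)`
into transpositions. -/
def Fcal (n g : ℕ) : Set (List (Equiv.Perm (Fin n))) :=
  {l | l.length = n - 1 + 2 * g ∧ (∀ t ∈ l, t.IsSwap) ∧ prodLR l = finRotate n}

/-- A permutation of `{1,…,n}` is a long cycle (a single cycle of length `n`)
iff it acts as a cycle on the whole set. -/
def IsLongCycle {n : ℕ} (π : Equiv.Perm (Fin n)) : Prop :=
  π.IsCycleOn (Set.univ : Set (Fin n))

/-- The random choices of one step of the algorithm: a pair of (0-indexed) insertion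
positions `(v, w)` and a triple `(a, b, c)` of elements of `{1,…,n}`. -/
abbrev Param (n : ℕ) := (ℕ × ℕ) × (Fin n × Fin n × Fin n)

/-- Validity of a choice of parameters for the step targeting genus `i`:
`v < w` are positions in `{0,…,n-2+2i}` (i.e. a 2-element subset of the
`n-1+2i` possible positions) and `a < b < c` in `Fin n`. -/
def paramOK (n i : ℕ) (p : Param n) : Prop :=
  p.1.1 < p.1.2 ∧ p.1.2 < n - 1 + 2 * i ∧ p.2.1 < p.2.2.1 ∧ p.2.2.1 < p.2.2.2

open scoped Classical in
/-- The deterministic part of one step of the algorithm `Λ`: given the input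
factorization `F` and the random choices `p = ((v,w),(a,b,c))`, insert the two
transpositions `(a c)`, `(a b)` (or `(a b)`, `(a c)`) at positions `v` and `w`;
if one of the two resulting products is a long cycle `ζ`, conjugate every entry by
the unique `σ` fixing `1` with `σ ζ σ⁻¹ = (1 2 ⋯ n)`; otherwise fail (`none = †`). -/
noncomputable def lamDet (n : ℕ) (F : List (Equiv.Perm (Fin n))) (p : Param n) :
    Option (List (Equiv.Perm (Fin n))) :=
  let v := p.1.1
  let w := p.1.2
  let a := p.2.1
  let b := p.2.2.1
  let c := p.2.2.2
  let L1 := (F.insertIdx v (Equiv.swap a c)).insertIdx w (Equiv.swap a b)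
  let L2 := (F.insertIdx v (Equiv.swap a b)).insertIdx w (Equiv.swap a c)
  let Lsel : Option (List (Equiv.Perm (Fin n))) :=
    if IsLongCycle (prodLR L1) then some L1
    else if IsLongCycle (prodLR L2) then some L2
    else none
  Lsel.bind fun L =>
    if h : ∃! σ : Equiv.Perm (Fin n),
        (∀ h0 : 0 < n, σ ⟨0, h0⟩ = ⟨0, h0⟩) ∧ σ * prodLR L * σ⁻¹ = finRotate n then
      some (L.map fun t => h.choose * t * h.choose⁻¹)
    else none

/-- The output distribution on `𝔽ₙᵍ ∪ {†}` of the randomized map `Λ` applied to a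
uniform element of `𝔽ₙ^{g-1}`, with the insertion positions and the triple `a<b<c`
chosen uniformly and independently. -/
noncomputable def lamStepDist (n g : ℕ) : Option (List (Equiv.Perm (Fin n))) → ℝ :=
  fun x =>
    (Set.ncard {q : List (Equiv.Perm (Fin n)) × Param n |
        q.1 ∈ Fcal n (g - 1) ∧ paramOK n g q.2 ∧ lamDet n q.1 q.2 = x} : ℝ) /
      ((Set.ncard (Fcal n (g - 1)) : ℝ) *
        (Set.ncard {p : Param n | paramOK n g p} : ℝ))

/-- The uniform distribution on `𝔽ₙᵍ`, viewed as a distribution on `𝔽ₙᵍ ∪ {†}`. -/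
noncomputable def unifF (n g : ℕ) : Option (List (Equiv.Perm (Fin n))) → ℝ :=
  fun x =>
    match x with
    | none => 0
    | some l => Set.indicator (Fcal n g) (fun _ => 1 / (Set.ncard (Fcal n g) : ℝ)) l

/-- Total variation distance between two probability mass functions. -/
noncomputable def dTV {X : Type*} (μ ν : X → ℝ) : ℝ :=
  (1 / 2) * ∑' x, |μ x - ν x|


lemma prodLR_nil {n : ℕ} : prodLR ([] : List (Equiv.Perm (Fin n))) = 1 := by simp [prodLR]
lemma prodLR_cons {n : ℕ} (t : Equiv.Perm (Fin n)) (l) : prodLR (t :: l) = prodLR l * t := by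
  simp [prodLR]
lemma prodLR_append {n : ℕ} (l l' : List (Equiv.Perm (Fin n))) :
    prodLR (l ++ l') = prodLR l' * prodLR l := by
  simp [prodLR]
lemma prodLR_map_conj {n : ℕ} (σ : Equiv.Perm (Fin n)) (l : List (Equiv.Perm (Fin n))) :
    prodLR (l.map fun t => σ * t * σ⁻¹) = σ * prodLR l * σ⁻¹ := by
  induction l with
  | nil => simp [prodLR]
  | cons t l ih => rw [List.map_cons, prodLR_cons, prodLR_cons, ih]; group

/-- position at time `i` of the particle attached to the vertex `u`. -/
def Pt {n : ℕ} (l : List (Equiv.Perm (Fin n))) (u : Fin n) (i : ℕ) : Fin n :=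
  (prodLR (l.take i))⁻¹ u

lemma Pt_zero {n : ℕ} (l : List (Equiv.Perm (Fin n))) (u : Fin n) : Pt l u 0 = u := by
  simp [Pt, prodLR]

lemma Pt_full {n : ℕ} (l : List (Equiv.Perm (Fin n))) (u : Fin n) {i : ℕ} (h : l.length ≤ i) :
    Pt l u i = (prodLR l)⁻¹ u := by
  rw [Pt, List.take_of_length_le h]

lemma Pt_inj {n : ℕ} (l : List (Equiv.Perm (Fin n))) {u v : Fin n} {i : ℕ} :
    Pt l u i = Pt l v i ↔ u = v := by
  simp [Pt]

lemma Pt_succ {n : ℕ} (l : List (Equiv.Perm (Fin n))) (u : Fin n) {i : ℕ} (h : i < l.length) :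
    Pt l u (i+1) = Pt l (l[i]⁻¹ u) i := by
  rw [Pt, List.take_succ_eq_append_getElem h, prodLR_append]
  simp [Pt, prodLR]

lemma finRotate_val {n : ℕ} (s : Fin n) :
    (finRotate n s : ℕ) = if (s : ℕ) + 1 = n then 0 else (s : ℕ) + 1 := by
  rcases n with _ | n
  · exact s.elim0
  · rw [coe_finRotate]
    simp [Fin.ext_iff]

lemma finRotate_inv_val {n : ℕ} (s : Fin n) :
    ((finRotate n)⁻¹ s : ℕ) = if (s : ℕ) = 0 then n - 1 else (s : ℕ) - 1 := by
  have h := finRotate_val ((finRotate n)⁻¹ s)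
  rw [show finRotate n ((finRotate n)⁻¹ s) = s from (finRotate n).apply_symm_apply s] at h
  have := ((finRotate n)⁻¹ s).2
  have := s.2
  split_ifs at h ⊢ <;> omega

/-- descent of particle `u` at index `i` -/
def Desc {n : ℕ} (l : List (Equiv.Perm (Fin n))) (u : Fin n) (i : ℕ) : Prop :=
  i < l.length ∧ Pt l u (i+1) < Pt l u i

lemma Desc_unique {n : ℕ} {l : List (Equiv.Perm (Fin n))} (hs : ∀ t ∈ l, t.IsSwap)
    {u v : Fin n} {i : ℕ} (hu : Desc l u i) (hv : Desc l v i) : u = v := by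
  obtain ⟨hi, hu⟩ := hu
  obtain ⟨-, hv⟩ := hv
  rw [Pt_succ _ _ hi] at hu hv
  obtain ⟨x, y, hxy, ht⟩ := hs _ (List.getElem_mem hi)
  rw [ht, Equiv.swap_inv] at hu hv
  by_contra hne
  have key : ∀ u, Pt l (Equiv.swap x y u) i < Pt l u i → u = x ∨ u = y := by
    intro u h
    by_contra! h'
    rw [Equiv.swap_apply_of_ne_of_ne h'.1 h'.2] at h
    exact lt_irrefl _ h
  rcases key u hu with rfl | rfl <;> rcases key v hv with rfl | rfl
  · exact hne rfl
  · simp at hu hv; exact lt_asymm hu hv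
  · simp at hu hv; exact lt_asymm hu hv
  · exact hne rfl

lemma exists_minDesc {n : ℕ} {l : List (Equiv.Perm (Fin n))} (hp : prodLR l = finRotate n)
    {u : Fin n} (hu : (u : ℕ) ≠ 0) :
    ∃ i, Desc l u i ∧ ∀ j ≤ l.length, Pt l u (i+1) ≤ Pt l u j := by
  classical
  obtain ⟨k, hk, hmin⟩ := Finset.exists_min_image (Finset.range (l.length+1)) (fun j => Pt l u j)
    ⟨0, by simp⟩
  have hmin' : ∀ j ≤ l.length, Pt l u k ≤ Pt l u j := fun j hj => hmin j (by simpa using Nat.lt_succ_of_le hj)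
  have hex : ∃ k, k ≤ l.length ∧ ∀ j ≤ l.length, Pt l u k ≤ Pt l u j :=
    ⟨k, by simpa [Nat.lt_succ_iff] using hk, hmin'⟩
  set k0 := Nat.find hex with hk0
  have h0 := Nat.find_spec hex
  rw [← hk0] at h0
  have hk00 : k0 ≠ 0 := by
    intro h
    have h1 := h0.2 _ le_rfl
    rw [h, Pt_zero, Pt_full _ _ le_rfl, hp, Fin.le_def, finRotate_inv_val, if_neg hu] at h1
    omega
  obtain ⟨i, hi⟩ := Nat.exists_eq_succ_of_ne_zero hk00
  have hi' : k0 = i + 1 := hi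
  rw [hi'] at h0
  refine ⟨i, ⟨h0.1, lt_of_le_of_ne (h0.2 _ (by omega)) ?_⟩, h0.2⟩
  intro h
  have := Nat.find_min hex (m := i) (by omega)
  apply this
  refine ⟨by omega, fun j hj => h ▸ h0.2 j hj⟩

open scoped Classical in
/-- first index at which `u` reaches its minimum -/
noncomputable def dmin {n : ℕ} (l : List (Equiv.Perm (Fin n))) (u : Fin n) : ℕ :=
  if h : ∃ i, Desc l u i ∧ ∀ j ≤ l.length, Pt l u (i+1) ≤ Pt l u j then h.choose else 0

lemma dmin_spec {n : ℕ} {l : List (Equiv.Perm (Fin n))} (hp : prodLR l = finRotate n)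
    {u : Fin n} (hu : (u : ℕ) ≠ 0) :
    Desc l u (dmin l u) ∧ ∀ j ≤ l.length, Pt l u (dmin l u+1) ≤ Pt l u j := by
  have h := exists_minDesc hp hu
  rw [dmin, dif_pos h]
  exact h.choose_spec

/-- the finset of nonzero elements of `Fin n`. -/
def nz (n : ℕ) : Finset (Fin n) := Finset.univ.filter fun u => (u : ℕ) ≠ 0

lemma card_nz (n : ℕ) : (nz n).card = n - 1 := by
  rcases n with _ | n
  · rfl
  · have : nz (n+1) = Finset.univ.erase 0 := by
      ext u; rw [nz, Finset.mem_filter, Finset.mem_erase, ne_eq, ne_eq, Fin.ext_iff, and_comm]; rfl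
    rw [this, Finset.card_erase_of_mem (Finset.mem_univ _), Finset.card_univ, Fintype.card_fin]

/-- indices that are not of the form `dmin` -/
lemma card_le_of_disjoint_dmin {n : ℕ} {l : List (Equiv.Perm (Fin n))}
    (hs : ∀ t ∈ l, t.IsSwap) (hp : prodLR l = finRotate n) (T : Finset ℕ)
    (hT : ∀ i ∈ T, i < l.length ∧ ∀ u : Fin n, (u : ℕ) ≠ 0 → dmin l u ≠ i) :
    T.card + (n - 1) ≤ l.length := by
  classical
  have hinj : Set.InjOn (dmin l) (nz n : Set (Fin n)) := by
    intro u hu v hv h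
    simp [nz] at hu hv
    have h1 := (dmin_spec hp hu).1
    have h2 := (dmin_spec hp hv).1
    rw [← h] at h2
    exact Desc_unique hs h1 h2
  have hd : Disjoint T ((nz n).image (dmin l)) := by
    rw [Finset.disjoint_left]
    intro i hi h
    simp [nz] at h
    obtain ⟨u, hu, rfl⟩ := h
    exact (hT _ hi).2 u hu rfl
  have : T ∪ (nz n).image (dmin l) ⊆ Finset.range l.length := by
    intro i hi
    rw [Finset.mem_union] at hi
    rw [Finset.mem_range]
    rcases hi with hi | hi
    · exact (hT i hi).1
    · simp [nz] at hi
      obtain ⟨u, hu, rfl⟩ := hi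
      exact (dmin_spec hp hu).1.1
  have := Finset.card_le_card this
  rw [Finset.card_union_of_disjoint hd, Finset.card_image_of_injOn hinj, card_nz,
    Finset.card_range] at this
  exact this

open scoped Classical in
/-- trisections -/
noncomputable def Tri {n : ℕ} (l : List (Equiv.Perm (Fin n))) : Finset ℕ :=
  (Finset.range l.length).filter fun i => ∃ u, Desc l u i ∧ ∃ j ≤ l.length, Pt l u j < Pt l u (i+1)

lemma card_Tri {n : ℕ} {l : List (Equiv.Perm (Fin n))}
    (hs : ∀ t ∈ l, t.IsSwap) (hp : prodLR l = finRotate n) :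
    (Tri l).card + (n - 1) ≤ l.length := by
  classical
  apply card_le_of_disjoint_dmin hs hp
  intro i hi
  simp only [Tri, Finset.mem_filter, Finset.mem_range] at hi
  refine ⟨hi.1, ?_⟩
  rintro u hu rfl
  obtain ⟨-, v, hv, j, hj, hlt⟩ := hi
  have h1 := dmin_spec hp hu
  have := Desc_unique hs hv h1.1
  subst this
  exact absurd hlt (not_lt.mpr (h1.2 j hj))

/-- `u` has only one descent. -/
def Mono {n : ℕ} (l : List (Equiv.Perm (Fin n))) (u : Fin n) : Prop :=
  (u : ℕ) ≠ 0 ∧ ∀ i j, Desc l u i → Desc l u j → i = j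

lemma card_notMono {n : ℕ} {l : List (Equiv.Perm (Fin n))}
    (hs : ∀ t ∈ l, t.IsSwap) (hp : prodLR l = finRotate n) (S : Finset (Fin n))
    (hS : ∀ u ∈ S, ¬ Mono l u) :
    S.card ≤ l.length - (n - 1) + 1 := by
  classical
  set S' := S.filter (fun u : Fin n => (u : ℕ) ≠ 0) with hS'
  have h1 : S.card ≤ S'.card + 1 := by
    rw [← Finset.card_filter_add_card_filter_not (s := S) (fun u : Fin n => (u : ℕ) ≠ 0)]
    refine Nat.add_le_add_left ?_ _
    rw [Finset.card_le_one]
    intro a ha b hb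
    simp at ha hb
    ext; omega
  have key : ∀ u ∈ S', ∃ i, Desc l u i ∧ dmin l u ≠ i := by
    intro u hu
    simp [hS'] at hu
    by_contra! h
    exact hS u hu.1 ⟨hu.2, fun i j hi hj => (h i hi).symm.trans (h j hj)⟩
  choose! f hf using key
  have hinj : Set.InjOn f S' := by
    intro u hu v hv h
    have h1 := (hf u hu).1
    have h2 := (hf v hv).1
    rw [← h] at h2
    exact Desc_unique hs h1 h2
  have := card_le_of_disjoint_dmin hs hp (S'.image f) (by
    intro i hi
    rw [Finset.mem_image] at hi
    obtain ⟨u, hu, rfl⟩ := hi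
    refine ⟨(hf u hu).1.1, fun v hv h => ?_⟩
    have h1 := (dmin_spec hp hv).1
    rw [h] at h1
    have := Desc_unique hs h1 (hf u hu).1
    exact (hf u hu).2 (this ▸ h))
  rw [Finset.card_image_of_injOn hinj] at this
  omega

lemma length_ge {n : ℕ} {l : List (Equiv.Perm (Fin n))}
    (hs : ∀ t ∈ l, t.IsSwap) (hp : prodLR l = finRotate n) : n - 1 ≤ l.length := by
  have := card_Tri hs hp
  omega

lemma Mono_spec {n : ℕ} {l : List (Equiv.Perm (Fin n))} (hp : prodLR l = finRotate n)
    {a : Fin n} (ha : Mono l a) : ∃ f ≤ l.length, 0 < f ∧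
      (∀ i j, i ≤ j → j < f → a ≤ Pt l a i ∧ Pt l a i ≤ Pt l a j) ∧
      (∀ i j, f ≤ i → i ≤ j → j ≤ l.length → Pt l a i ≤ Pt l a j ∧ Pt l a j < a) := by
  obtain ⟨h0, hu⟩ := ha
  obtain ⟨hd, -⟩ := dmin_spec hp h0
  have hstep : ∀ i < l.length, i ≠ dmin l a → Pt l a i ≤ Pt l a (i+1) := by
    intro i hi hne
    by_contra! h
    exact hne (hu _ _ ⟨hi, h⟩ hd)
  have hm1 : ∀ i j, i ≤ j → j < dmin l a + 1 → Pt l a i ≤ Pt l a j := by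
    intro i j hij hj
    induction j, hij using Nat.le_induction with
    | base => exact le_rfl
    | succ j hij ih =>
      exact (ih (by omega)).trans (hstep j (by have := hd.1; omega) (by omega))
  have hm2 : ∀ i j, dmin l a + 1 ≤ i → i ≤ j → j ≤ l.length → Pt l a i ≤ Pt l a j := by
    intro i j hi hij hj
    induction j, hij using Nat.le_induction with
    | base => exact le_rfl
    | succ j hij ih =>
      exact (ih (by omega)).trans (hstep j (by omega) (by omega))
  refine ⟨dmin l a + 1, hd.1, by omega, fun i j hij hj => ⟨?_, hm1 i j hij hj⟩,
    fun i j hi hij hj => ⟨hm2 i j hi hij hj, ?_⟩⟩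
  · have := hm1 0 i (by omega) (by omega)
    rwa [Pt_zero] at this
  · have h1 := hm2 j l.length (by omega) hj le_rfl
    rw [Pt_full _ _ le_rfl, hp] at h1
    rw [Fin.le_def, finRotate_inv_val, if_neg h0] at h1
    rw [Fin.lt_def]; omega


lemma swap_val {n : ℕ} (x y s : Fin n) : ((Equiv.swap x y s : Fin n) : ℕ) =
    if (s : ℕ) = x then (y : ℕ) else if (s : ℕ) = y then (x : ℕ) else s := by
  rw [Equiv.swap_apply_def]
  simp only [Fin.ext_iff]
  split_ifs <;> rfl

/-- the relabelling -/
def rho (x1 x2 x3 x4 s : ℕ) : ℕ :=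
  if s ≤ x1 then s else if s ≤ x2 then s + (x4 - x2) else
    if s ≤ x3 then s - x2 + x1 + x4 - x3 else if s ≤ x4 then s - x3 + x1 else s

lemma exists_rho {n x1 x2 x3 x4 : ℕ} (h12 : x1 ≤ x2) (h23 : x2 < x3) (h34 : x3 < x4) (h4 : x4 < n) :
    ∃ σ : Equiv.Perm (Fin n), ∀ s, (σ s : ℕ) = rho x1 x2 x3 x4 s := by
  have hlt : ∀ s : Fin n, rho x1 x2 x3 x4 s < n := by
    intro s
    have := s.2
    unfold rho
    split_ifs <;> omega
  let f : Fin n → Fin n := fun s => ⟨rho x1 x2 x3 x4 s, hlt s⟩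
  have hf : Function.Injective f := by
    intro s t h
    simp only [f, Fin.mk.injEq] at h
    ext
    unfold rho at h
    split_ifs at h <;> omega
  exact ⟨Equiv.ofBijective f (Finite.injective_iff_bijective.mp hf), fun s => rfl⟩

lemma swap_cases {n : ℕ} (x y s : Fin n) :
    ((s : ℕ) = x ∧ ((Equiv.swap x y s : Fin n) : ℕ) = y) ∨
    ((s : ℕ) ≠ x ∧ (s : ℕ) = y ∧ ((Equiv.swap x y s : Fin n) : ℕ) = x) ∨
    ((s : ℕ) ≠ x ∧ (s : ℕ) ≠ y ∧ ((Equiv.swap x y s : Fin n) : ℕ) = s) := by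
  rw [swap_val]
  split_ifs <;> simp_all

lemma rho_rot {n x1 x2 x3 x4 s r : ℕ} (h12 : x1 ≤ x2) (h23 : x2 < x3) (h34 : x3 < x4) (h4 : x4 < n)
    (hs : s < n) (h : (s = x1 ∧ r = x3) ∨ (s = x2 ∧ x1 < x2 ∧ r = x4) ∨ (s = x3 ∧ x1 < x2 ∧ r = x1) ∨
      (s = x3 ∧ x1 = x2 ∧ r = x4) ∨ (s = x4 ∧ r = x2) ∨
      (s ≠ x1 ∧ s ≠ x2 ∧ s ≠ x3 ∧ s ≠ x4 ∧ r = s)) :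
    rho x1 x2 x3 x4 (if r + 1 = n then 0 else r + 1) =
      if rho x1 x2 x3 x4 s + 1 = n then 0 else rho x1 x2 x3 x4 s + 1 := by
  by_cases hr : r + 1 = n
  · rw [if_pos hr]
    have e : rho x1 x2 x3 x4 s = n - 1 := by
      rcases h with h | h | h | h | h | h <;> unfold rho <;> split_ifs <;> omega
    rw [e, if_pos (by omega)]
    simp [rho]
  · rw [if_neg hr]
    have e : rho x1 x2 x3 x4 (r + 1) = rho x1 x2 x3 x4 s + 1 := by
      rcases h with ⟨h, h'⟩ | ⟨h, h'', h'⟩ | ⟨h, h'', h'⟩ | ⟨h, h'', h'⟩ | ⟨h, h'⟩ | h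
      · subst h h'
        unfold rho
        rw [if_neg (by omega), if_neg (by omega), if_neg (by omega), if_pos (by omega),
          if_pos (by omega)]
        omega
      · subst h h'
        unfold rho
        rw [if_neg (by omega), if_neg (by omega), if_neg (by omega), if_neg (by omega),
          if_neg (by omega), if_pos (by omega)]
        omega
      · subst h h'
        unfold rho
        rw [if_neg (by omega), if_pos (by omega), if_neg (by omega), if_neg (by omega),
          if_pos (by omega)]
        omega
      · subst h h'
        unfold rho
        rw [if_neg (by omega), if_neg (by omega), if_neg (by omega), if_neg (by omega),
          if_neg (by omega), if_neg (by omega), if_pos (by omega)]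
        omega
      · subst h h'
        unfold rho
        rw [if_neg (by omega), if_neg (by omega), if_pos (by omega), if_neg (by omega),
          if_neg (by omega), if_neg (by omega), if_pos (by omega)]
        omega
      · obtain ⟨h1, h2, h3, h4, rfl⟩ := h
        unfold rho
        split_ifs <;> omega
    rw [e, if_neg]
    intro h'
    have : rho x1 x2 x3 x4 (r + 1) < n := by
      have : r + 1 < n := by omega
      unfold rho
      split_ifs <;> omega
    omega

lemma rho_rot1 {n : ℕ} {X1 X2 X3 X4 : Fin n} (h12 : X1 < X2) (h23 : X2 < X3) (h34 : X3 < X4)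
    (s : Fin n) : rho X1 X2 X3 X4 (finRotate n (Equiv.swap X1 X3 (Equiv.swap X2 X4 s)) : Fin n) =
      if rho X1 X2 X3 X4 s + 1 = n then 0 else rho X1 X2 X3 X4 s + 1 := by
  have := s.2
  have := X4.2
  rw [Fin.lt_def] at *
  rw [finRotate_val]
  apply rho_rot h12.le h23 h34 X4.2 s.2
  have e1 := swap_cases X2 X4 s
  have e2 := swap_cases X1 X3 (Equiv.swap X2 X4 s)
  generalize ((Equiv.swap X1 X3 (Equiv.swap X2 X4 s) : Fin n) : ℕ) = r at *
  generalize ((Equiv.swap X2 X4 s : Fin n) : ℕ) = r' at *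
  rcases e1 with e1 | e1 | e1 <;> rcases e2 with e2 | e2 | e2 <;> omega

lemma rho_rot2 {n : ℕ} {X1 X2 X3 X4 : Fin n} (h12 : X1 ≤ X2) (h23 : X2 < X3) (h34 : X3 < X4)
    (s : Fin n) : rho X1 X2 X3 X4 (finRotate n (Equiv.swap X2 X4 (Equiv.swap X1 X3 s)) : Fin n) =
      if rho X1 X2 X3 X4 s + 1 = n then 0 else rho X1 X2 X3 X4 s + 1 := by
  have := s.2
  have := X4.2
  rw [Fin.lt_def] at *
  rw [Fin.le_def] at h12
  rw [finRotate_val]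
  apply rho_rot h12 h23 h34 X4.2 s.2
  have e1 := swap_cases X1 X3 s
  have e2 := swap_cases X2 X4 (Equiv.swap X1 X3 s)
  generalize ((Equiv.swap X2 X4 (Equiv.swap X1 X3 s) : Fin n) : ℕ) = r at *
  generalize ((Equiv.swap X1 X3 s : Fin n) : ℕ) = r' at *
  rcases e1 with e1 | e1 | e1 <;> rcases e2 with e2 | e2 | e2 <;> omega

lemma conj_of_rot {n : ℕ} {σ π : Equiv.Perm (Fin n)}
    (h : ∀ s, (σ (π s) : ℕ) = if (σ s : ℕ) + 1 = n then 0 else (σ s : ℕ) + 1) :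
    σ * π * σ⁻¹ = finRotate n := by
  rw [mul_inv_eq_iff_eq_mul]
  ext s
  rw [Equiv.Perm.mul_apply, Equiv.Perm.mul_apply, h, finRotate_val]

lemma finRotate_long (n : ℕ) : IsLongCycle (finRotate n) := by
  unfold IsLongCycle
  rcases n with _ | _ | n
  · constructor
    · exact ⟨fun x => x.elim0, fun x => x.elim0, fun x => x.elim0⟩
    · intro x; exact x.elim0
  · constructor
    · exact Set.bijOn_univ.mpr (Equiv.bijective _)
    · intro x _ y _; rw [show x = y from Fin.ext (by omega)]
  · have h := (isCycle_finRotate (n := n)).isCycleOn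
    have hs := support_finRotate (n := n)
    have : {x | finRotate (n+2) x ≠ x} = Set.univ := by
      ext x
      simp only [Set.mem_ofPred_eq, Set.mem_univ, iff_true]
      rw [← Equiv.Perm.mem_support, hs]; simp
    rwa [this] at h

lemma long_of_conj {n : ℕ} {σ π : Equiv.Perm (Fin n)} (h : σ * π * σ⁻¹ = finRotate n) :
    IsLongCycle π := by
  have h1 : π = σ⁻¹ * finRotate n * σ⁻¹⁻¹ := by rw [← h]; group
  have h2 := (finRotate_long n).conj (g := σ⁻¹)
  unfold IsLongCycle
  rw [h1]
  convert h2 using 1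
  simp

lemma conj_unique {n : ℕ} {σ τ π : Equiv.Perm (Fin n)}
    (hσ0 : ∀ h0 : 0 < n, σ ⟨0, h0⟩ = ⟨0, h0⟩) (hτ0 : ∀ h0 : 0 < n, τ ⟨0, h0⟩ = ⟨0, h0⟩)
    (hσ : σ * π * σ⁻¹ = finRotate n) (hτ : τ * π * τ⁻¹ = finRotate n) : σ = τ := by
  have key : ∀ k : ℕ, ∀ hk : k < n, (τ * σ⁻¹) ⟨k, hk⟩ = ⟨k, hk⟩ := by
    intro k
    induction k with
    | zero =>
      intro hk
      have : σ⁻¹ ⟨0, hk⟩ = ⟨0, hk⟩ := by rw [Equiv.Perm.inv_eq_iff_eq, hσ0 hk]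
      rw [Equiv.Perm.mul_apply, this, hτ0 hk]
    | succ k ih =>
      intro hk
      have e : (⟨k+1, hk⟩ : Fin n) = finRotate n ⟨k, by omega⟩ := by
        ext; rw [finRotate_val, if_neg (by simp; omega)]
      have hc : τ * σ⁻¹ * finRotate n = finRotate n * (τ * σ⁻¹) := by
        rw [← hσ]
        conv_rhs => rw [hσ, ← hτ]
        group
      rw [e, ← Equiv.Perm.mul_apply, hc, Equiv.Perm.mul_apply, ih]
  have : τ * σ⁻¹ = 1 := by
    ext ⟨k, hk⟩
    rw [key k hk]; rfl
  exact (mul_inv_eq_one.mp this).symm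

lemma exu_of_conj {n : ℕ} {σ π : Equiv.Perm (Fin n)}
    (hσ0 : ∀ h0 : 0 < n, σ ⟨0, h0⟩ = ⟨0, h0⟩) (hσ : σ * π * σ⁻¹ = finRotate n) :
    ∃! σ : Equiv.Perm (Fin n), (∀ h0 : 0 < n, σ ⟨0, h0⟩ = ⟨0, h0⟩) ∧ σ * π * σ⁻¹ = finRotate n :=
  ⟨σ, ⟨hσ0, hσ⟩, fun _ h => conj_unique h.1 hσ0 h.2 hσ⟩

lemma not_long_of_inv {n : ℕ} {π : Equiv.Perm (Fin n)} (S : Set (Fin n))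
    (hS : ∀ s ∈ S, π s ∈ S) {x y : Fin n} (hx : x ∈ S) (hy : y ∉ S) : ¬ IsLongCycle π := by
  intro h
  have h1 : π.SameCycle x y := h.2 (Set.mem_univ x) (Set.mem_univ y)
  obtain ⟨k, hk⟩ := h1.exists_nat_pow_eq
  have : ∀ k : ℕ, (π ^ k) x ∈ S := by
    intro k
    induction k with
    | zero => simpa using hx
    | succ k ih => rw [pow_succ', Equiv.Perm.mul_apply]; exact hS _ ih
  exact hy (hk ▸ this k)

lemma not_long_case {n : ℕ} {p1 q1 b' c' : Fin n} (h1 : p1 ≤ q1) (h2 : q1 < b') (h3 : b' < c') :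
    ¬ IsLongCycle (finRotate n * Equiv.swap q1 b' * Equiv.swap p1 c') := by
  apply not_long_of_inv {s | s ≤ p1 ∨ c' < s} (x := p1) (y := c')
  · intro s hs
    rw [Fin.lt_def] at *
    simp only [Set.mem_ofPred_eq, Fin.le_def, Fin.lt_def, Equiv.Perm.mul_apply] at hs h1 ⊢
    rw [finRotate_val]
    have := s.2
    have e1 := swap_cases p1 c' s
    have e2 := swap_cases q1 b' (Equiv.swap p1 c' s)
    split_ifs <;> omega
  · simp
  · rw [Fin.lt_def] at *
    simp only [Set.mem_ofPred_eq, Fin.le_def, Fin.lt_def] at h1 ⊢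
    omega

/-! ### insertion -/

lemma insertIdx_append_len {α : Type*} (A R : List α) (x : α) :
    (A ++ R).insertIdx A.length x = A ++ x :: R := by
  induction A with
  | nil => simp
  | cons a A ih => simp [ih]

lemma insert_split {α : Type*} (F : List α) {v w : ℕ} (hvw : v < w) (hw : w < F.length + 2) :
    ∃ A B C : List α, F = A ++ (B ++ C) ∧ A.length = v ∧ A.length + B.length + 1 = w ∧
      ∀ t t' : α, (F.insertIdx v t).insertIdx w t' = A ++ t :: (B ++ t' :: C) := by
  have h1 : F = F.take v ++ ((F.drop v).take (w - 1 - v) ++ (F.drop v).drop (w - 1 - v)) := by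
    rw [List.take_append_drop, List.take_append_drop]
  have h2 : (F.take v).length = v := by rw [List.length_take]; omega
  have h3 : (F.take v).length + ((F.drop v).take (w - 1 - v)).length + 1 = w := by
    rw [List.length_take, List.length_take, List.length_drop]; omega
  refine ⟨F.take v, (F.drop v).take (w - 1 - v), (F.drop v).drop (w - 1 - v), h1, h2, h3, ?_⟩
  intro t t'
  generalize F.take v = A at *
  generalize (F.drop v).take (w - 1 - v) = B at *
  generalize (F.drop v).drop (w - 1 - v) = C at *
  subst h1
  rw [← h2, insertIdx_append_len, ← h3]
  have := insertIdx_append_len (A ++ t :: B) C t'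
  simpa [Nat.add_assoc] using this

section ins
variable {n : ℕ} (A B C : List (Equiv.Perm (Fin n))) (t t' : Equiv.Perm (Fin n)) (u : Fin n)

lemma Pt_ins1 {i : ℕ} (hi : i ≤ A.length) :
    Pt (A ++ t :: (B ++ t' :: C)) u i = Pt (A ++ (B ++ C)) u i := by
  rw [Pt, Pt, List.take_append_of_le_length hi, List.take_append_of_le_length hi]

lemma Pt_ins2 {i : ℕ} (hi : A.length < i) (hi2 : i ≤ A.length + B.length + 1) :
    Pt (A ++ t :: (B ++ t' :: C)) u i =
      ((prodLR A)⁻¹ * t⁻¹ * prodLR A) (Pt (A ++ (B ++ C)) u (i-1)) := by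
  obtain ⟨k, rfl⟩ : ∃ k, i = A.length + (k + 1) := ⟨i - A.length - 1, by omega⟩
  rw [Pt, Pt, show A.length + (k+1) - 1 = A.length + k by omega, List.take_length_add_append,
    List.take_length_add_append, List.take_succ_cons,
    List.take_append_of_le_length (by omega), List.take_append_of_le_length (by omega),
    prodLR_append, prodLR_append, prodLR_cons]
  simp

lemma Pt_ins3 {i : ℕ} (hi : A.length + B.length + 1 < i) :
    Pt (A ++ t :: (B ++ t' :: C)) u i =
      ((prodLR A)⁻¹ * t⁻¹ * prodLR A) (((prodLR (A ++ B))⁻¹ * t'⁻¹ * prodLR (A ++ B))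
        (Pt (A ++ (B ++ C)) u (i-2))) := by
  obtain ⟨k, rfl⟩ : ∃ k, i = A.length + (B.length + (k + 1) + 1) :=
    ⟨i - A.length - B.length - 2, by omega⟩
  rw [Pt, Pt, show A.length + (B.length + (k + 1) + 1) - 2 = A.length + (B.length + k) by omega,
    List.take_length_add_append,
    List.take_length_add_append, List.take_succ_cons, List.take_length_add_append,
    List.take_length_add_append, List.take_succ_cons]
  simp [prodLR_append, prodLR_cons]

lemma prodLR_ins : prodLR (A ++ t :: (B ++ t' :: C)) =
    prodLR (A ++ (B ++ C)) * ((prodLR (A ++ B))⁻¹ * t' * prodLR (A ++ B)) *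
      ((prodLR A)⁻¹ * t * prodLR A) := by
  simp only [prodLR_append, prodLR_cons]
  group

end ins

lemma conj_swap' {n : ℕ} (π : Equiv.Perm (Fin n)) (a b : Fin n) :
    π⁻¹ * Equiv.swap a b * π = Equiv.swap (π⁻¹ a) (π⁻¹ b) := by
  have := Equiv.mul_swap_eq_swap_mul π⁻¹ a b
  rw [this]; group

lemma Pt_map_conj {n : ℕ} (σ : Equiv.Perm (Fin n)) (l : List (Equiv.Perm (Fin n))) (u : Fin n) (i : ℕ) :
    Pt (l.map fun t => σ * t * σ⁻¹) (σ u) i = σ (Pt l u i) := by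
  rw [Pt, Pt, ← List.map_take, prodLR_map_conj]
  simp

lemma isSwap_conj {n : ℕ} (σ t : Equiv.Perm (Fin n)) (h : t.IsSwap) : (σ * t * σ⁻¹).IsSwap := by
  obtain ⟨x, y, hxy, rfl⟩ := h
  refine ⟨σ x, σ y, by simpa using hxy, ?_⟩
  rw [Equiv.mul_swap_eq_swap_mul]; group


/-- candidate list -/
def Lof {n : ℕ} (ty : Bool) (F : List (Equiv.Perm (Fin n))) (p : Param n) : List (Equiv.Perm (Fin n)) :=
  if ty then (F.insertIdx p.1.1 (Equiv.swap p.2.1 p.2.2.2)).insertIdx p.1.2 (Equiv.swap p.2.1 p.2.2.1)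
  else (F.insertIdx p.1.1 (Equiv.swap p.2.1 p.2.2.1)).insertIdx p.1.2 (Equiv.swap p.2.1 p.2.2.2)

lemma lamDet_of_true {n : ℕ} {F : List (Equiv.Perm (Fin n))} {p : Param n} {σ : Equiv.Perm (Fin n)}
    (hσ0 : ∀ h0 : 0 < n, σ ⟨0, h0⟩ = ⟨0, h0⟩)
    (hσ : σ * prodLR (Lof true F p) * σ⁻¹ = finRotate n) :
    lamDet n F p = some ((Lof true F p).map fun t => σ * t * σ⁻¹) := by
  have hl : IsLongCycle (prodLR (Lof true F p)) := long_of_conj hσ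
  have hex := exu_of_conj hσ0 hσ
  have he : hex.choose = σ := conj_unique hex.choose_spec.1.1 hσ0 hex.choose_spec.1.2 hσ
  unfold lamDet
  simp only [Lof, if_true] at hl hex he ⊢
  rw [if_pos hl, Option.bind_some, dif_pos hex, he]

lemma lamDet_of_false {n : ℕ} {F : List (Equiv.Perm (Fin n))} {p : Param n} {σ : Equiv.Perm (Fin n)}
    (hσ0 : ∀ h0 : 0 < n, σ ⟨0, h0⟩ = ⟨0, h0⟩) (hn : ¬ IsLongCycle (prodLR (Lof true F p)))
    (hσ : σ * prodLR (Lof false F p) * σ⁻¹ = finRotate n) :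
    lamDet n F p = some ((Lof false F p).map fun t => σ * t * σ⁻¹) := by
  have hl : IsLongCycle (prodLR (Lof false F p)) := long_of_conj hσ
  have hex := exu_of_conj hσ0 hσ
  have he : hex.choose = σ := conj_unique hex.choose_spec.1.1 hσ0 hex.choose_spec.1.2 hσ
  unfold lamDet
  simp only [Lof, if_true] at hl hex he hn ⊢
  rw [if_neg hn]
  simp only [Bool.false_eq_true, if_false] at hl hex he ⊢
  rw [if_pos hl, Option.bind_some, dif_pos hex, he]

/-- separation -/
def Sepa {n : ℕ} (F : List (Equiv.Perm (Fin n))) (v w : ℕ) (a b : Fin n) : Prop :=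
  Pt F a v < Pt F b v ∧ Pt F a v < Pt F b (w-1) ∧ Pt F a (w-1) < Pt F b v ∧ Pt F a (w-1) < Pt F b (w-1)

/-- good pairs -/
def Good {n : ℕ} (F : List (Equiv.Perm (Fin n))) (p : Param n) : Prop :=
  Mono F p.2.1 ∧ Sepa F p.1.1 p.1.2 p.2.1 p.2.2.1 ∧ Sepa F p.1.1 p.1.2 p.2.2.1 p.2.2.2

/-- decoding data -/
def Dec {n : ℕ} (ty : Bool) (x : List (Equiv.Perm (Fin n))) (v w : ℕ) : Prop :=
  if ty then ∃ u, Desc x u v ∧ Pt x u w < Pt x u (v+1) ∧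
    ∀ i ≤ x.length, (i ≤ v ∨ w < i) → Pt x u (v+1) ≤ Pt x u i
  else ∃ u, Desc x u w ∧ Pt x u v < Pt x u (w+1) ∧
    ∀ i, v < i → i ≤ w → Pt x u (w+1) ≤ Pt x u i

lemma rho_0 (x1 x2 x3 x4 : ℕ) : rho x1 x2 x3 x4 0 = 0 := by simp [rho]
lemma rho_1 (x1 x2 x3 x4 : ℕ) : rho x1 x2 x3 x4 x1 = x1 := by simp [rho]
lemma rho_2 {x1 x2 x3 x4 s : ℕ} (h1 : x1 < s) (h2 : s ≤ x2) : rho x1 x2 x3 x4 s = s + (x4 - x2) := by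
  simp [rho, h2, not_le.mpr h1]
lemma rho_3 {x1 x2 x3 x4 : ℕ} (h12 : x1 ≤ x2) (h23 : x2 < x3) (h34 : x3 < x4) :
    rho x1 x2 x3 x4 x3 = x4 - x2 + x1 := by
  unfold rho
  split_ifs <;> omega
lemma rho_4 {x1 x2 x3 x4 : ℕ} (h12 : x1 ≤ x2) (h23 : x2 < x3) (h34 : x3 < x4) :
    rho x1 x2 x3 x4 x4 = x4 - x3 + x1 := by
  unfold rho
  split_ifs <;> omega

lemma length_Lof {n : ℕ} (ty : Bool) {F : List (Equiv.Perm (Fin n))} {p : Param n}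
    (hvw : p.1.1 < p.1.2) (hw : p.1.2 < F.length + 2) : (Lof ty F p).length = F.length + 2 := by
  obtain ⟨A, B, C, hF, hA, hB, hL⟩ := insert_split F hvw hw
  unfold Lof
  rw [hL, hL]
  rw [hF]
  split_ifs <;> simp <;> omega

lemma swaps_Lof {n : ℕ} (ty : Bool) {F : List (Equiv.Perm (Fin n))} {p : Param n}
    (hs : ∀ t ∈ F, t.IsSwap)
    (hvw : p.1.1 < p.1.2) (hw : p.1.2 < F.length + 2)  (hab : p.2.1 < p.2.2.1) (hbc : p.2.2.1 < p.2.2.2) :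
    ∀ t ∈ Lof ty F p, t.IsSwap := by
  obtain ⟨A, B, C, hF, hA, hB, hL⟩ := insert_split F hvw hw
  have h1 : (Equiv.swap p.2.1 p.2.2.1).IsSwap := ⟨_, _, hab.ne, rfl⟩
  have h2 : (Equiv.swap p.2.1 p.2.2.2).IsSwap := ⟨_, _, (hab.trans hbc).ne, rfl⟩
  unfold Lof
  rw [hL, hL]
  rw [hF] at hs
  intro t ht
  simp only [List.mem_append] at hs
  split_ifs at ht <;> simp only [List.mem_append, List.mem_cons] at ht
  all_goals
    rcases ht with ht | rfl | ht | rfl | ht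
    · exact hs t (Or.inl ht)
    · assumption
    · exact hs t (Or.inr (Or.inl ht))
    · assumption
    · exact hs t (Or.inr (Or.inr ht))

lemma prodLR_Lof {n : ℕ} {F : List (Equiv.Perm (Fin n))} {p : Param n}
    (hvw : p.1.1 < p.1.2) (hw : p.1.2 < F.length + 2) :
    prodLR (Lof true F p) = prodLR F * Equiv.swap (Pt F p.2.1 (p.1.2-1)) (Pt F p.2.2.1 (p.1.2-1)) *
       Equiv.swap (Pt F p.2.1 p.1.1) (Pt F p.2.2.2 p.1.1) ∧
    prodLR (Lof false F p) = prodLR F * Equiv.swap (Pt F p.2.1 (p.1.2-1)) (Pt F p.2.2.2 (p.1.2-1)) *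
       Equiv.swap (Pt F p.2.1 p.1.1) (Pt F p.2.2.1 p.1.1) := by
  obtain ⟨A, B, C, hF, hA, hB, hL⟩ := insert_split F hvw hw
  unfold Lof
  simp only [hL, if_true, Bool.false_eq_true, if_false]
  rw [prodLR_ins, prodLR_ins]
  have e1 : ∀ u, (prodLR A)⁻¹ u = Pt F u p.1.1 := by
    intro u; rw [Pt, hF, ← hA, List.take_left]
  have e2 : ∀ u, (prodLR (A ++ B))⁻¹ u = Pt F u (p.1.2 - 1) := by
    intro u; rw [Pt, hF, ← hB, ← List.append_assoc, Nat.add_sub_cancel, ← List.length_append, List.take_left]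
  simp only [conj_swap', e1, e2, ← hF, and_self]

lemma Pt_Lof {n : ℕ} {F : List (Equiv.Perm (Fin n))} {p : Param n}
    (hvw : p.1.1 < p.1.2) (hw : p.1.2 < F.length + 2) (ty : Bool) (u : Fin n) :
    (∀ i ≤ p.1.1, Pt (Lof ty F p) u i = Pt F u i) ∧
    (∀ i, p.1.1 < i → i ≤ p.1.2 → Pt (Lof ty F p) u i =
      Equiv.swap (Pt F p.2.1 p.1.1) (Pt F (if ty then p.2.2.2 else p.2.2.1) p.1.1) (Pt F u (i-1))) ∧
    (∀ i, p.1.2 < i → Pt (Lof ty F p) u i =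
      Equiv.swap (Pt F p.2.1 p.1.1) (Pt F (if ty then p.2.2.2 else p.2.2.1) p.1.1)
       (Equiv.swap (Pt F p.2.1 (p.1.2-1)) (Pt F (if ty then p.2.2.1 else p.2.2.2) (p.1.2-1))
         (Pt F u (i-2)))) := by
  obtain ⟨A, B, C, hF, hA, hB, hL⟩ := insert_split F hvw hw
  have e1 : ∀ u, (prodLR A)⁻¹ u = Pt F u p.1.1 := by
    intro u; rw [Pt, hF, ← hA, List.take_left]
  have e2 : ∀ u, (prodLR (A ++ B))⁻¹ u = Pt F u (p.1.2 - 1) := by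
    intro u; rw [Pt, hF, ← hB, ← List.append_assoc, Nat.add_sub_cancel, ← List.length_append, List.take_left]
  have hL2 : Lof ty F p = A ++ (Equiv.swap p.2.1 (if ty then p.2.2.2 else p.2.2.1)) ::
      (B ++ (Equiv.swap p.2.1 (if ty then p.2.2.1 else p.2.2.2)) :: C) := by
    unfold Lof; rw [hL, hL]; cases ty <;> simp
  rw [hL2]
  refine ⟨fun i hi => ?_, fun i hi hi2 => ?_, fun i hi => ?_⟩
  · rw [Pt_ins1 _ _ _ _ _ _ (by omega), ← hF]
  · rw [Pt_ins2 _ _ _ _ _ _ (by omega) (by omega), Equiv.swap_inv, conj_swap', ← hF, e1, e1]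
  · rw [Pt_ins3 _ _ _ _ _ _ (by omega), Equiv.swap_inv, conj_swap', ← hF, e1, e1, Equiv.swap_inv,
      conj_swap', e2, e2]

lemma good_main {n g : ℕ} {F : List (Equiv.Perm (Fin n))} {p : Param n} (hg : 1 ≤ g)
    (hF : F ∈ Fcal n (g-1)) (hp : paramOK n g p) (hG : Good F p) :
    ∃ x ty, lamDet n F p = some x ∧ x ∈ Fcal n g ∧
      (∃ σ : Equiv.Perm (Fin n), (∀ h0 : 0 < n, σ ⟨0, h0⟩ = ⟨0, h0⟩) ∧
        x = (Lof ty F p).map fun t => σ * t * σ⁻¹) ∧ Dec ty x p.1.1 p.1.2 := by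
  obtain ⟨hlen, hs, hprod⟩ := hF
  obtain ⟨hvw, hw, hab, hbc⟩ := hp
  have hw2 : p.1.2 < F.length + 2 := by omega
  obtain ⟨hM, ⟨sab1, sab2, sab3, sab4⟩, sbc1, sbc2, sbc3, sbc4⟩ := hG
  obtain ⟨f, hfl, hf0, hM1, hM2⟩ := Mono_spec hprod hM
  obtain ⟨P1, P2⟩ := prodLR_Lof hvw hw2
  have inF : ∀ ty (σ : Equiv.Perm (Fin n)), σ * prodLR (Lof ty F p) * σ⁻¹ = finRotate n →
      ((Lof ty F p).map fun t => σ * t * σ⁻¹) ∈ Fcal n g := by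
    intro ty σ h
    refine ⟨?_, ?_, ?_⟩
    · rw [List.length_map, length_Lof ty hvw hw2]; omega
    · intro t ht
      rw [List.mem_map] at ht
      obtain ⟨s, hs', rfl⟩ := ht
      exact isSwap_conj _ _ (swaps_Lof ty hs hvw hw2 hab hbc s hs')
    · rw [prodLR_map_conj, h]
  by_cases hc : Pt F p.2.1 (p.1.2-1) < Pt F p.2.1 p.1.1
  · -- first case
    obtain ⟨σ, hσ⟩ := exists_rho (n := n) (x1 := Pt F p.2.1 (p.1.2-1)) (x2 := Pt F p.2.1 p.1.1)
      (x3 := Pt F p.2.2.1 (p.1.2-1)) (x4 := Pt F p.2.2.2 p.1.1) hc.le sab2 sbc3 (Fin.is_lt _)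
    have hσ0 : ∀ h0 : 0 < n, σ ⟨0, h0⟩ = ⟨0, h0⟩ := by
      intro h0; ext; rw [hσ]; exact rho_0 _ _ _ _
    have hconj : σ * prodLR (Lof true F p) * σ⁻¹ = finRotate n := by
      apply conj_of_rot
      intro s
      rw [hσ, hσ, P1, hprod]
      exact rho_rot1 hc sab2 sbc3 s
    refine ⟨_, true, lamDet_of_true hσ0 hconj, inF true σ hconj, ⟨σ, hσ0, rfl⟩, ?_⟩
    obtain ⟨Q1, Q2, Q3⟩ := Pt_Lof hvw hw2 true p.2.1
    simp only [if_true] at Q2 Q3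
    have hfv : p.1.1 < f := by
      by_contra! h
      have := (hM2 p.1.1 (p.1.2-1) h (by omega) (by omega)).1
      exact absurd this (not_le.mpr hc)
    have hfw : f ≤ p.1.2 - 1 := by
      by_contra! h
      have := (hM1 p.1.1 (p.1.2-1) (by omega) h).2
      exact absurd this (not_le.mpr hc)
    have ev1 : Pt (Lof true F p) p.2.1 (p.1.1 + 1) = Pt F p.2.2.2 p.1.1 := by
      rw [Q2 _ (by omega) (by omega), Nat.add_sub_cancel, Equiv.swap_apply_left]
    have ew : Pt (Lof true F p) p.2.1 p.1.2 = Pt F p.2.1 (p.1.2-1) := by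
      rw [Q2 _ (by omega) (by omega), Equiv.swap_apply_of_ne_of_ne hc.ne]
      exact (sab4.trans sbc3).ne
    have r1 := rho_1 (Pt F p.2.1 (p.1.2-1)) (Pt F p.2.1 p.1.1) (Pt F p.2.2.1 (p.1.2-1)) (Pt F p.2.2.2 p.1.1)
    have r3 := rho_3 (x1 := Pt F p.2.1 (p.1.2-1)) (x2 := Pt F p.2.1 p.1.1)
      (x3 := Pt F p.2.2.1 (p.1.2-1)) (x4 := Pt F p.2.2.2 p.1.1) hc.le sab2 sbc3
    have r4 := rho_4 (x1 := Pt F p.2.1 (p.1.2-1)) (x2 := Pt F p.2.1 p.1.1)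
      (x3 := Pt F p.2.2.1 (p.1.2-1)) (x4 := Pt F p.2.2.2 p.1.1) hc.le sab2 sbc3
    rw [Fin.lt_def] at hc sab2 sbc3
    simp only [Dec, if_true]
    refine ⟨σ p.2.1, ⟨?_, ?_⟩, ?_, ?_⟩
    · rw [List.length_map, length_Lof true hvw hw2]; omega
    · rw [Pt_map_conj, Pt_map_conj, ev1, Q1 _ le_rfl, Fin.lt_def, hσ, hσ, r4, rho_2 hc le_rfl]
      omega
    · rw [Pt_map_conj, Pt_map_conj, ev1, ew, Fin.lt_def, hσ, hσ, r4, r1]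
      omega
    · intro i hi hi2
      rw [List.length_map, length_Lof true hvw hw2] at hi
      rw [Pt_map_conj, Pt_map_conj, ev1, Fin.le_def, hσ, hσ, r4]
      rcases hi2 with hi2 | hi2
      · rw [Q1 i hi2]
        have h1 := hM1 i p.1.1 hi2 hfv
        have h2 := (hM2 (p.1.2-1) (p.1.2-1) hfw le_rfl (by omega)).2
        rw [Fin.le_def, Fin.le_def] at h1
        rw [Fin.lt_def] at h2
        rw [rho_2 (by omega) h1.2]
        omega
      · rw [Q3 i hi2]
        have h1 := hM2 (p.1.2-1) (i-2) hfw (by omega) (by omega)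
        have h2 := (hM1 p.1.1 p.1.1 le_rfl hfv).1
        by_cases e : Pt F p.2.1 (i-2) = Pt F p.2.1 (p.1.2-1)
        · rw [e, Equiv.swap_apply_left, Equiv.swap_apply_of_ne_of_ne, r3]
          · omega
          · exact Fin.ne_of_gt sab2
          · exact Fin.ne_of_lt sbc3
        · have h3 := lt_of_le_of_ne h1.1 (Ne.symm e)
          rw [Fin.le_def] at h2
          rw [Fin.lt_def] at h3 h1
          rw [Equiv.swap_apply_of_ne_of_ne e, Equiv.swap_apply_of_ne_of_ne, rho_2 h3]
          · omega
          · omega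
          · apply Fin.ne_of_lt; rw [Fin.lt_def]; omega
          · apply Fin.ne_of_lt; rw [Fin.lt_def]; omega
          · apply Fin.ne_of_lt; rw [Fin.lt_def]; omega
  · -- second case
    push Not at hc
    obtain ⟨σ, hσ⟩ := exists_rho (n := n) (x1 := Pt F p.2.1 p.1.1) (x2 := Pt F p.2.1 (p.1.2-1))
      (x3 := Pt F p.2.2.1 p.1.1) (x4 := Pt F p.2.2.2 (p.1.2-1)) hc sab3 sbc2 (Fin.is_lt _)
    have hσ0 : ∀ h0 : 0 < n, σ ⟨0, h0⟩ = ⟨0, h0⟩ := by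
      intro h0; ext; rw [hσ]; exact rho_0 _ _ _ _
    have hconj : σ * prodLR (Lof false F p) * σ⁻¹ = finRotate n := by
      apply conj_of_rot
      intro s
      rw [hσ, hσ, P2, hprod]
      exact rho_rot2 hc sab3 sbc2 s
    have hnl : ¬ IsLongCycle (prodLR (Lof true F p)) := by
      rw [P1, hprod]
      exact not_long_case hc sab4 sbc3
    refine ⟨_, false, lamDet_of_false hσ0 hnl hconj, inF false σ hconj, ⟨σ, hσ0, rfl⟩, ?_⟩
    obtain ⟨Q1, Q2, Q3⟩ := Pt_Lof hvw hw2 false p.2.1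
    simp only [Bool.false_eq_true, if_false] at Q2 Q3
    have hmid : ∀ i, p.1.1 ≤ i → i ≤ p.1.2 - 1 → Pt F p.2.1 p.1.1 ≤ Pt F p.2.1 i ∧
        Pt F p.2.1 i ≤ Pt F p.2.1 (p.1.2-1) := by
      intro i h1 h2
      by_cases hfv : p.1.1 < f
      · by_cases hfw : p.1.2 - 1 < f
        · exact ⟨(hM1 _ _ h1 (by omega)).2, (hM1 _ _ h2 (by omega)).2⟩
        · exfalso
          have h3 := (hM1 p.1.1 p.1.1 le_rfl hfv).1
          have h4 := (hM2 (p.1.2-1) (p.1.2-1) (by omega) le_rfl (by omega)).2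
          exact absurd (h4.trans_le h3) (not_lt.mpr hc)
      · exact ⟨(hM2 _ _ (by omega) h1 (by omega)).1, (hM2 _ _ (by omega) h2 (by omega)).1⟩
    have ew1 : Pt (Lof false F p) p.2.1 (p.1.2 + 1) = Pt F p.2.2.2 (p.1.2-1) := by
      rw [Q3 _ (by omega), show p.1.2 + 1 - 2 = p.1.2 - 1 by omega, Equiv.swap_apply_left,
        Equiv.swap_apply_of_ne_of_ne]
      · exact (sab2.trans sbc4).ne'
      · exact sbc2.ne'
    have r1 := rho_1 (Pt F p.2.1 p.1.1) (Pt F p.2.1 (p.1.2-1)) (Pt F p.2.2.1 p.1.1) (Pt F p.2.2.2 (p.1.2-1))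
    have r3 := rho_3 (x1 := Pt F p.2.1 p.1.1) (x2 := Pt F p.2.1 (p.1.2-1))
      (x3 := Pt F p.2.2.1 p.1.1) (x4 := Pt F p.2.2.2 (p.1.2-1)) hc sab3 sbc2
    have r4 := rho_4 (x1 := Pt F p.2.1 p.1.1) (x2 := Pt F p.2.1 (p.1.2-1))
      (x3 := Pt F p.2.2.1 p.1.1) (x4 := Pt F p.2.2.2 (p.1.2-1)) hc sab3 sbc2
    rw [Fin.lt_def] at sab3 sbc2
    rw [Fin.le_def] at hc
    have mid : ∀ i, p.1.1 < i → i ≤ p.1.2 →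
        (Pt F p.2.2.2 (p.1.2-1) : ℕ) - Pt F p.2.2.1 p.1.1 + Pt F p.2.1 p.1.1 <
         (σ (Pt (Lof false F p) p.2.1 i) : Fin n) := by
      intro i h1 h2
      rw [Q2 i h1 h2, hσ]
      have h3 := hmid (i-1) (by omega) (by omega)
      by_cases e : Pt F p.2.1 (i-1) = Pt F p.2.1 p.1.1
      · rw [e, Equiv.swap_apply_left, r3]
        omega
      · have h5 := lt_of_le_of_ne h3.1 (Ne.symm e)
        have h4 := h3.2
        rw [Fin.lt_def] at h5
        rw [Fin.le_def] at h4
        rw [Equiv.swap_apply_of_ne_of_ne e, rho_2 h5 h4]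
        · omega
        · apply Fin.ne_of_lt; rw [Fin.lt_def]; omega
    simp only [Dec, Bool.false_eq_true, if_false]
    refine ⟨σ p.2.1, ⟨?_, ?_⟩, ?_, ?_⟩
    · rw [List.length_map, length_Lof false hvw hw2]; omega
    · rw [Pt_map_conj, Pt_map_conj, ew1, Fin.lt_def, hσ, r4]
      exact mid _ hvw le_rfl
    · rw [Pt_map_conj, Pt_map_conj, ew1, Q1 _ le_rfl, Fin.lt_def, hσ, hσ, r4, r1]
      omega
    · intro i h1 h2
      rw [Pt_map_conj, Pt_map_conj, ew1, Fin.le_def, hσ (Pt F p.2.2.2 (p.1.2-1)), r4]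
      exact (mid i h1 h2).le

lemma swap_inj_lt {n : ℕ} {a b a' b' : Fin n} (h : a < b) (h' : a' < b')
    (e : Equiv.swap a b = Equiv.swap a' b') : a = a' ∧ b = b' := by
  have h1 : Equiv.swap a' b' a = b := by rw [← e, Equiv.swap_apply_left]
  have h2 : Equiv.swap a' b' b = a := by rw [← e, Equiv.swap_apply_right]
  rw [Equiv.swap_apply_def] at h1
  split_ifs at h1 with e1 e2
  · exact ⟨e1, h1.symm⟩
  · subst e2; subst h1; exact absurd h (lt_asymm h')
  · exact absurd h1 h.ne

/-- the chosen index -/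
def dix {n : ℕ} (ty : Bool) (p : Param n) : ℕ := if ty then p.1.1 else p.1.2

lemma Dec_Tri {n : ℕ} {ty : Bool} {x : List (Equiv.Perm (Fin n))} {v w : ℕ} (hvw : v < w)
    (hw : w < x.length) (h : Dec ty x v w) : (if ty then v else w) ∈ Tri x := by
  cases ty
  · simp only [Dec, Bool.false_eq_true, if_false] at h ⊢
    obtain ⟨u, h1, h2, h3⟩ := h
    simp only [Tri, Finset.mem_filter, Finset.mem_range]
    exact ⟨hw, u, h1, v, by omega, h2⟩
  · simp only [Dec, if_true] at h ⊢
    obtain ⟨u, h1, h2, h3⟩ := h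
    simp only [Tri, Finset.mem_filter, Finset.mem_range]
    exact ⟨by omega, u, h1, w, by omega, h2⟩

lemma Dec_unique {n : ℕ} {ty ty' : Bool} {x : List (Equiv.Perm (Fin n))} (hs : ∀ t ∈ x, t.IsSwap)
    {v w v' w' : ℕ} (hvw : v < w) (hw : w < x.length) (hvw' : v' < w') (hw' : w' < x.length)
    (h : Dec ty x v w) (h' : Dec ty' x v' w')
    (e : (if ty then v else w) = (if ty' then v' else w')) : ty = ty' ∧ v = v' ∧ w = w' := by
  cases ty <;> cases ty' <;> simp only [Dec, Bool.false_eq_true, if_false, if_true] at h h' e ⊢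
  · subst e
    obtain ⟨u, h1, h2, h3⟩ := h
    obtain ⟨u', h1', h2', h3'⟩ := h'
    have := Desc_unique hs h1 h1'
    subst this
    refine ⟨trivial, ?_, rfl⟩
    rcases lt_trichotomy v v' with hh | hh | hh
    · exact absurd h2' (not_lt.mpr (h3 v' hh (by omega)))
    · exact hh
    · exact absurd h2 (not_lt.mpr (h3' v hh (by omega)))
  · subst e
    obtain ⟨u, h1, h2, h3⟩ := h
    obtain ⟨u', h1', h2', h3'⟩ := h'
    have := Desc_unique hs h1 h1'
    subst this
    exact absurd h2 (not_lt.mpr (h3' v (by omega) (by omega)))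
  · subst e
    obtain ⟨u, h1, h2, h3⟩ := h
    obtain ⟨u', h1', h2', h3'⟩ := h'
    have := Desc_unique hs h1 h1'
    subst this
    exact absurd h2' (not_lt.mpr (h3 v' (by omega) (by omega)))
  · subst e
    obtain ⟨u, h1, h2, h3⟩ := h
    obtain ⟨u', h1', h2', h3'⟩ := h'
    have := Desc_unique hs h1 h1'
    subst this
    refine ⟨trivial, rfl, ?_⟩
    rcases lt_trichotomy w w' with hh | hh | hh
    · exact absurd h2' (not_lt.mpr (h3 w' (by omega) (by omega)))
    · exact hh
    · exact absurd h2 (not_lt.mpr (h3' w (by omega) (by omega)))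

lemma Lof_inj {n : ℕ} {ty : Bool} {F F' : List (Equiv.Perm (Fin n))} {p p' : Param n}
    (hF : prodLR F = finRotate n) (hF' : prodLR F' = finRotate n) (hlen : F.length = F'.length)
    (hpos : p.1 = p'.1) (hvw : p.1.1 < p.1.2) (hw : p.1.2 < F.length + 2)
    (hab : p.2.1 < p.2.2.1) (hbc : p.2.2.1 < p.2.2.2)
    (hab' : p'.2.1 < p'.2.2.1) (hbc' : p'.2.2.1 < p'.2.2.2) {σ σ' : Equiv.Perm (Fin n)}
    (hσ0 : ∀ h0 : 0 < n, σ ⟨0, h0⟩ = ⟨0, h0⟩) (hσ0' : ∀ h0 : 0 < n, σ' ⟨0, h0⟩ = ⟨0, h0⟩)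
    (e : (Lof ty F p).map (fun t => σ * t * σ⁻¹) = (Lof ty F' p').map (fun t => σ' * t * σ'⁻¹)) :
    F = F' ∧ p = p' := by
  obtain ⟨A, B, C, hA1, hA, hB, hL⟩ := insert_split F hvw hw
  obtain ⟨A', B', C', hA1', hA', hB', hL'⟩ := insert_split F' (hpos ▸ hvw) (hpos ▸ hlen ▸ hw)
  set f : Equiv.Perm (Fin n) → Equiv.Perm (Fin n) := fun t => σ * t * σ⁻¹ with hf
  set f' : Equiv.Perm (Fin n) → Equiv.Perm (Fin n) := fun t => σ' * t * σ'⁻¹ with hf'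
  have hA2 : A.length = A'.length := by rw [hA, hA', hpos]
  have hB2 : B.length = B'.length := by
    have := congrArg Prod.snd hpos
    omega
  have key : ∀ t t' s s', (A ++ t :: (B ++ t' :: C)).map f = (A' ++ s :: (B' ++ s' :: C')).map f' →
      F = F' ∧ t = s ∧ t' = s' := by
    intro t t' s s' h
    simp only [List.map_append, List.map_cons] at h
    obtain ⟨h1, h2⟩ := List.append_inj h (by simpa using hA2)
    obtain ⟨h2, h3⟩ := List.cons_eq_cons.mp h2
    obtain ⟨h3, h4⟩ := List.append_inj h3 (by simpa using hB2)
    obtain ⟨h4, h5⟩ := List.cons_eq_cons.mp h4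
    have hFF : F.map f = F'.map f' := by
      rw [hA1, hA1']; simp only [List.map_append, h1, h3, h5]
    have hpp : σ * finRotate n * σ⁻¹ = σ' * finRotate n * σ'⁻¹ := by
      have := congrArg prodLR hFF
      rwa [hf, hf', prodLR_map_conj, prodLR_map_conj, hF, hF'] at this
    have hinv0 : ∀ τ : Equiv.Perm (Fin n), (∀ h0 : 0 < n, τ ⟨0, h0⟩ = ⟨0, h0⟩) →
        (∀ h0 : 0 < n, τ⁻¹ ⟨0, h0⟩ = ⟨0, h0⟩) := by
      intro τ hτ h0
      rw [Equiv.Perm.inv_eq_iff_eq, hτ h0]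
    have hσσ : σ = σ' := by
      have := conj_unique (hinv0 σ hσ0) (hinv0 σ' hσ0') (π := σ * finRotate n * σ⁻¹)
        (by group) (by rw [hpp]; group)
      exact inv_injective this
    subst hσσ
    have hfi : Function.Injective f := by
      intro a b hab
      simpa [hf] using hab
    exact ⟨List.map_injective_iff.mpr hfi hFF, hfi h2, hfi h4⟩
  obtain ⟨⟨v, w⟩, a, b, c⟩ := p
  obtain ⟨⟨v', w'⟩, a', b', c'⟩ := p'
  simp only at hpos hab hbc hab' hbc' hvw hw hL hL'
  cases ty
  · simp only [Lof, Bool.false_eq_true, if_false] at e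
    rw [hL, hL'] at e
    obtain ⟨h1, h2, h3⟩ := key _ _ _ _ e
    obtain ⟨rfl, rfl⟩ := swap_inj_lt hab hab' h2
    obtain ⟨-, rfl⟩ := swap_inj_lt (hab.trans hbc) (hab.trans hbc') h3
    exact ⟨h1, by rw [hpos]⟩
  · simp only [Lof, if_true] at e
    rw [hL, hL'] at e
    obtain ⟨h1, h2, h3⟩ := key _ _ _ _ e
    obtain ⟨rfl, rfl⟩ := swap_inj_lt hab hab' h3
    obtain ⟨-, rfl⟩ := swap_inj_lt (hab.trans hbc) (hab.trans hbc') h2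
    exact ⟨h1, by rw [hpos]⟩

/-- the good pairs have fibres of size at most `2g`. -/
lemma good_fibre {n g : ℕ} (hg : 1 ≤ g) (x : List (Equiv.Perm (Fin n))) (hx : x ∈ Fcal n g)
    (S : Finset (List (Equiv.Perm (Fin n)) × Param n))
    (hS : ∀ q ∈ S, q.1 ∈ Fcal n (g-1) ∧ paramOK n g q.2 ∧ Good q.1 q.2 ∧ lamDet n q.1 q.2 = some x) :
    S.card ≤ 2 * g := by
  have h1 := card_Tri hx.2.1 hx.2.2
  have h2 := hx.1
  suffices S.card ≤ (Tri x).card by omega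
  have key : ∀ q ∈ S, ∃ ty, (∃ σ : Equiv.Perm (Fin n), (∀ h0 : 0 < n, σ ⟨0, h0⟩ = ⟨0, h0⟩) ∧
        x = (Lof ty q.1 q.2).map fun t => σ * t * σ⁻¹) ∧ Dec ty x q.2.1.1 q.2.1.2 := by
    intro q hq
    obtain ⟨a1, a2, a3, a4⟩ := hS q hq
    obtain ⟨x', ty, b1, b2, b3, b4⟩ := good_main hg a1 a2 a3
    rw [a4] at b1
    cases b1
    exact ⟨ty, b3, b4⟩
  choose! ty hty using key
  apply Finset.card_le_card_of_injOn (fun q => if ty q then q.2.1.1 else q.2.1.2)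
  · intro q hq
    obtain ⟨a1, a2, a3, a4⟩ := hS q hq
    exact Dec_Tri a2.1 (by rw [h2]; exact a2.2.1) (hty q hq).2
  · intro q hq q' hq' he
    obtain ⟨a1, a2, a3, a4⟩ := hS q hq
    obtain ⟨a1', a2', a3', a4'⟩ := hS q' hq'
    obtain ⟨⟨σ, c1, c2⟩, c3⟩ := hty q hq
    obtain ⟨⟨σ', c1', c2'⟩, c3'⟩ := hty q' hq'
    obtain ⟨d1, d2, d3⟩ := Dec_unique hx.2.1 a2.1 (by rw [h2]; exact a2.2.1) a2'.1
      (by rw [h2]; exact a2'.2.1) c3 c3' he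
    rw [← d1] at c2'
    have hl : q.1.length = n - 1 + 2 * (g-1) := a1.1
    obtain ⟨e1, e2⟩ := Lof_inj a1.2.2 a1'.2.2 (hl.trans a1'.1.symm) (Prod.ext d2 d3) a2.1
      (by have := a2.2.1; omega) a2.2.2.1 a2.2.2.2 a2'.2.2.1 a2'.2.2.2 c1 c1' (c2.symm.trans c2')
    exact Prod.ext e1 e2


section alg
open Polynomial

/-- permutation matrix -/
noncomputable def PM {n : ℕ} (π : Equiv.Perm (Fin n)) : Matrix (Fin n) (Fin n) ℝ :=
  fun i j => if π i = j then 1 else 0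

lemma eval_crev {n : ℕ} (A : Matrix (Fin n) (Fin n) ℝ) (y : ℝ) :
    eval y A.charpolyRev = (1 - y • A).det := by
  rw [Matrix.charpolyRev, ← coe_evalRingHom, RingHom.map_det]
  congr 1
  ext i j
  by_cases h : i = j <;> simp [h, Matrix.one_apply] <;> ring

lemma eval_crev' {n : ℕ} (A : Matrix (Fin n) (Fin n) ℝ) (y : ℝ) :
    eval y (1 + (X : ℝ[X]) • A.map C).det = (1 + y • A).det := by
  rw [← coe_evalRingHom, RingHom.map_det]
  congr 1
  ext i j
  by_cases h : i = j <;> simp [h, Matrix.one_apply] <;> ring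

lemma deriv_crev {n : ℕ} (A : Matrix (Fin n) (Fin n) ℝ) (x : ℝ) (hx : (1 - x • A).det ≠ 0) :
    eval x (derivative A.charpolyRev) = - ((1 - x • A).det * (A * (1 - x • A)⁻¹).trace) := by
  set M := 1 - x • A with hM
  have hu : IsUnit M.det := isUnit_iff_ne_zero.mpr hx
  have e : A.charpolyRev.comp (C x + X) = C M.det * (1 + (X : ℝ[X]) • (-(A * M⁻¹)).map C).det := by
    apply Polynomial.funext
    intro y
    rw [eval_comp, eval_mul, eval_crev', eval_C, eval_add, eval_C, eval_X, eval_crev, mul_comm,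
      ← Matrix.det_mul, add_mul, one_mul, smul_mul_assoc, neg_mul, Matrix.mul_assoc,
      Matrix.nonsing_inv_mul _ hu, mul_one, hM]
    congr 1
    rw [add_smul, smul_neg]; abel
  have h2 := congrArg (fun q => eval 0 (derivative q)) e
  simp only [derivative_comp, derivative_mul, derivative_add, derivative_C, derivative_X, zero_add,
    one_mul, zero_mul, eval_mul, eval_comp, eval_add, eval_C, eval_X, add_zero,
    Matrix.derivative_det_one_add_X_smul, Matrix.trace_neg] at h2
  rw [h2]; ring

lemma PM_mul_swap {n : ℕ} (π : Equiv.Perm (Fin n)) (i j : Fin n) (hij : i ≠ j) (x : ℝ) :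
    1 - x • PM (π * Equiv.swap i j) = (1 - x • PM π) +
      Matrix.replicateCol Unit (fun a => x * ((if a = i then 1 else 0) - (if a = j then 1 else 0))) *
        Matrix.replicateRow Unit (fun b => PM π i b - PM π j b) := by
  ext a b
  simp only [Matrix.sub_apply, Matrix.smul_apply, Matrix.add_apply,
    Matrix.mul_apply, Matrix.replicateCol_apply, Matrix.replicateRow_apply, Finset.univ_unique,
    Finset.sum_const, Finset.card_singleton, one_smul, PM, Equiv.Perm.mul_apply, smul_eq_mul]
  by_cases h1 : a = i
  · subst h1
    simp only [Equiv.swap_apply_left, if_true, if_neg hij]; ring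
  · by_cases h2 : a = j
    · subst h2
      simp only [Equiv.swap_apply_right, if_true, if_neg h1]; ring
    · have h3 := Equiv.swap_apply_of_ne_of_ne h1 h2
      simp only [h3, if_neg h1, if_neg h2]; ring

lemma PM_row {n : ℕ} (π : Equiv.Perm (Fin n)) : (PM π).mulVec 1 = 1 := by
  ext i
  simp [Matrix.mulVec, dotProduct, PM]

lemma det_swap {n : ℕ} (π : Equiv.Perm (Fin n)) (i j : Fin n) (hij : i ≠ j) (x : ℝ)
    (hx : (1 - x • PM π).det ≠ 0) :
    (1 - x • PM (π * Equiv.swap i j)).det = (1 - x • PM π).det * (1 + x *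
      ((PM π * (1 - x • PM π)⁻¹) i i + (PM π * (1 - x • PM π)⁻¹) j j
        - (PM π * (1 - x • PM π)⁻¹) i j - (PM π * (1 - x • PM π)⁻¹) j i)) := by
  rw [PM_mul_swap π i j hij, Matrix.det_add_replicateCol_mul_replicateRow (isUnit_iff_ne_zero.mpr hx)]
  congr 1
  rw [Matrix.det_unique, Matrix.add_apply, Matrix.one_apply_eq]
  congr 1
  set N := (1 - x • PM π)⁻¹
  have h1 : ∀ k, (Matrix.replicateRow Unit (fun b => PM π i b - PM π j b) * N) () k =
      (PM π * N) i k - (PM π * N) j k := by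
    intro k
    simp [Matrix.mul_apply, sub_mul, Finset.sum_sub_distrib]
  rw [Matrix.mul_apply]
  simp only [show (default : Unit) = () from rfl, h1, Matrix.replicateCol_apply]
  have : ∀ k, ((PM π * N) i k - (PM π * N) j k) * (x * ((if k = i then (1 : ℝ) else 0) - if k = j then 1 else 0))
    = (if k = i then x * ((PM π * N) i k - (PM π * N) j k) else 0) -
      (if k = j then x * ((PM π * N) i k - (PM π * N) j k) else 0) := by
    intro k; split_ifs <;> ring
  simp only [this, Finset.sum_sub_distrib, Finset.sum_ite_eq', Finset.mem_univ, if_true]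
  ring

lemma sum_det_swap {n : ℕ} (π : Equiv.Perm (Fin n)) (x : ℝ) (h1 : x ≠ 1)
    (hx : (1 - x • PM π).det ≠ 0) :
    ∑ i, ∑ j, (if i ≠ j then (1 - x • PM (π * Equiv.swap i j)).det else 0) =
     (n * (n - 1) : ℝ) * (1 - x • PM π).det - 2 * n * x * eval x (derivative (PM π).charpolyRev)
       - 2 * n * x * (1 - x • PM π).det / (1 - x) := by
  set Q := PM π * (1 - x • PM π)⁻¹ with hQ
  set D := (1 - x • PM π).det with hD
  have e : ∀ i j : Fin n, (if i ≠ j then (1 - x • PM (π * Equiv.swap i j)).det else 0) =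
      D * (1 + x * (Q i i + Q j j - Q i j - Q j i)) - (if i = j then D else 0) := by
    intro i j
    by_cases h : i = j
    · subst h; simp
    · rw [if_pos h, if_neg h, det_swap π i j h x hx]; ring
  have hone : (1 - x • PM π).mulVec 1 = (1 - x) • (1 : Fin n → ℝ) := by
    rw [Matrix.sub_mulVec, Matrix.one_mulVec, Matrix.smul_mulVec, PM_row, sub_smul, one_smul]
  have hinv : ((1 - x • PM π)⁻¹).mulVec 1 = (1 - x)⁻¹ • (1 : Fin n → ℝ) := by
    have h2 : ((1 - x • PM π)⁻¹).mulVec ((1 - x • PM π).mulVec 1) = 1 := by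
      rw [Matrix.mulVec_mulVec, Matrix.nonsing_inv_mul _ (isUnit_iff_ne_zero.mpr hx), Matrix.one_mulVec]
    rw [hone, Matrix.mulVec_smul] at h2
    have h3 := congrArg (fun u => (1 - x)⁻¹ • u) h2
    simp only [smul_smul, inv_mul_cancel₀ (sub_ne_zero.mpr (Ne.symm h1)), one_smul] at h3
    exact h3
  have hQ1 : ∀ i, ∑ j, Q i j = (1 - x)⁻¹ := by
    intro i
    have h2 : Q.mulVec 1 = (1 - x)⁻¹ • (1 : Fin n → ℝ) := by
      rw [hQ, ← Matrix.mulVec_mulVec, hinv, Matrix.mulVec_smul, PM_row]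
    have := congrFun h2 i
    simpa [Matrix.mulVec, dotProduct] using this
  have hQ2 : ∑ i, ∑ j, Q j i = n * (1 - x)⁻¹ := by
    rw [Finset.sum_comm]; simp [hQ1]
  have htr : ∑ i, Q i i = Q.trace := rfl
  simp only [e]
  simp only [Finset.sum_sub_distrib, Finset.sum_add_distrib, ← Finset.mul_sum, hQ1, hQ2, htr,
    Finset.sum_const, Finset.card_univ, Fintype.card_fin, Finset.sum_ite_eq, Finset.mem_univ, if_true,
    nsmul_eq_mul, mul_one]
  rw [deriv_crev _ x hx, ← hQ, ← hD]
  field_simp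
  ring

lemma crev_ne_zero {n : ℕ} (A : Matrix (Fin n) (Fin n) ℝ) : A.charpolyRev ≠ 0 := by
  intro h
  have := Matrix.eval_charpolyRev (M := A)
  rw [h] at this
  simp at this

lemma crev_one {n : ℕ} (hn : 0 < n) (π : Equiv.Perm (Fin n)) : eval 1 (PM π).charpolyRev = 0 := by
  rw [eval_crev, one_smul]
  by_contra h
  have h2 : (1 - PM π).mulVec 1 = 0 := by
    rw [Matrix.sub_mulVec, Matrix.one_mulVec, PM_row, sub_self]
  have := Matrix.eq_zero_of_mulVec_eq_zero h h2
  have := congrFun this ⟨0, hn⟩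
  simp at this

lemma exists_psi {n : ℕ} (hn : 0 < n) (π : Equiv.Perm (Fin n)) :
    ∃ ψ : ℝ[X], (PM π).charpolyRev = (1 - X) * ψ := by
  obtain ⟨q, hq⟩ := dvd_iff_isRoot.mpr (crev_one hn π)
  refine ⟨-q, ?_⟩
  rw [hq, C_1]; ring

open scoped Classical in
/-- reduced characteristic polynomial -/
noncomputable def psi {n : ℕ} (π : Equiv.Perm (Fin n)) : ℝ[X] :=
  if hn : 0 < n then (exists_psi hn π).choose else 0

lemma psi_spec {n : ℕ} (hn : 0 < n) (π : Equiv.Perm (Fin n)) :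
    (PM π).charpolyRev = (1 - X) * psi π := by
  rw [psi, dif_pos hn]; exact (exists_psi hn π).choose_spec

lemma eq_of_eval_eq_of_ne {p q r : ℝ[X]} (hr : r ≠ 0) (h : ∀ x, eval x r ≠ 0 → eval x p = eval x q) :
    p = q := by
  have : r * (p - q) = 0 := by
    apply Polynomial.funext
    intro x
    by_cases hx : eval x r = 0
    · simp [hx]
    · simp [h x hx]
  rcases mul_eq_zero.mp this with h | h
  · exact absurd h hr
  · exact sub_eq_zero.mp h

lemma sum_psi_swap {n : ℕ} (hn : 0 < n) (π : Equiv.Perm (Fin n)) :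
    ∑ i, ∑ j, (if i ≠ j then psi (π * Equiv.swap i j) else 0) =
      C (n * (n - 1) : ℝ) * psi π - C (2 * n : ℝ) * X * derivative (psi π) := by
  apply eq_of_eval_eq_of_ne (r := (1 - X) * (PM π).charpolyRev)
  · apply mul_ne_zero
    · intro h
      have := congrArg (eval 0) h
      simp at this
    · exact crev_ne_zero _
  intro x hx
  rw [eval_mul, eval_crev] at hx
  have hx1 : x ≠ 1 := by
    intro h; apply hx; simp [h]
  have hx2 := (mul_ne_zero_iff.mp hx).2
  have hx1' : 1 - x ≠ 0 := sub_ne_zero.mpr (Ne.symm hx1)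
  have key := sum_det_swap π x hx1 hx2
  have ev : ∀ τ : Equiv.Perm (Fin n), (1 - x • PM τ).det = (1 - x) * eval x (psi τ) := by
    intro τ
    rw [← eval_crev, psi_spec hn]; simp
  rw [psi_spec hn] at key
  simp only [ev] at key
  apply mul_left_cancel₀ hx1'
  rw [eval_finsetSum, Finset.mul_sum]
  have e2 : ∀ i : Fin n, (1 - x) * eval x (∑ j, if i ≠ j then psi (π * Equiv.swap i j) else 0) =
     ∑ j, if i ≠ j then (1 - x) * eval x (psi (π * Equiv.swap i j)) else 0 := by
    intro i
    rw [eval_finsetSum, Finset.mul_sum]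
    apply Finset.sum_congr rfl
    intro j _
    split_ifs <;> simp
  simp only [e2, key]
  simp
  field_simp
  ring

lemma psi_one {n : ℕ} (hn : 0 < n) : psi (1 : Equiv.Perm (Fin n)) = (1 - X) ^ (n - 1) := by
  have h := psi_spec hn 1
  have e : (PM (1 : Equiv.Perm (Fin n))).charpolyRev = (1 - X) ^ n := by
    apply Polynomial.funext
    intro x
    rw [eval_crev]
    have : PM (1 : Equiv.Perm (Fin n)) = 1 := by
      ext i j; simp only [PM, Matrix.one_apply, Equiv.Perm.one_apply]; congr
    rw [this, show (1 : Matrix (Fin n) (Fin n) ℝ) - x • 1 = (1 - x) • 1 by rw [sub_smul, one_smul],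
      Matrix.det_smul]
    simp
  rw [e] at h
  have h1 : (1 - X : ℝ[X]) ≠ 0 := by
    intro h
    have := congrArg (eval 0) h
    simp at this
  apply mul_left_cancel₀ h1
  rw [← h, ← pow_succ']
  congr 1; omega

end alg


section cnt
open Polynomial

lemma long_conj {n : ℕ} (hn : 2 ≤ n) (π : Equiv.Perm (Fin n)) :
    IsLongCycle π ↔ π.cycleType = {n} := by
  haveI : Nontrivial (Fin n) := Fin.nontrivial_iff_two_le.mpr hn
  constructor
  · intro h
    have hm : ∀ x, π x ≠ x := fun x => h.apply_ne Set.nontrivial_univ (Set.mem_univ x)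
    have hc : π.IsCycle := ⟨⟨0, by omega⟩, hm _, fun y _ => h.2 (Set.mem_univ _) (Set.mem_univ _)⟩
    rw [hc.cycleType]
    have : π.support = Finset.univ := by ext x; simp [hm x]
    rw [this]; simp
  · intro h
    have hc : π.IsCycle := by
      rw [← Equiv.Perm.card_cycleType_eq_one, h]; simp
    have hs : π.support.card = n := by
      rw [← Equiv.Perm.sum_cycleType, h]; simp
    have hs' : π.support = Finset.univ := by
      rw [← Finset.card_eq_iff_eq_univ, hs]; simp
    have hm : ∀ x, π x ≠ x := by
      intro x; rw [← Equiv.Perm.mem_support, hs']; simp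
    refine ⟨π.bijective.bijOn_univ, fun x _ y _ => hc.sameCycle (hm x) (hm y)⟩

lemma long_isConj {n : ℕ} (hn : 2 ≤ n) (π : Equiv.Perm (Fin n)) (h : IsLongCycle π) :
    ∃ σ : Equiv.Perm (Fin n), σ * π * σ⁻¹ = finRotate n := by
  rw [long_conj hn] at h
  have : IsConj π (finRotate n) := by
    rw [Equiv.Perm.isConj_iff_cycleType_eq, h, cycleType_finRotate_of_le hn]
  exact isConj_iff.mp this

open scoped Classical in
lemma card_long {n : ℕ} (hn : 2 ≤ n) :
    (Finset.univ.filter (fun π : Equiv.Perm (Fin n) => IsLongCycle π)).card = (n-1).factorial := by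
  simp only [long_conj hn]
  have := Equiv.Perm.card_of_cycleType_singleton (α := Fin n) hn (by simp)
  simp at this
  rw [← this]

lemma psi_not_long {n : ℕ} (hn : 0 < n) (π : Equiv.Perm (Fin n)) (h : ¬ IsLongCycle π) :
    eval 1 (psi π) = 0 := by
  obtain ⟨x, y, hxy⟩ : ∃ x y, ¬ π.SameCycle x y := by
    by_contra! hc
    exact h ⟨π.bijective.bijOn_univ, fun x _ y _ => hc x y⟩
  classical
  set p : Fin n → Prop := fun z => π.SameCycle x z with hp
  have hpi : ∀ z, p (π z) ↔ p z := fun z => Equiv.Perm.sameCycle_apply_right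
  have hB := Matrix.twoBlockTriangular_det (1 - (X : ℝ[X]) • (PM π).map C) p (by
    intro i hi j hj
    have h1 : i ≠ j := by rintro rfl; exact hi hj
    have h2 : π i ≠ j := by rintro rfl; exact hi ((hpi i).mp hj)
    simp [Matrix.one_apply, h1, PM, h2])
  have hz : ∀ (q : Fin n → Prop) [DecidablePred q] (_ : ∀ z, q (π z) ↔ q z) (z0 : Fin n) (_ : q z0),
      eval 1 ((1 - (X : ℝ[X]) • (PM π).map C).toSquareBlockProp q).det = 0 := by
    intro q _ hq z0 hz0
    rw [← coe_evalRingHom, RingHom.map_det]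
    rw [← Matrix.exists_mulVec_eq_zero_iff]
    refine ⟨fun _ => 1, ?_, ?_⟩
    · intro hc
      have := congrFun hc ⟨z0, hz0⟩
      simp at this
    · ext ⟨i, hi⟩
      have e : ∀ j : {a // q a}, ((evalRingHom 1).mapMatrix
          ((1 - (X : ℝ[X]) • (PM π).map C).toSquareBlockProp q)) ⟨i, hi⟩ j =
          (if ⟨i, hi⟩ = j then 1 else 0) - (if ⟨π i, (hq i).mpr hi⟩ = j then 1 else 0) := by
        rintro ⟨j, hj⟩
        by_cases h1 : i = j <;> by_cases h2 : π i = j <;>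
          simp only [Matrix.toSquareBlockProp_def, Matrix.one_apply, PM, h1, h2, RingHom.mapMatrix_apply,
            Matrix.map_apply, Matrix.of_apply, Matrix.sub_apply, Matrix.smul_apply, Subtype.mk.injEq,
            if_true, if_false] <;> simp <;> split_ifs <;> simp
      simp only [Matrix.mulVec, dotProduct, e]
      simp
  have h1 := hz p hpi x (Equiv.Perm.SameCycle.refl _ _)
  have h2 := hz (fun i => ¬ p i) (fun z => not_congr (hpi z)) y hxy
  have h3 := psi_spec hn π
  rw [Matrix.charpolyRev, hB] at h3
  have h4 := congrArg (fun q => eval 1 (derivative q)) h3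
  simp only [derivative_mul, eval_add, eval_mul, h1, h2, derivative_sub, derivative_X,
    eval_sub, eval_one, eval_X, derivative_one, eval_zero] at h4
  linarith

lemma crev_long {n : ℕ} (hn : 2 ≤ n) (π : Equiv.Perm (Fin n)) (h : IsLongCycle π) :
    (PM π).charpolyRev = 1 - X ^ n := by
  obtain ⟨σ, hσ⟩ := long_isConj hn π h
  have hm : ∀ x, π x ≠ x := by
    haveI : Nontrivial (Fin n) := Fin.nontrivial_iff_two_le.mpr hn
    exact fun x => h.apply_ne Set.nontrivial_univ (Set.mem_univ x)
  have hsg : (Equiv.Perm.sign π : ℤ) = - (-1) ^ n := by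
    have h1 := congrArg Equiv.Perm.sign hσ
    obtain ⟨k, rfl⟩ : ∃ k, n = k + 1 := ⟨n - 1, by omega⟩
    rw [sign_finRotate, map_mul, map_mul, map_inv, mul_right_comm, mul_inv_cancel, one_mul] at h1
    rw [h1]; push_cast; ring
  rw [Matrix.charpolyRev, Matrix.det_apply']
  have hne : (1 : Equiv.Perm (Fin n)) ≠ π⁻¹ := by
    intro hc
    have : π = 1 := by rw [← inv_inv π, ← hc, inv_one]
    exact hm ⟨0, by omega⟩ (by rw [this]; rfl)
  rw [← Finset.sum_subset (Finset.subset_univ {1, π⁻¹})]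
  · rw [Finset.sum_pair hne]
    have e1 : ∀ i, (1 - (X : ℝ[X]) • (PM π).map C) ((1 : Equiv.Perm (Fin n)) i) i = 1 := by
      intro i; simp [PM, hm i]
    have e2 : ∀ i, (1 - (X : ℝ[X]) • (PM π).map C) (π⁻¹ i) i = - X := by
      intro i
      have : π⁻¹ i ≠ i := by
        intro hc; apply hm i; conv_lhs => rw [← hc]
        exact Equiv.apply_symm_apply π i
      have h2 : π (π⁻¹ i) = i := Equiv.apply_symm_apply π i
      simp only [Matrix.sub_apply, Matrix.one_apply, if_neg this, Matrix.smul_apply, Matrix.map_apply,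
        PM, h2, if_true]
      simp
    simp only [e1, e2, Finset.prod_const, Finset.card_univ, Fintype.card_fin, Equiv.Perm.sign_inv, hsg,
      Equiv.Perm.sign_one]
    rw [neg_pow]
    push_cast
    have : ((-1 : ℝ[X]) ^ n) * (-1) ^ n = 1 := by rw [← mul_pow]; simp
    linear_combination (- X ^ n) * this
  · intro τ _ hτ
    by_contra hc
    apply hτ
    have hne : ∀ i, τ i = i ∨ π (τ i) = i := by
      intro i
      by_contra! hi
      apply hc
      rw [Finset.prod_eq_zero (Finset.mem_univ i), mul_zero]
      simp [Matrix.one_apply, hi.1, PM, hi.2]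
    by_cases h1 : ∃ z, τ z = z
    · obtain ⟨z, hz⟩ := h1
      have hfix : ∀ i, τ i = i → τ (π i) = π i := by
        intro i hi
        rcases hne (π i) with h | h
        · exact h
        · have h2 : τ (π i) = τ i := by rw [hi]; exact π.injective h
          exact absurd (τ.injective h2) (hm i)
      have hall : ∀ k : ℕ, τ ((π ^ k) z) = (π ^ k) z := by
        intro k
        induction k with
        | zero => simpa using hz
        | succ k ih =>
          rw [pow_succ', Equiv.Perm.mul_apply]; exact hfix _ ih
      have : τ = 1 := by
        ext1 i
        obtain ⟨k, hk⟩ := (h.2 (Set.mem_univ z) (Set.mem_univ i)).exists_nat_pow_eq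
        rw [← hk]; exact hall k
      simp [this]
    · push Not at h1
      have : τ = π⁻¹ := by
        ext1 i
        rcases hne i with h | h
        · exact absurd h (h1 i)
        · exact (Equiv.eq_symm_apply π).mpr h
      simp [this]

lemma psi_long {n : ℕ} (hn : 2 ≤ n) (π : Equiv.Perm (Fin n)) (h : IsLongCycle π) :
    eval 1 (psi π) = n := by
  have h3 := psi_spec (by omega) π
  rw [crev_long hn π h] at h3
  have h4 := congrArg (fun q => eval 1 (derivative q)) h3
  simp [derivative_X_pow] at h4
  linarith

end cnt


section cnt
open Polynomial

open scoped Classical in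
/-- transpositions -/
noncomputable def SW (n : ℕ) : Finset (Equiv.Perm (Fin n)) := Finset.univ.filter fun t => t.IsSwap

lemma mem_SW {n : ℕ} {t : Equiv.Perm (Fin n)} : t ∈ SW n ↔ t.IsSwap := by simp [SW]

/-- lists of transpositions -/
noncomputable def Lst (n : ℕ) : ℕ → Finset (List (Equiv.Perm (Fin n)))
  | 0 => {[]}
  | m + 1 => (SW n ×ˢ Lst n m).image fun p => p.1 :: p.2

lemma mem_Lst {n m : ℕ} {l : List (Equiv.Perm (Fin n))} :
    l ∈ Lst n m ↔ l.length = m ∧ ∀ t ∈ l, t.IsSwap := by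
  induction m generalizing l with
  | zero =>
    simp only [Lst, Finset.mem_singleton, List.length_eq_zero_iff]
    constructor
    · rintro rfl; simp
    · exact fun h => h.1
  | succ m ih =>
    simp only [Lst, Finset.mem_image, Finset.mem_product, mem_SW, ih, Prod.exists]
    constructor
    · rintro ⟨t, l', ⟨h1, h2, h3⟩, rfl⟩
      simp [h2]; exact ⟨h1, h3⟩
    · rintro ⟨h1, h2⟩
      cases l with
      | nil => simp at h1
      | cons t l' =>
        refine ⟨t, l', ⟨h2 t (by simp), by simpa using h1, fun s hs => h2 s (by simp [hs])⟩, rfl⟩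

lemma sum_Lst_succ {n m : ℕ} {M : Type*} [AddCommMonoid M] (φ : List (Equiv.Perm (Fin n)) → M) :
    ∑ l ∈ Lst n (m + 1), φ l = ∑ l ∈ Lst n m, ∑ t ∈ SW n, φ (t :: l) := by
  rw [Lst, Finset.sum_image, Finset.sum_product_right]
  rintro ⟨a, b⟩ _ ⟨c, d⟩ _ h
  simpa using h

lemma swap_eq_swap {n : ℕ} {i j x y : Fin n} (hij : i ≠ j) (h : Equiv.swap x y = Equiv.swap i j) :
    (x = i ∧ y = j) ∨ (x = j ∧ y = i) := by
  have h1 := Equiv.congr_fun h i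
  have h2 := Equiv.congr_fun h j
  rw [Equiv.swap_apply_left] at h1
  rw [Equiv.swap_apply_right] at h2
  by_cases a : i = x
  · subst a
    rw [Equiv.swap_apply_left] at h1; exact Or.inl ⟨rfl, h1⟩
  · by_cases b : i = y
    · subst b
      rw [Equiv.swap_apply_right] at h1; exact Or.inr ⟨h1, rfl⟩
    · rw [Equiv.swap_apply_of_ne_of_ne a b] at h1; exact absurd h1 hij

lemma sum_SW {n : ℕ} {M : Type*} [AddCommMonoid M] (φ : Equiv.Perm (Fin n) → M) :
    ∑ i, ∑ j, (if i ≠ j then φ (Equiv.swap i j) else 0) = 2 • ∑ t ∈ SW n, φ t := by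
  classical
  rw [← Finset.sum_product', ← Finset.sum_filter]
  rw [← Finset.sum_fiberwise_of_maps_to (t := SW n) (g := fun q : Fin n × Fin n => Equiv.swap q.1 q.2)]
  · rw [Finset.smul_sum]
    apply Finset.sum_congr rfl
    intro t ht
    rw [mem_SW] at ht
    obtain ⟨i, j, hij, rfl⟩ := ht
    have e : (Finset.filter (fun q : Fin n × Fin n => Equiv.swap q.1 q.2 = Equiv.swap i j)
        (Finset.filter (fun q : Fin n × Fin n => q.1 ≠ q.2) (Finset.univ ×ˢ Finset.univ))) =
        {(i, j), (j, i)} := by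
      ext ⟨x, y⟩
      simp only [Finset.mem_filter, Finset.mem_product, Finset.mem_univ, true_and, Finset.mem_insert,
        Finset.mem_singleton, Prod.mk.injEq]
      constructor
      · rintro ⟨_, h⟩; exact swap_eq_swap hij h
      · rintro (⟨rfl, rfl⟩ | ⟨rfl, rfl⟩)
        · exact ⟨hij, rfl⟩
        · exact ⟨hij.symm, Equiv.swap_comm _ _⟩
    rw [e, Finset.sum_pair (by simp [hij]), Equiv.swap_comm j i, two_nsmul]
  · intro q hq
    rw [mem_SW]
    exact ⟨q.1, q.2, by simpa using hq, rfl⟩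

lemma sum_psi_SW {n : ℕ} (hn : 0 < n) (π : Equiv.Perm (Fin n)) :
    ∑ t ∈ SW n, psi (π * t) = C (n * (n - 1) / 2 : ℝ) * psi π - C (n : ℝ) * X * derivative (psi π) := by
  have h := sum_psi_swap hn π
  rw [sum_SW (fun t => psi (π * t))] at h
  have h2 : (2 : ℝ[X]) ≠ 0 := two_ne_zero
  apply mul_left_cancel₀ h2
  rw [nsmul_eq_mul] at h
  push_cast at h
  rw [h]
  have e1 : C (n * (n - 1) : ℝ) = 2 * C (n * (n - 1) / 2 : ℝ) := by
    rw [← C_ofNat, ← C_mul]; congr 1; ring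
  have e2 : C (2 * n : ℝ) = 2 * C (n : ℝ) := by
    rw [← C_ofNat, ← C_mul]
  rw [e1, e2]; ring

lemma one_sub_X_pow (N : ℕ) : (1 - X : ℝ[X]) ^ N =
    ∑ k ∈ Finset.range (N + 1), C ((-1) ^ k * (N.choose k) : ℝ) * X ^ k := by
  rw [sub_eq_add_neg, add_comm, add_pow]
  apply Finset.sum_congr rfl
  intro k _
  rw [neg_pow]
  simp
  ring

lemma sum_psi_Lst {n : ℕ} (hn : 0 < n) (m : ℕ) :
    ∑ l ∈ Lst n m, psi (prodLR l) = ∑ k ∈ Finset.range n,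
      C ((-1) ^ k * ((n-1).choose k) * ((n * (n - 1) / 2 : ℝ) - n * k) ^ m) * X ^ k := by
  induction m with
  | zero =>
    simp only [Lst, Finset.sum_singleton, prodLR_nil, psi_one hn, one_sub_X_pow, pow_zero, mul_one]
    rw [Nat.sub_add_cancel hn]
  | succ m ih =>
    rw [sum_Lst_succ]
    simp only [prodLR_cons, sum_psi_SW hn]
    rw [Finset.sum_sub_distrib, ← Finset.mul_sum, ← Finset.mul_sum, ← derivative_sum, ih, derivative_sum,
      Finset.mul_sum, Finset.mul_sum, ← Finset.sum_sub_distrib]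
    apply Finset.sum_congr rfl
    intro k _
    rw [derivative_C_mul_X_pow]
    rcases k with _ | k
    · simp only [Nat.cast_zero, mul_zero, C_0, zero_mul, sub_zero, pow_zero, mul_one]
      rw [← C_mul]; congr 1; ring
    · rw [pow_succ (_ - _) m]
      simp only [C_mul, C_sub, Nat.add_sub_cancel]
      ring

lemma sum_eval_psi {n : ℕ} (hn : 0 < n) (m : ℕ) :
    ∑ l ∈ Lst n m, eval 1 (psi (prodLR l)) = ∑ k ∈ Finset.range n,
      (-1) ^ k * ((n-1).choose k) * ((n * (n - 1) / 2 : ℝ) - n * k) ^ m := by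
  rw [← eval_finsetSum, sum_psi_Lst hn, eval_finsetSum]
  simp

/-- factorizations of `π` into `m` transpositions -/
noncomputable def FF (n m : ℕ) (π : Equiv.Perm (Fin n)) : Finset (List (Equiv.Perm (Fin n))) :=
  (Lst n m).filter fun l => prodLR l = π

lemma mem_FF {n m : ℕ} {π : Equiv.Perm (Fin n)} {l : List (Equiv.Perm (Fin n))} :
    l ∈ FF n m π ↔ l.length = m ∧ (∀ t ∈ l, t.IsSwap) ∧ prodLR l = π := by
  simp [FF, mem_Lst, and_assoc]

lemma Fcal_eq (n g : ℕ) : Fcal n g = (FF n (n - 1 + 2 * g) (finRotate n) : Set _) := by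
  ext l; simp only [Fcal, Set.mem_ofPred_eq, Finset.mem_coe, mem_FF]

lemma card_FF_conj {n m : ℕ} (σ π : Equiv.Perm (Fin n)) :
    (FF n m (σ * π * σ⁻¹)).card = (FF n m π).card := by
  symm
  refine Finset.card_bij' (fun l _ => l.map fun t => σ * t * σ⁻¹)
    (fun l _ => l.map fun t => σ⁻¹ * t * σ) ?_ ?_ ?_ ?_
  · intro l hl
    rw [mem_FF] at hl ⊢
    refine ⟨by simp [hl.1], ?_, by rw [prodLR_map_conj, hl.2.2]⟩
    intro t ht
    simp only [List.mem_map] at ht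
    obtain ⟨s, hs, rfl⟩ := ht
    exact isSwap_conj _ _ (hl.2.1 s hs)
  · intro l hl
    rw [mem_FF] at hl ⊢
    have := prodLR_map_conj σ⁻¹ l
    rw [inv_inv] at this
    refine ⟨by simp [hl.1], ?_, by rw [this, hl.2.2]; group⟩
    intro t ht
    simp only [List.mem_map] at ht
    obtain ⟨s, hs, rfl⟩ := ht
    have := isSwap_conj σ⁻¹ _ (hl.2.1 s hs)
    rwa [inv_inv] at this
  · intro l _
    rw [List.map_map]
    convert List.map_id l
    ext1 t; simp [mul_assoc]
  · intro l _
    rw [List.map_map]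
    convert List.map_id l
    ext1 t; simp [mul_assoc]

lemma count_FF {n : ℕ} (hn : 2 ≤ n) (m : ℕ) :
    (n.factorial : ℝ) * (FF n m (finRotate n)).card = ∑ k ∈ Finset.range n,
      (-1) ^ k * ((n-1).choose k) * ((n * (n - 1) / 2 : ℝ) - n * k) ^ m := by
  classical
  rw [← sum_eval_psi (by omega)]
  rw [← Finset.sum_fiberwise_of_maps_to (t := Finset.univ) (g := prodLR) (fun _ _ => Finset.mem_univ _)]
  have e : ∀ π : Equiv.Perm (Fin n), ∑ l ∈ (Lst n m).filter (fun l => prodLR l = π),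
      eval 1 (psi (prodLR l)) = if IsLongCycle π then (n : ℝ) * (FF n m (finRotate n)).card else 0 := by
    intro π
    rw [Finset.sum_congr rfl (g := fun _ => eval 1 (psi π))
      (fun l hl => by rw [(Finset.mem_filter.mp hl).2])]
    rw [Finset.sum_const, nsmul_eq_mul]
    split_ifs with h
    · obtain ⟨σ, hσ⟩ := long_isConj hn π h
      rw [psi_long hn π h, ← hσ, card_FF_conj, mul_comm, FF]
    · rw [psi_not_long (by omega) π h, mul_zero]
  simp only [e]
  rw [← Finset.sum_filter, Finset.sum_const, card_long hn, nsmul_eq_mul]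
  rw [← mul_assoc]
  congr 1
  rw [← Nat.mul_factorial_pred (show n ≠ 0 by omega)]
  push_cast; ring

end cnt


section asy
open Filter Topology PowerSeries

/-- rescaled exponential -/
noncomputable def EE (a : ℝ) : ℝ⟦X⟧ := rescale a (exp ℝ)

lemma coeff_EE (a : ℝ) (k : ℕ) : coeff k (EE a) = a ^ k / k.factorial := by
  rw [EE, coeff_rescale, coeff_exp]
  simp [div_eq_mul_inv]

lemma EE_mul (a b : ℝ) : EE a * EE b = EE (a + b) := exp_mul_exp_eq_exp_add a b

lemma EE_pow (a : ℝ) (k : ℕ) : EE a ^ k = EE (k * a) := by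
  induction k with
  | zero =>
    ext j
    rw [pow_zero, coeff_EE, coeff_one]
    rcases j with _ | j <;> simp
  | succ k ih => rw [pow_succ, ih, EE_mul]; congr 1; push_cast; ring

/-- the tail series -/
noncomputable def WW : ℝ⟦X⟧ := PowerSeries.mk fun k => ((1/2 : ℝ) ^ (k+3) - (-1/2) ^ (k+3)) / (k+3).factorial

lemma EE_sub : EE (1/2) - EE (-1/2) = X * (1 + X ^ 2 * WW) := by
  ext k
  rw [map_sub, coeff_EE, coeff_EE, ← sub_div]
  rcases k with _ | _ | _ | k
  · simp
  · rw [show 0 + 1 = 0 + 1 from rfl, coeff_succ_X_mul]; simp; norm_num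
  · rw [coeff_succ_X_mul, map_add, coeff_X_pow_mul']; simp [coeff_one]; norm_num
  · rw [coeff_succ_X_mul, map_add, coeff_X_pow_mul, coeff_one]
    simp [WW]

/-- genus coefficient -/
noncomputable def cc (h N : ℕ) : ℝ := ∑ i ∈ Finset.range (h+1), (N.choose i : ℝ) * coeff (2 * h - 2 * i) (WW ^ i)

lemma coeff_pow_EE (N h : ℕ) : coeff (N + 2 * h) ((EE (1/2) - EE (-1/2)) ^ N) = cc h N := by
  rw [EE_sub, mul_pow, add_comm N, coeff_X_pow_mul, add_comm (1 : ℝ⟦X⟧), add_pow, map_sum]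
  have e : ∀ i, coeff (2 * h) ((X ^ 2 * WW) ^ i * 1 ^ (N - i) * (N.choose i : ℝ⟦X⟧)) =
      if i ≤ h then (N.choose i : ℝ) * coeff (2 * h - 2 * i) (WW ^ i) else 0 := by
    intro i
    rw [one_pow, mul_one, mul_pow, ← pow_mul]
    rw [show (X ^ (2 * i) * WW ^ i * (N.choose i : ℝ⟦X⟧) : ℝ⟦X⟧) = C (N.choose i : ℝ) * (X ^ (2 * i) * WW ^ i) by
      rw [map_natCast]; ring]
    rw [coeff_C_mul, coeff_X_pow_mul']
    by_cases hi : i ≤ h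
    · rw [if_pos hi, if_pos (by omega)]
    · rw [if_neg hi, if_neg (by omega), mul_zero]
  simp only [e]
  rw [cc, ← Finset.sum_filter]
  have e2 : ∀ i ∈ Finset.range (N+1+h), i ∉ (Finset.range (N+1)).filter (fun i => i ≤ h) → 
      (fun i => if i ≤ h then (N.choose i : ℝ) * coeff (2 * h - 2 * i) (WW ^ i) else 0) i = 0 := by
    intro i _ hi
    simp only [Finset.mem_filter, Finset.mem_range, not_and] at hi
    by_cases h1 : i < N+1
    · simp [hi h1]
    · simp [Nat.choose_eq_zero_of_lt (show N < i by omega)]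
  have s1 := Finset.sum_subset (s₁ := (Finset.range (N+1)).filter (fun i => i ≤ h)) (s₂ := Finset.range (N+1+h))
    (by intro i; simp; omega) e2
  have s2 := Finset.sum_subset (s₁ := (Finset.range (h+1))) (s₂ := Finset.range (N+1+h))
    (f := (fun i => if i ≤ h then (N.choose i : ℝ) * coeff (2 * h - 2 * i) (WW ^ i) else 0))
    (by intro i; simp; omega) (by intro i _ hi; simp only [Finset.mem_range] at hi; simp; intro; omega)
  rw [← s2] at s1
  rw [Finset.sum_congr rfl (g := (fun i => if i ≤ h then (N.choose i : ℝ) * coeff (2 * h - 2 * i) (WW ^ i) else 0)), s1]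
  · apply Finset.sum_congr rfl
    intro i hi
    simp only [Finset.mem_range] at hi
    simp; intro; omega
  · intro i hi
    simp only [Finset.mem_filter] at hi
    simp [hi.2]

lemma coeff_pow_EE' (N m : ℕ) : coeff m ((EE (1/2) - EE (-1/2)) ^ N) =
    (∑ k ∈ Finset.range (N+1), (-1) ^ k * (N.choose k) * ((N : ℝ)/2 - k) ^ m) / m.factorial := by
  rw [sub_eq_add_neg, add_comm, add_pow, map_sum, Finset.sum_div]
  apply Finset.sum_congr rfl
  intro k hk
  simp only [Finset.mem_range] at hk
  rw [neg_pow, EE_pow, EE_pow]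
  have : ((-1) ^ k * EE (k * (-1/2)) * EE ((N - k : ℕ) * (1/2)) * (N.choose k : ℝ⟦X⟧)) =
    C ((-1) ^ k * (N.choose k) : ℝ) * (EE (k * (-1/2)) * EE ((N - k : ℕ) * (1/2))) := by
    simp; ring
  rw [this, EE_mul, coeff_C_mul, coeff_EE, Nat.cast_sub (by omega)]
  rw [mul_div_assoc]
  congr 3
  ring

/-- number of genus `h` factorizations -/
noncomputable def fc (n h : ℕ) : ℝ := (FF n (n - 1 + 2 * h) (finRotate n)).card

lemma fc_formula {n : ℕ} (hn : 2 ≤ n) (h : ℕ) :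
    (n.factorial : ℝ) * fc n h = n ^ (n - 1 + 2 * h) * (n - 1 + 2 * h).factorial * cc h (n-1) := by
  rw [fc, count_FF hn, ← coeff_pow_EE, coeff_pow_EE', Nat.sub_add_cancel (by omega)]
  have : ((n - 1 + 2 * h).factorial : ℝ) ≠ 0 := by positivity
  rw [mul_assoc, mul_div_cancel₀ _ this, Finset.mul_sum]
  apply Finset.sum_congr rfl
  intro k _
  rw [show ((n : ℝ) * (n - 1) / 2 - n * k) = n * (((n - 1 : ℕ) : ℝ) / 2 - k) by
    rw [Nat.cast_sub (by omega)]; push_cast; ring, mul_pow]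
  ring

lemma fc_zero {n : ℕ} (hn : 2 ≤ n) : fc n 0 = (n : ℝ) ^ (n - 2) := by
  have := fc_formula hn 0
  have hc : cc 0 (n-1) = 1 := by simp [cc]
  rw [hc, ← Nat.mul_factorial_pred (show n ≠ 0 by omega)] at this
  have h2 : ((n-1).factorial : ℝ) ≠ 0 := by positivity
  have h3 : (n : ℝ) ≠ 0 := by positivity
  have h4 : (n : ℝ) ^ (n-1) = n * n ^ (n-2) := by rw [← pow_succ']; congr 1; omega
  simp only [mul_zero, add_zero] at this
  rw [h4] at this
  push_cast at this
  apply mul_left_cancel₀ (mul_ne_zero h3 h2)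
  linarith

lemma choose_div_tendsto (i : ℕ) : Tendsto (fun N : ℕ => (N.choose i : ℝ) / (N : ℝ) ^ i) atTop (𝓝 (1 / i.factorial)) := by
  have h := isEquivalent_choose i
  have h2 := (Asymptotics.isEquivalent_iff_tendsto_one (by
    filter_upwards [eventually_gt_atTop 0] with N hN
    positivity)).mp h
  have h3 := h2.mul_const (1 / (i.factorial : ℝ))
  rw [one_mul] at h3
  refine h3.congr' ?_
  filter_upwards [eventually_gt_atTop 0] with N hN
  simp only [Pi.div_apply]
  have : (N : ℝ) ≠ 0 := by positivity
  field_simp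

lemma cc_tendsto (h : ℕ) : Tendsto (fun N : ℕ => cc h N / (N : ℝ) ^ h) atTop (𝓝 (1 / h.factorial * (1/24) ^ h)) := by
  unfold cc
  simp only [Finset.sum_div]
  rw [show (1 / (h.factorial : ℝ) * (1/24) ^ h) = ∑ i ∈ Finset.range (h+1), if i = h then (1 / (h.factorial : ℝ) * (1/24) ^ h) else 0 by
    rw [Finset.sum_ite_eq']; simp]
  apply tendsto_finsetSum
  intro i hi
  simp only [Finset.mem_range] at hi
  by_cases hih : i = h
  · subst hih
    rw [if_pos rfl]
    have := (choose_div_tendsto i).mul_const (coeff (2 * i - 2 * i) (WW ^ i))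
    have e : coeff (2 * i - 2 * i) (WW ^ i) = (1/24 : ℝ) ^ i := by
      rw [Nat.sub_self, coeff_zero_eq_constantCoeff, map_pow]
      congr 1
      rw [← coeff_zero_eq_constantCoeff_apply, WW, coeff_mk]
      norm_num [Nat.factorial]
    rw [e] at this ⊢
    refine this.congr fun N => by ring
  · rw [if_neg hih]
    have h1 := (choose_div_tendsto i).mul_const (coeff (2 * h - 2 * i) (WW ^ i))
    have h2 : Tendsto (fun N : ℕ => ((N : ℝ) ^ (h - i))⁻¹) atTop (𝓝 0) :=
      ((tendsto_pow_atTop (by omega)).comp tendsto_natCast_atTop_atTop).inv_tendsto_atTop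
    have h3 := h1.mul h2
    rw [mul_zero] at h3
    refine h3.congr fun N => ?_
    have : (N : ℝ) ^ h = N ^ i * N ^ (h - i) := by rw [← pow_add]; congr 1; omega
    rw [this, div_eq_mul_inv, div_eq_mul_inv, mul_inv]; ring

lemma fc_pos_ev (h : ℕ) : ∀ᶠ n in atTop, 0 < fc n h := by
  have h1 := (cc_tendsto h).comp (tendsto_sub_atTop_nat 1)
  have h2 := h1.eventually (lt_mem_nhds (show (0:ℝ) < (1 / h.factorial * (1/24) ^ h) by positivity))
  filter_upwards [h2, eventually_ge_atTop 2] with n hn hn2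
  have h3 := fc_formula hn2 h
  have h4 : 0 < cc h (n-1) := by
    by_contra hc
    push Not at hc
    have : cc h (n-1) / ((n-1 : ℕ) : ℝ) ^ h ≤ 0 := div_nonpos_of_nonpos_of_nonneg hc (by positivity)
    simp only [Function.comp] at hn
    linarith
  have h5 : 0 < (n.factorial : ℝ) * fc n h := by rw [h3]; positivity
  exact pos_of_mul_pos_right h5 (by positivity)

lemma fc_ratio (g : ℕ) (hg : 1 ≤ g) : Tendsto (fun n : ℕ => (2 * g * fc n g) /
    (fc n (g-1) * (((n - 1 + 2 * g).choose 2 : ℝ) * (n.choose 3 : ℝ)))) atTop (𝓝 1) := by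
  have h1 := (cc_tendsto g).comp (tendsto_sub_atTop_nat 1)
  have h2 := (cc_tendsto (g-1)).comp (tendsto_sub_atTop_nat 1)
  have h3 := choose_div_tendsto 3
  have h4 : Tendsto (fun n : ℕ => ((n-1 : ℕ) : ℝ) / n) atTop (𝓝 1) := by
    have := tendsto_natCast_div_add_atTop (𝕜 := ℝ) 1
    have := this.comp (tendsto_sub_atTop_nat 1)
    refine this.congr' ?_
    filter_upwards [eventually_ge_atTop 1] with n hn
    simp only [Function.comp]
    congr 1
    rw [Nat.cast_sub hn]; push_cast; ring
  have h5 := ((h1.div h2 (by positivity)).mul h4).mul ((h3.inv₀ (by positivity)).const_mul (4 * g : ℝ))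
  have e : (1 / (g.factorial : ℝ) * (1/24) ^ g) / (1 / ((g-1).factorial : ℝ) * (1/24) ^ (g-1)) * 1 *
     ((4 * g) * (1 / (Nat.factorial 3 : ℝ))⁻¹) = 1 := by
    obtain ⟨k, rfl⟩ : ∃ k, g = k + 1 := ⟨g - 1, by omega⟩
    simp only [Nat.add_sub_cancel, Nat.factorial]
    push_cast
    rw [pow_succ]
    have : ((k.factorial : ℕ) : ℝ) ≠ 0 := by positivity
    have : ((k : ℝ) + 1) ≠ 0 := by positivity
    field_simp
    norm_num
  rw [e] at h5
  refine h5.congr' ?_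
  filter_upwards [eventually_ge_atTop 4, fc_pos_ev (g-1)] with n hn hf
  have f1 := fc_formula (by omega : 2 ≤ n) g
  have f2 := fc_formula (by omega : 2 ≤ n) (g-1)
  simp only [Function.comp, Pi.div_apply]
  have hm : n - 1 + 2 * g = n - 1 + 2 * (g - 1) + 1 + 1 := by omega
  set m := n - 1 + 2 * (g-1) with hmm
  have hC : (((n - 1 + 2 * g).choose 2 : ℕ) : ℝ) = (m + 2) * (m + 1) / 2 := by
    rw [hm, Nat.cast_choose_two]; push_cast; ring
  have hn0 : (n : ℝ) ≠ 0 := by positivity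
  have hn1 : ((n-1 : ℕ) : ℝ) ≠ 0 := by
    have : 0 < n - 1 := by omega
    positivity
  have hc3 : (n.choose 3 : ℝ) ≠ 0 := by
    have := Nat.choose_pos (show 3 ≤ n by omega)
    positivity
  have hfa : (n.factorial : ℝ) ≠ 0 := by positivity
  have hfm : (m.factorial : ℝ) ≠ 0 := by positivity
  have e1 : fc n g = n ^ m * n ^ 2 * ((m + 2) * (m + 1) * m.factorial) * cc g (n-1) / n.factorial := by
    rw [eq_div_iff hfa, mul_comm, f1, hm, Nat.factorial_succ, Nat.factorial_succ]; push_cast; ring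
  have e2 : fc n (g-1) = n ^ m * m.factorial * cc (g-1) (n-1) / n.factorial := by
    rw [eq_div_iff hfa, mul_comm, f2]
  have hcc : cc (g-1) (n-1) ≠ 0 := by
    intro h0; rw [e2, h0] at hf; simp at hf
  rw [e1, e2, hC]
  have hp : ((n-1 : ℕ) : ℝ) ^ g = ((n-1 : ℕ) : ℝ) ^ (g-1) * ((n-1 : ℕ) : ℝ) := by
    rw [← pow_succ]; congr 1; omega
  rw [hp]
  have h5 : (m : ℝ) + 2 ≠ 0 := by positivity
  have h6 : (m : ℝ) + 1 ≠ 0 := by positivity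
  field_simp
  ring

end asy


section disp

/-- total displacement -/
noncomputable def disp {n : ℕ} (π : Equiv.Perm (Fin n)) : ℝ := ∑ s, |((π s : ℕ) : ℝ) - ((s : ℕ) : ℝ)|

lemma disp_nonneg {n : ℕ} (π : Equiv.Perm (Fin n)) : 0 ≤ disp π :=
  Finset.sum_nonneg fun _ _ => abs_nonneg _

lemma disp_one {n : ℕ} : disp (1 : Equiv.Perm (Fin n)) = 0 := by simp [disp]

lemma disp_mul {n : ℕ} (π τ : Equiv.Perm (Fin n)) : disp (π * τ) ≤ disp π + disp τ := by
  have h : disp π = ∑ s, |((π (τ s) : ℕ) : ℝ) - ((τ s : ℕ) : ℝ)| := by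
    unfold disp
    exact (Equiv.sum_comp τ (fun s => |((π s : ℕ) : ℝ) - ((s : ℕ) : ℝ)|)).symm
  rw [h, disp, disp, ← Finset.sum_add_distrib]
  apply Finset.sum_le_sum
  intro s _
  rw [Equiv.Perm.mul_apply]
  exact abs_sub_le _ _ _

lemma disp_inv {n : ℕ} (π : Equiv.Perm (Fin n)) : disp π⁻¹ = disp π := by
  unfold disp
  rw [← Equiv.sum_comp π]
  apply Finset.sum_congr rfl
  intro s _
  rw [show π⁻¹ (π s) = s from Equiv.symm_apply_apply π s, abs_sub_comm]

/-- sum of head displacements -/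
noncomputable def Dsum (n m : ℕ) (π : Equiv.Perm (Fin n)) : ℝ := ∑ l ∈ FF n m π, disp (l.headD 1)

lemma Dsum_nonneg {n m : ℕ} (π : Equiv.Perm (Fin n)) : 0 ≤ Dsum n m π :=
  Finset.sum_nonneg fun _ _ => disp_nonneg _

/-- Hurwitz move of the `k`-th entry to the front -/
noncomputable def hur {n : ℕ} (k : ℕ) (l : List (Equiv.Perm (Fin n))) : List (Equiv.Perm (Fin n)) :=
  ((prodLR (l.take k))⁻¹ * (l.getD k 1) * prodLR (l.take k)) :: (l.take k ++ l.drop (k+1))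

lemma split_at {α : Type*} (l : List α) (d : α) {k : ℕ} (hk : k < l.length) :
    l = l.take k ++ l.getD k d :: l.drop (k+1) := by
  rw [List.getD_eq_getElem _ _ hk, List.getElem_cons_drop, List.take_append_drop]

lemma hur_mem {n m k : ℕ} {π : Equiv.Perm (Fin n)} {l : List (Equiv.Perm (Fin n))} (hk : k < m)
    (hl : l ∈ FF n m π) : hur k l ∈ FF n m π := by
  rw [mem_FF] at hl ⊢
  obtain ⟨h1, h2, h3⟩ := hl
  have hs := split_at l 1 (k := k) (by omega)
  refine ⟨?_, ?_, ?_⟩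
  · simp [hur]; omega
  · intro t ht
    simp only [hur, List.mem_cons, List.mem_append] at ht
    rcases ht with rfl | ht | ht
    · have := isSwap_conj (prodLR (l.take k))⁻¹ (l.getD k 1) (h2 _ (by
        rw [List.getD_eq_getElem _ _ (by omega)]; exact List.getElem_mem _))
      rwa [inv_inv] at this
    · exact h2 t (List.mem_of_mem_take ht)
    · exact h2 t (List.mem_of_mem_drop ht)
  · rw [← h3]
    conv_rhs => rw [hs]
    rw [hur, prodLR_cons, prodLR_append, prodLR_append, prodLR_cons]
    group

lemma hur_inj {n m k : ℕ} {π : Equiv.Perm (Fin n)} {l l' : List (Equiv.Perm (Fin n))} (hk : k < m)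
    (hl : l ∈ FF n m π) (hl' : l' ∈ FF n m π) (h : hur k l = hur k l') : l = l' := by
  rw [mem_FF] at hl hl'
  have hs := split_at l 1 (k := k) (by omega)
  have hs' := split_at l' 1 (k := k) (by omega)
  simp only [hur, List.cons.injEq] at h
  obtain ⟨h1, h2⟩ := h
  obtain ⟨h3, h4⟩ := List.append_inj h2 (by simp; omega)
  rw [h3] at h1
  have h5 : l.getD k 1 = l'.getD k 1 := by
    simpa using h1
  rw [hs, hs', h3, h4, h5]

lemma sum_disp_prefix {n m k : ℕ} (π : Equiv.Perm (Fin n)) (hk : k ≤ m) :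
    ∑ l ∈ FF n m π, disp (prodLR (l.take k)) ≤ k * Dsum n m π := by
  induction k with
  | zero => simp [prodLR_nil, disp_one]
  | succ k ih =>
    have h1 := ih (by omega)
    have h2 : ∑ l ∈ FF n m π, disp ((hur k l).headD 1) ≤ Dsum n m π := by
      unfold Dsum
      rw [← Finset.sum_image (f := fun l => disp (l.headD 1)) (g := hur k)
        (fun x hx y hy h => hur_inj (by omega) hx hy h)]
      apply Finset.sum_le_sum_of_subset_of_nonneg
      · intro l hl
        obtain ⟨l', hl', rfl⟩ := Finset.mem_image.mp hl
        exact hur_mem (by omega) hl'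
      · intro l _ _; exact disp_nonneg _
    have h3 : ∀ l ∈ FF n m π, disp (prodLR (l.take (k+1))) ≤ disp (prodLR (l.take k)) + disp ((hur k l).headD 1) := by
      intro l hl
      have hl1 := (mem_FF.mp hl).1
      have : prodLR (l.take (k+1)) = prodLR (l.take k) * (hur k l).headD 1 := by
        rw [← List.take_append_getElem (by omega : k < l.length), prodLR_append, prodLR_cons, prodLR_nil, hur]
        rw [List.headD_cons, List.getD_eq_getElem _ _ (by omega : k < l.length)]
        group
      rw [this]; exact disp_mul _ _
    have h4 := Finset.sum_le_sum h3
    rw [Finset.sum_add_distrib] at h4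
    push_cast
    linarith

lemma sum_Pt {n m k : ℕ} (π : Equiv.Perm (Fin n)) (hk : k ≤ m) :
    ∑ l ∈ FF n m π, ∑ y, |((Pt l y k : ℕ) : ℝ) - ((y : ℕ) : ℝ)| ≤ m * Dsum n m π := by
  have h := sum_disp_prefix (n := n) (m := m) π hk
  have e : ∀ l : List (Equiv.Perm (Fin n)), ∑ y, |((Pt l y k : ℕ) : ℝ) - ((y : ℕ) : ℝ)| =
      disp (prodLR (l.take k)) := fun l => disp_inv _
  simp only [e]
  refine le_trans h (mul_le_mul_of_nonneg_right (by exact_mod_cast hk) (Dsum_nonneg _))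

end disp


section bad

open scoped Classical in
/-- parameter finset -/
noncomputable def PP (n g : ℕ) : Finset (Param n) :=
  ((Finset.range (n - 1 + 2 * g - 1) ×ˢ Finset.range (n - 1 + 2 * g)) ×ˢ Finset.univ).filter (paramOK n g)

lemma mem_PP {n g : ℕ} {p : Param n} : p ∈ PP n g ↔ paramOK n g p := by
  simp only [PP, Finset.mem_filter, Finset.mem_product, Finset.mem_range, Finset.mem_univ, and_true,
    and_iff_right_iff_imp]
  intro h
  have h1 := h.1
  have h2 := h.2.1
  omega

lemma PP_coe (n g : ℕ) : {p : Param n | paramOK n g p} = (PP n g : Set _) := by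
  ext p; simp [mem_PP]

lemma card_pairs (m : ℕ) : ((Finset.range m ×ˢ Finset.range m).filter fun q => q.1 < q.2).card = m.choose 2 := by
  have : (Finset.range m ×ˢ Finset.range m).filter (fun q : ℕ × ℕ => q.1 < q.2) =
    (Finset.range m).biUnion fun w => (Finset.range w).image fun v => (v, w) := by
    ext ⟨v, w⟩
    simp
    omega
  rw [this, Finset.card_biUnion]
  · have : ∀ w, ((Finset.range w).image fun v => (v, w)).card = w := by
      intro w
      rw [Finset.card_image_of_injective]
      · simp
      · intro a b h; simpa using h
    simp only [this]
    rw [Finset.sum_range_id, Nat.choose_two_right]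
  · intro a _ b _ hab
    rw [Function.onFun, Finset.disjoint_left]
    intro q h1 h2
    simp at h1 h2
    obtain ⟨_, _, rfl⟩ := h1
    obtain ⟨_, _, h⟩ := h2
    simp at h; omega

lemma card_triples (n : ℕ) : ((Finset.univ : Finset (Fin n × Fin n × Fin n)).filter
    fun q => q.1 < q.2.1 ∧ q.2.1 < q.2.2).card = n.choose 3 := by
  have h0 := Finset.card_powersetCard 3 (Finset.range n)
  rw [Finset.card_range] at h0
  rw [← h0]
  refine Finset.card_bij (fun q _ => {(q.1 : ℕ), (q.2.1 : ℕ), (q.2.2 : ℕ)}) ?_ ?_ ?_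
  · rintro ⟨a, b, c⟩ h
    simp only [Finset.mem_filter, Finset.mem_univ, true_and, Fin.lt_def] at h
    rw [Finset.mem_powersetCard]
    constructor
    · intro x
      simp only [Finset.mem_insert, Finset.mem_singleton, Finset.mem_range]
      have := a.2; have := b.2; have := c.2
      omega
    · rw [Finset.card_eq_three]
      exact ⟨a, b, c, by omega, by omega, by omega, rfl⟩
  · rintro ⟨a, b, c⟩ h ⟨a', b', c'⟩ h' e
    simp only [Finset.mem_filter, Finset.mem_univ, true_and, Fin.lt_def] at h h'
    simp only [Finset.ext_iff, Finset.mem_insert, Finset.mem_singleton] at e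
    have e1 := (e a).mp (by simp)
    have e2 := (e b).mp (by simp)
    have e3 := (e c).mp (by simp)
    have e4 := (e a').mpr (by simp)
    have e5 := (e b').mpr (by simp)
    have e6 := (e c').mpr (by simp)
    simp only [Prod.mk.injEq, Fin.ext_iff]
    omega
  · intro s hs
    rw [Finset.mem_powersetCard] at hs
    obtain ⟨x, y, z, hx, hy, hz, hxy, hyz⟩ : ∃ x y z, x ∈ s ∧ y ∈ s ∧ z ∈ s ∧ x < y ∧ y < z :=
      ⟨s.orderEmbOfFin hs.2 0, s.orderEmbOfFin hs.2 1, s.orderEmbOfFin hs.2 2,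
        Finset.orderEmbOfFin_mem s hs.2 _, Finset.orderEmbOfFin_mem s hs.2 _,
        Finset.orderEmbOfFin_mem s hs.2 _,
        (s.orderEmbOfFin hs.2).strictMono (by decide), (s.orderEmbOfFin hs.2).strictMono (by decide)⟩
    have hlt : ∀ i ∈ s, i < n := fun i hi => Finset.mem_range.mp (hs.1 hi)
    refine ⟨(⟨x, hlt x hx⟩, ⟨y, hlt y hy⟩, ⟨z, hlt z hz⟩), ?_, ?_⟩
    · exact Finset.mem_filter.mpr ⟨Finset.mem_univ _, hxy, hyz⟩
    · apply Finset.eq_of_subset_of_card_le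
      · intro u
        simp only [Finset.mem_insert, Finset.mem_singleton]
        rintro (rfl | rfl | rfl) <;> assumption
      · rw [hs.2]
        apply le_of_eq
        symm
        rw [Finset.card_eq_three]
        exact ⟨x, y, z, by omega, by omega, by omega, rfl⟩

lemma card_PP (n g : ℕ) : (PP n g).card = (n - 1 + 2 * g).choose 2 * n.choose 3 := by
  rw [← card_pairs, ← card_triples, ← Finset.card_product]
  congr 1
  ext ⟨⟨v, w⟩, ⟨a, b, c⟩⟩
  rw [mem_PP]
  simp only [paramOK, Finset.mem_product, Finset.mem_filter, Finset.mem_range, Finset.mem_univ, true_and]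
  constructor
  · rintro ⟨h1, h2, h3, h4⟩; exact ⟨⟨⟨by omega, h2⟩, h1⟩, h3, h4⟩
  · rintro ⟨⟨⟨_, h2⟩, h1⟩, h3, h4⟩; exact ⟨h1, h2, h3, h4⟩

/-- pointwise displacement -/
noncomputable def TT {n : ℕ} (F : List (Equiv.Perm (Fin n))) (y : Fin n) (k : ℕ) : ℝ :=
  |((Pt F y k : ℕ) : ℝ) - ((y : ℕ) : ℝ)|

open scoped Classical in
/-- closeness indicator -/
noncomputable def KK {n : ℕ} (r : ℝ) (a b : Fin n) : ℝ :=
  if a < b ∧ ((b : ℕ) : ℝ) - ((a : ℕ) : ℝ) ≤ r then 1 else 0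

open scoped Classical in
/-- non-monotonicity indicator -/
noncomputable def MM {n : ℕ} (F : List (Equiv.Perm (Fin n))) (a : Fin n) : ℝ := if Mono F a then 0 else 1

lemma KK_nonneg {n : ℕ} (r : ℝ) (a b : Fin n) : 0 ≤ KK r a b := by unfold KK; split_ifs <;> norm_num

lemma TT_nonneg {n : ℕ} (F : List (Equiv.Perm (Fin n))) (y : Fin n) (k : ℕ) : 0 ≤ TT F y k := abs_nonneg _

lemma sum_KK {n : ℕ} {r : ℝ} (hr : 0 ≤ r) (a : Fin n) : ∑ b, KK r a b ≤ r := by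
  classical
  unfold KK
  rw [← Finset.sum_filter, Finset.sum_const, nsmul_eq_mul, mul_one]
  have : (Finset.univ.filter fun b : Fin n => a < b ∧ ((b : ℕ) : ℝ) - ((a : ℕ) : ℝ) ≤ r).card ≤
      (Finset.Ioc (a : ℕ) (a + ⌊r⌋₊)).card := by
    apply Finset.card_le_card_of_injOn (fun b : Fin n => (b : ℕ))
    · intro b hb
      simp only [Finset.coe_filter, Finset.mem_univ, true_and, Set.mem_ofPred_eq] at hb
      simp only [Finset.coe_Ioc, Set.mem_Ioc]
      refine ⟨hb.1, ?_⟩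
      have h1 : ((b - a : ℕ) : ℝ) ≤ r := by
        rw [Nat.cast_sub (Nat.le_of_lt hb.1)]; exact hb.2
      have := Nat.le_floor h1
      omega
    · intro x _ y _ h; exact Fin.ext h
  rw [Nat.card_Ioc, Nat.add_sub_cancel_left] at this
  exact le_trans (by exact_mod_cast this) (Nat.floor_le hr)

open scoped Classical in
lemma sepa_bound {n : ℕ} {F : List (Equiv.Perm (Fin n))} {v w : ℕ} {a b : Fin n} (hab : a < b) {r : ℝ} (hr : 0 < r) :
    (if Sepa F v w a b then (0:ℝ) else 1) ≤ KK (2 * r) a b +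
      r⁻¹ * (TT F a v + TT F a (w-1) + TT F b v + TT F b (w-1)) := by
  have t1 := TT_nonneg F a v
  have t2 := TT_nonneg F a (w-1)
  have t3 := TT_nonneg F b v
  have t4 := TT_nonneg F b (w-1)
  have ht : 0 ≤ r⁻¹ * (TT F a v + TT F a (w-1) + TT F b v + TT F b (w-1)) := by positivity
  have hk := KK_nonneg (2*r) a b
  split_ifs with hS
  · linarith
  by_cases hc : ((b : ℕ) : ℝ) - ((a : ℕ) : ℝ) ≤ 2 * r
  · have : KK (2*r) a b = 1 := by simp [KK, hab, hc]
    linarith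
  push Not at hc
  have key : ∀ i j, ¬ (Pt F a i < Pt F b j) → 2 * r ≤ TT F a i + TT F b j := by
    intro i j h
    rw [not_lt, Fin.le_def] at h
    have h' : ((Pt F b j : ℕ) : ℝ) ≤ ((Pt F a i : ℕ) : ℝ) := by exact_mod_cast h
    have h1 := le_abs_self (((Pt F a i : ℕ) : ℝ) - ((a : ℕ) : ℝ))
    have h2 := neg_abs_le (((Pt F b j : ℕ) : ℝ) - ((b : ℕ) : ℝ))
    unfold TT
    linarith
  have h5 : r ≤ TT F a v + TT F a (w-1) + TT F b v + TT F b (w-1) := by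
    unfold Sepa at hS
    by_contra! hlt
    apply hS
    refine ⟨?_, ?_, ?_, ?_⟩ <;> by_contra hh <;> have := key _ _ hh <;> linarith
  have h6 : 1 ≤ r⁻¹ * (TT F a v + TT F a (w-1) + TT F b v + TT F b (w-1)) := by
    rw [← inv_mul_cancel₀ hr.ne']
    exact mul_le_mul_of_nonneg_left h5 (by positivity)
  linarith

open scoped Classical in
lemma good_bound {n g : ℕ} {F : List (Equiv.Perm (Fin n))} {p : Param n} (hp : paramOK n g p) {r : ℝ} (hr : 0 < r) :
    (if Good F p then (0:ℝ) else 1) ≤ MM F p.2.1 + KK (2*r) p.2.1 p.2.2.1 + KK (2*r) p.2.2.1 p.2.2.2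
      + r⁻¹ * (TT F p.2.1 p.1.1 + TT F p.2.1 (p.1.2-1) + TT F p.2.2.1 p.1.1 + TT F p.2.2.1 (p.1.2-1))
      + r⁻¹ * (TT F p.2.2.1 p.1.1 + TT F p.2.2.1 (p.1.2-1) + TT F p.2.2.2 p.1.1 + TT F p.2.2.2 (p.1.2-1)) := by
  have h1 := sepa_bound (F := F) (v := p.1.1) (w := p.1.2) hp.2.2.1 hr
  have h2 := sepa_bound (F := F) (v := p.1.1) (w := p.1.2) hp.2.2.2 hr
  have h3 : (if Good F p then (0:ℝ) else 1) ≤ MM F p.2.1 +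
      (if Sepa F p.1.1 p.1.2 p.2.1 p.2.2.1 then (0:ℝ) else 1) + (if Sepa F p.1.1 p.1.2 p.2.2.1 p.2.2.2 then (0:ℝ) else 1) := by
    unfold Good MM
    split_ifs <;> first | (exfalso; tauto) | norm_num
  linarith

open scoped Classical in
lemma sum_Mono {n h : ℕ} {F : List (Equiv.Perm (Fin n))} (hF : F ∈ FF n (n - 1 + 2 * h) (finRotate n)) :
    ∑ a, MM F a ≤ 2 * h + 1 := by
  rw [mem_FF] at hF
  have h1 := card_notMono hF.2.1 hF.2.2 (Finset.univ.filter fun u => ¬ Mono F u) (by simp)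
  rw [hF.1, Nat.add_sub_cancel_left] at h1
  have : ∀ a, MM F a = if ¬ Mono F a then 1 else 0 := by
    intro a; unfold MM; split_ifs <;> simp_all
  simp only [this]
  rw [← Finset.sum_filter, Finset.sum_const, nsmul_eq_mul, mul_one]
  exact_mod_cast h1

open scoped Classical in
lemma bad_bound {n g : ℕ} (hg : 1 ≤ g) {r : ℝ} (hr : 0 < r) :
    ∑ F ∈ FF n (n - 1 + 2 * (g-1)) (finRotate n), ∑ p ∈ PP n g, (if Good F p then (0:ℝ) else 1) ≤
     ((n - 1 + 2 * g : ℕ) : ℝ) ^ 2 * (fc n (g-1) * (2 * g * n ^ 2 + 4 * r * n ^ 2) +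
       8 * r⁻¹ * n ^ 2 * ((n - 1 + 2 * g : ℕ) * Dsum n (n - 1 + 2 * (g-1)) (finRotate n))) := by
  set m := n - 1 + 2 * g with hm
  set m' := n - 1 + 2 * (g-1) with hm'
  set D := Dsum n m' (finRotate n) with hD
  have hD0 : 0 ≤ D := Dsum_nonneg _
  set Z : List (Equiv.Perm (Fin n)) → ℕ → ℝ := fun F k => ∑ y, TT F y k with hZ
  have step1 : ∀ F ∈ FF n m' (finRotate n), ∑ p ∈ PP n g, (if Good F p then (0:ℝ) else 1) ≤
      ∑ q ∈ Finset.range (m-1) ×ˢ Finset.range m, ((2 * g * n ^ 2 + 4 * r * n ^ 2) +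
        r⁻¹ * n ^ 2 * (4 * Z F q.1 + 4 * Z F (q.2 - 1))) := by
    intro F hF
    refine le_trans (Finset.sum_le_sum fun p hp => good_bound (mem_PP.mp hp) hr) ?_
    refine le_trans (Finset.sum_le_sum_of_subset_of_nonneg
      (t := (Finset.range (m-1) ×ˢ Finset.range m) ×ˢ Finset.univ) ?_ ?_) ?_
    · exact Finset.filter_subset _ _
    · intro p _ _
      have h1 := KK_nonneg (2*r) p.2.1 p.2.2.1
      have h2 := KK_nonneg (2*r) p.2.2.1 p.2.2.2
      have h3 : (0:ℝ) ≤ MM F p.2.1 := by unfold MM; split_ifs <;> norm_num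
      have := TT_nonneg F
      have h4 : 0 ≤ r⁻¹ * (TT F p.2.1 p.1.1 + TT F p.2.1 (p.1.2-1) + TT F p.2.2.1 p.1.1 + TT F p.2.2.1 (p.1.2-1)) :=
        mul_nonneg (by positivity) (by linarith [this p.2.1 p.1.1, this p.2.1 (p.1.2-1), this p.2.2.1 p.1.1, this p.2.2.1 (p.1.2-1)])
      have h5 : 0 ≤ r⁻¹ * (TT F p.2.2.1 p.1.1 + TT F p.2.2.1 (p.1.2-1) + TT F p.2.2.2 p.1.1 + TT F p.2.2.2 (p.1.2-1)) :=
        mul_nonneg (by positivity) (by linarith [this p.2.2.2 p.1.1, this p.2.2.2 (p.1.2-1), this p.2.2.1 p.1.1, this p.2.2.1 (p.1.2-1)])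
      linarith
    · rw [Finset.sum_product]
      apply Finset.sum_le_sum
      rintro ⟨v, w⟩ _
      simp only [← Finset.univ_product_univ, Finset.sum_product, Finset.sum_add_distrib, ← Finset.mul_sum,
        Finset.sum_const, Finset.card_univ, Fintype.card_fin, nsmul_eq_mul, Finset.card_product, Nat.cast_mul]
      have k1 := sum_Mono hF
      have k2 : ∀ a : Fin n, ∑ b, KK (2*r) a b ≤ 2 * r := fun a => sum_KK (by positivity) a
      have k3 : ∑ a : Fin n, ∑ b, KK (2*r) a b ≤ n * (2 * r) := by
        refine le_trans (Finset.sum_le_sum fun a _ => k2 a) ?_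
        simp
      have e1 : ∀ k, ∑ y, TT F y k = Z F k := fun k => rfl
      simp only [e1]
      have hg' : ((g - 1 : ℕ) : ℝ) = g - 1 := by rw [Nat.cast_sub hg]; simp
      rw [hg'] at k1
      have j1 := mul_le_mul_of_nonneg_left k1 (show (0:ℝ) ≤ n * n by positivity)
      have j3 := mul_le_mul_of_nonneg_left k3 (show (0:ℝ) ≤ n by positivity)
      have : (0:ℝ) ≤ n := by positivity
      nlinarith [sq_nonneg (n:ℝ)]
  refine le_trans (Finset.sum_le_sum step1) ?_
  rw [Finset.sum_comm]
  have step2 : ∀ q ∈ Finset.range (m-1) ×ˢ Finset.range m,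
      ∑ F ∈ FF n m' (finRotate n), ((2 * g * n ^ 2 + 4 * r * n ^ 2 : ℝ) +
        r⁻¹ * n ^ 2 * (4 * Z F q.1 + 4 * Z F (q.2 - 1))) ≤
       (fc n (g-1) * (2 * g * n ^ 2 + 4 * r * n ^ 2) + 8 * r⁻¹ * n ^ 2 * (m * D)) := by
    rintro ⟨v, w⟩ hq
    simp only [Finset.mem_product, Finset.mem_range] at hq
    simp only [Finset.sum_add_distrib, ← Finset.mul_sum, Finset.sum_const, nsmul_eq_mul]
    have hf : fc n (g-1) = ((FF n m' (finRotate n)).card : ℝ) := rfl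
    have s1 : ∑ F ∈ FF n m' (finRotate n), Z F v ≤ m' * D := sum_Pt _ (by omega)
    have s2 : ∑ F ∈ FF n m' (finRotate n), Z F (w-1) ≤ m' * D := sum_Pt _ (by omega)
    have hmm : (m' : ℝ) * D ≤ m * D := mul_le_mul_of_nonneg_right (by
      have : m' ≤ m := by omega
      exact_mod_cast this) hD0
    rw [← hf]
    have h0 : 0 ≤ r⁻¹ * (n:ℝ) ^ 2 := by positivity
    have := mul_le_mul_of_nonneg_left (show 4 * ∑ F ∈ FF n m' (finRotate n), Z F v +
       4 * ∑ F ∈ FF n m' (finRotate n), Z F (w-1) ≤ 8 * (m * D) by linarith) h0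
    linarith
  refine le_trans (Finset.sum_le_sum step2) ?_
  rw [Finset.sum_const, Finset.card_product, Finset.card_range, Finset.card_range, nsmul_eq_mul]
  apply mul_le_mul_of_nonneg_right
  · have : (m - 1) * m ≤ m ^ 2 := by rw [pow_two]; exact Nat.mul_le_mul_right _ (by omega)
    exact_mod_cast this
  · have : 0 ≤ fc n (g-1) := by unfold fc; positivity
    positivity

end bad


section trans

lemma tv_core {α X : Type*} [DecidableEq X] (A G : Finset α) (φ : α → X) (Y : Finset X) (hGA : G ⊆ A)
    (hG : ∀ q ∈ G, φ q ∈ Y) (K : ℕ) (hK : ∀ y ∈ Y, (G.filter fun q => φ q = y).card ≤ K)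
    (hA : 0 < A.card) (hY : 0 < Y.card) :
    ∑ y ∈ Y, |((G.filter fun q => φ q = y).card : ℝ) / A.card - 1 / Y.card| ≤
      ((A.card : ℝ) - G.card) / A.card + 2 * |(K : ℝ) * Y.card / A.card - 1| := by
  have hA' : (0:ℝ) < A.card := by exact_mod_cast hA
  have hY' : (0:ℝ) < Y.card := by exact_mod_cast hY
  have h1 : ∀ y ∈ Y, |((G.filter fun q => φ q = y).card : ℝ) / A.card - 1 / Y.card| ≤
      ((K : ℝ) / A.card - (G.filter fun q => φ q = y).card / A.card) + |(K : ℝ) * Y.card / A.card - 1| / Y.card := by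
    intro y hy
    have h2 : ((G.filter fun q => φ q = y).card : ℝ) / A.card ≤ K / A.card := by
      apply div_le_div_of_nonneg_right _ hA'.le
      exact_mod_cast hK y hy
    have h3 : |(K : ℝ) / A.card - 1 / Y.card| = |(K : ℝ) * Y.card / A.card - 1| / Y.card := by
      rw [← abs_of_pos hY', ← abs_div, abs_of_pos hY']
      congr 1
      field_simp
    rw [← h3]
    have h4 := abs_sub_le (((G.filter fun q => φ q = y).card : ℝ) / A.card) (K / A.card) (1 / Y.card)
    have h4' : |((G.filter fun q => φ q = y).card : ℝ) / A.card - K / A.card| = K / A.card - ((G.filter fun q => φ q = y).card : ℝ) / A.card := by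
      rw [abs_sub_comm, abs_of_nonneg (sub_nonneg.mpr h2)]
    rw [h4'] at h4
    exact h4
  refine le_trans (Finset.sum_le_sum h1) ?_
  rw [Finset.sum_add_distrib, Finset.sum_sub_distrib, Finset.sum_const, Finset.sum_const, ← Finset.sum_div]
  have h5 : ∑ y ∈ Y, ((G.filter fun q => φ q = y).card : ℝ) = G.card := by
    rw [Finset.card_eq_sum_card_fiberwise (f := φ) (t := Y) hG]; push_cast; rfl
  rw [h5, nsmul_eq_mul, nsmul_eq_mul, mul_div_cancel₀ _ hY'.ne', sub_div, div_self hA'.ne']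
  have := le_abs_self ((K : ℝ) * Y.card / A.card - 1)
  have e : (Y.card : ℝ) * (K / A.card) = (K : ℝ) * Y.card / A.card := by ring
  rw [e]
  linarith

lemma disp_swap {n : ℕ} {a b : Fin n} : disp (Equiv.swap a b) = 2 * |((b : ℕ) : ℝ) - ((a : ℕ) : ℝ)| := by
  by_cases hab : a = b
  · subst hab; simp [disp]
  unfold disp
  rw [← Finset.sum_subset (Finset.subset_univ {a, b})]
  · rw [Finset.sum_pair hab, Equiv.swap_apply_left, Equiv.swap_apply_right]
    rw [abs_sub_comm ((a : ℕ) : ℝ)]; ring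
  · intro x _ hx
    simp only [Finset.mem_insert, Finset.mem_singleton, not_or] at hx
    rw [Equiv.swap_apply_of_ne_of_ne hx.1 hx.2]; simp

lemma disp_swap_le {n : ℕ} {t : Equiv.Perm (Fin n)} (ht : t.IsSwap) : disp t ≤ 2 * n := by
  obtain ⟨a, b, _, rfl⟩ := ht
  rw [disp_swap]
  have h1 : ((a : ℕ) : ℝ) < n := by exact_mod_cast a.2
  have h2 : ((b : ℕ) : ℝ) < n := by exact_mod_cast b.2
  have h3 : (0:ℝ) ≤ ((a : ℕ) : ℝ) := by positivity
  have h4 : (0:ℝ) ≤ ((b : ℕ) : ℝ) := by positivity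
  have : |((b : ℕ) : ℝ) - ((a : ℕ) : ℝ)| ≤ n := by rw [abs_le]; constructor <;> linarith
  linarith

lemma disp_headD_le {n m : ℕ} {π : Equiv.Perm (Fin n)} {l : List (Equiv.Perm (Fin n))} (hl : l ∈ FF n m π) :
    disp (l.headD 1) ≤ 2 * n := by
  cases l with
  | nil => simp [disp_one]
  | cons t l => exact disp_swap_le ((mem_FF.mp hl).2.1 t (by simp))

open scoped Classical in
/-- hit indicator -/
noncomputable def HH {n : ℕ} (t : Equiv.Perm (Fin n)) (s : Fin n) : ℝ :=
  if ∃ a b, a < b ∧ t = Equiv.swap a b ∧ a ≤ s ∧ s < b then 1 else 0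

lemma HH_nonneg {n : ℕ} (t : Equiv.Perm (Fin n)) (s : Fin n) : 0 ≤ HH t s := by
  unfold HH; split_ifs <;> norm_num

lemma HH_one {n : ℕ} (s : Fin n) : HH 1 s = 0 := by
  unfold HH
  rw [if_neg]
  rintro ⟨a, b, hab, h, _⟩
  have := Equiv.congr_fun h a
  rw [Equiv.swap_apply_left] at this
  exact absurd this hab.ne

lemma HH_swap {n : ℕ} {a b : Fin n} (hab : a < b) (s : Fin n) :
    HH (Equiv.swap a b) s = if a ≤ s ∧ s < b then 1 else 0 := by
  unfold HH
  congr 1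
  apply propext
  constructor
  · rintro ⟨a', b', h1, h2, h3⟩
    obtain ⟨rfl, rfl⟩ := swap_inj_lt hab h1 h2
    exact h3
  · intro h; exact ⟨a, b, hab, rfl, h⟩

lemma sum_HH {n : ℕ} {t : Equiv.Perm (Fin n)} (ht : t = 1 ∨ t.IsSwap) : ∑ s, HH t s = disp t / 2 := by
  rcases ht with rfl | ⟨a, b, hab, rfl⟩
  · simp [HH_one, disp_one]
  · wlog h : a < b generalizing a b
    · rw [Equiv.swap_comm]; exact this b a hab.symm (lt_of_le_of_ne (not_lt.mp h) hab.symm)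
    simp only [HH_swap h]
    rw [← Finset.sum_filter, Finset.sum_const, nsmul_eq_mul, mul_one]
    have : (Finset.univ.filter fun s => a ≤ s ∧ s < b) = Finset.Ico a b := by ext; simp
    rw [this, Fin.card_Ico, disp_swap, Nat.cast_sub (by omega), abs_of_nonneg]
    · ring
    · rw [sub_nonneg]; exact_mod_cast h.le

lemma conj_swap {n : ℕ} (σ : Equiv.Perm (Fin n)) (a b : Fin n) :
    σ * Equiv.swap a b * σ⁻¹ = Equiv.swap (σ a) (σ b) := by
  have := conj_swap' σ⁻¹ a b
  rwa [inv_inv] at this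

/-- rigid translation off the modified points -/
lemma conj_shift {n : ℕ} {σ ζ : Equiv.Perm (Fin n)} (hσ0 : ∀ h0 : 0 < n, σ ⟨0, h0⟩ = ⟨0, h0⟩)
    (hσ : σ * ζ * σ⁻¹ = finRotate n) {p q : Fin n} (hpq : p < q)
    (h : ∀ s : Fin n, p ≤ s → s < q → ζ s = finRotate n s) :
    ((σ q : ℕ) : ℤ) - (σ p : ℕ) = (q : ℕ) - (p : ℕ) := by
  have key : ∀ j : ℕ, ∀ hj : p + j < n, p + j ≤ q → ((σ ⟨p + j, hj⟩ : Fin n) : ℕ) = σ p + j := by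
    intro j
    induction j with
    | zero => intro hj _; simp
    | succ j ih =>
      intro hj hjq
      have h1 := ih (by omega) (by omega)
      have h2 := h ⟨p + j, by omega⟩ (by rw [Fin.le_def]; simp) (by rw [Fin.lt_def]; simp; omega)
      have h3 : finRotate n ⟨p + j, by omega⟩ = ⟨p + (j+1), hj⟩ := by
        apply Fin.ext
        rw [finRotate_val]
        simp only
        rw [if_neg (by omega)]; omega
      rw [h3] at h2
      have h4 : σ ⟨p + (j+1), hj⟩ = finRotate n (σ ⟨p + j, by omega⟩) := by
        rw [← hσ, ← h2]; simp
      have h5 := congrArg (fun x : Fin n => (x : ℕ)) h4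
      simp only [finRotate_val] at h5
      by_cases h6 : ((σ ⟨p + j, by omega⟩ : Fin n) : ℕ) + 1 = n
      · exfalso
        rw [if_pos h6] at h5
        have h0 : 0 < n := by omega
        have h7 : σ ⟨p + (j+1), hj⟩ = σ ⟨0, h0⟩ := by
          rw [hσ0 h0]; exact Fin.ext h5
        have := congrArg (fun x : Fin n => (x : ℕ)) (σ.injective h7)
        simp at this
      · rw [if_neg h6] at h5
        omega
  have := key (q - p) (by omega) (by omega)
  have e : (⟨p + (q - p), by omega⟩ : Fin n) = q := Fin.ext (by simp; omega)
  rw [e] at this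
  omega

/-- sum of hits -/
noncomputable def H6 {n : ℕ} (F : List (Equiv.Perm (Fin n))) (p : Param n) : ℝ :=
  HH (F.headD 1) (Pt F p.2.1 p.1.1) + HH (F.headD 1) (Pt F p.2.2.1 p.1.1) + HH (F.headD 1) (Pt F p.2.2.2 p.1.1) +
  HH (F.headD 1) (Pt F p.2.1 (p.1.2-1)) + HH (F.headD 1) (Pt F p.2.2.1 (p.1.2-1)) + HH (F.headD 1) (Pt F p.2.2.2 (p.1.2-1))

lemma head_Lof {n : ℕ} (ty : Bool) {F : List (Equiv.Perm (Fin n))} {p : Param n}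
    (hvw : p.1.1 < p.1.2) (hw : p.1.2 < F.length + 2) (hv : p.1.1 ≠ 0) :
    ∃ R, Lof ty F p = F.headD 1 :: R := by
  obtain ⟨A, B, C, hF, hA, hB, hL⟩ := insert_split F hvw hw
  unfold Lof
  rw [hL, hL]
  cases A with
  | nil => simp at hA; omega
  | cons t A => subst hF; cases ty <;> simp

lemma transport {n g : ℕ} (hg : 1 ≤ g) {F x : List (Equiv.Perm (Fin n))} {p : Param n} {ty : Bool}
    {σ : Equiv.Perm (Fin n)} (hF : F ∈ Fcal n (g-1)) (hp : paramOK n g p) (hx : x ∈ Fcal n g)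
    (hσ0 : ∀ h0 : 0 < n, σ ⟨0, h0⟩ = ⟨0, h0⟩) (hxl : x = (Lof ty F p).map fun t => σ * t * σ⁻¹) :
    disp (x.headD 1) ≤ disp (F.headD 1) + (if p.1.1 = 0 then 2 * (n:ℝ) else 0) + 2 * n * H6 F p := by
  have hx2 : disp (x.headD 1) ≤ 2 * n := by
    rw [Fcal_eq] at hx; exact disp_headD_le hx
  have h6 : 0 ≤ H6 F p := by
    unfold H6
    have := HH_nonneg (F.headD 1)
    linarith [this (Pt F p.2.1 p.1.1), this (Pt F p.2.2.1 p.1.1), this (Pt F p.2.2.2 p.1.1),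
      this (Pt F p.2.1 (p.1.2-1)), this (Pt F p.2.2.1 (p.1.2-1)), this (Pt F p.2.2.2 (p.1.2-1))]
  have hd := disp_nonneg (F.headD 1)
  have hn6 : 0 ≤ 2 * n * H6 F p := by positivity
  split_ifs with hv
  · linarith
  have hlen : F.length + 2 = n - 1 + 2 * g := by rw [hF.1]; omega
  have hw : p.1.2 < F.length + 2 := by rw [hlen]; exact hp.2.1
  obtain ⟨R, hR⟩ := head_Lof ty hp.1 hw hv
  have hxh : x.headD 1 = σ * F.headD 1 * σ⁻¹ := by rw [hxl, hR]; simp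
  have hFs : (F.headD 1).IsSwap := by
    have := swaps_Lof ty hF.2.1 hp.1 hw hp.2.2.1 hp.2.2.2 (F.headD 1) (by rw [hR]; simp)
    exact this
  obtain ⟨P, Q, hPQ, ht⟩ : ∃ P Q, P < Q ∧ F.headD 1 = Equiv.swap P Q := by
    obtain ⟨a, b, hab, h⟩ := hFs
    rcases lt_or_gt_of_ne hab with h' | h'
    · exact ⟨a, b, h', h⟩
    · exact ⟨b, a, h', by rw [h, Equiv.swap_comm]⟩
  by_cases hone : 1 ≤ H6 F p
  · have : 2 * (n : ℝ) * 1 ≤ 2 * n * H6 F p := mul_le_mul_of_nonneg_left hone (by positivity)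
    linarith
  have hno : ∀ y k, HH (F.headD 1) (Pt F y k) < 1 → ¬ (P ≤ Pt F y k ∧ Pt F y k < Q) := by
    intro y k h hh
    rw [ht, HH_swap hPQ, if_pos hh] at h
    exact lt_irrefl _ h
  have hnn := HH_nonneg (F.headD 1)
  push Not at hone
  unfold H6 at hone
  have a1 := hnn (Pt F p.2.1 p.1.1)
  have a2 := hnn (Pt F p.2.2.1 p.1.1)
  have a3 := hnn (Pt F p.2.2.2 p.1.1)
  have a4 := hnn (Pt F p.2.1 (p.1.2-1))
  have a5 := hnn (Pt F p.2.2.1 (p.1.2-1))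
  have a6 := hnn (Pt F p.2.2.2 (p.1.2-1))
  have n1 := hno p.2.1 p.1.1 (by linarith)
  have n2 := hno p.2.2.1 p.1.1 (by linarith)
  have n3 := hno p.2.2.2 p.1.1 (by linarith)
  have n4 := hno p.2.1 (p.1.2-1) (by linarith)
  have n5 := hno p.2.2.1 (p.1.2-1) (by linarith)
  have n6 := hno p.2.2.2 (p.1.2-1) (by linarith)
  have hne : ∀ s : Fin n, P ≤ s → s < Q → ∀ u : Fin n, ¬ (P ≤ u ∧ u < Q) → s ≠ u := by
    rintro s h1 h2 u hu rfl; exact hu ⟨h1, h2⟩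
  have hpr := prodLR_Lof (F := F) (p := p) hp.1 hw
  have hζ : σ * prodLR (Lof ty F p) * σ⁻¹ = finRotate n := by
    rw [← prodLR_map_conj, ← hxl]; exact hx.2.2
  have hsh := conj_shift hσ0 hζ hPQ (by
    intro s h1 h2
    have hs := hne s h1 h2
    cases ty
    · rw [hpr.2, Equiv.Perm.mul_apply, Equiv.Perm.mul_apply]
      rw [Equiv.swap_apply_of_ne_of_ne (a := Pt F p.2.1 p.1.1) (hs _ n1) (by first | exact hs _ n2 | exact hs _ n3)]
      rw [Equiv.swap_apply_of_ne_of_ne (hs _ n4) (by first | exact hs _ n5 | exact hs _ n6), hF.2.2]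
    · rw [hpr.1, Equiv.Perm.mul_apply, Equiv.Perm.mul_apply]
      rw [Equiv.swap_apply_of_ne_of_ne (a := Pt F p.2.1 p.1.1) (hs _ n1) (by first | exact hs _ n2 | exact hs _ n3)]
      rw [Equiv.swap_apply_of_ne_of_ne (hs _ n4) (by first | exact hs _ n5 | exact hs _ n6), hF.2.2])
  rw [hxh, ht, conj_swap, disp_swap, disp_swap]
  have e : ((σ Q : ℕ) : ℝ) - (σ P : ℕ) = (Q : ℕ) - (P : ℕ) := by exact_mod_cast hsh
  rw [e]
  linarith

end trans


section ind
open Filter Topology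

lemma tv_gen {α X : Type*} [DecidableEq X] [DecidableEq α] (A G : Finset α) (φ : α → X) (Y : Finset X) (hGA : G ⊆ A)
    (hG : ∀ q ∈ G, φ q ∈ Y) (K : ℕ) (hK : ∀ y ∈ Y, (G.filter fun q => φ q = y).card ≤ K)
    (hA : 0 < A.card) (hY : 0 < Y.card) (μ ν : X → ℝ)
    (hμ : ∀ x, μ x = ((A.filter fun q => φ q = x).card : ℝ) / A.card)
    (hν : ∀ x ∈ Y, ν x = 1 / Y.card) (hν' : ∀ x, x ∉ Y → ν x = 0) :
    dTV μ ν ≤ ((A.card : ℝ) - G.card) / A.card + |(K : ℝ) * Y.card / A.card - 1| := by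
  have core := tv_core A G φ Y hGA hG K hK hA hY
  have hA' : (0:ℝ) < A.card := by exact_mod_cast hA
  unfold dTV
  have hS : ∑' x, |μ x - ν x| = ∑ x ∈ A.image φ ∪ Y, |μ x - ν x| := by
    apply tsum_eq_sum
    intro x hx
    rw [Finset.mem_union, not_or] at hx
    rw [hν' x hx.2, hμ, Finset.filter_eq_empty_iff.mpr]
    · simp
    · intro q hq h; exact hx.1 (Finset.mem_image.mpr ⟨q, hq, h⟩)
  have hGS : ∀ x, ((A.filter fun q => φ q = x).card : ℝ) =
      ((A \ G).filter fun q => φ q = x).card + (G.filter fun q => φ q = x).card := by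
    intro x
    rw [← Nat.cast_add, ← Finset.card_union_of_disjoint]
    · congr 2
      rw [← Finset.filter_union, Finset.sdiff_union_of_subset hGA]
    · exact Finset.disjoint_filter_filter Finset.sdiff_disjoint
  have h1 : ∀ x ∈ A.image φ ∪ Y, |μ x - ν x| ≤ (((A \ G).filter fun q => φ q = x).card : ℝ) / A.card +
      |((G.filter fun q => φ q = x).card : ℝ) / A.card - ν x| := by
    intro x _
    rw [hμ, hGS, add_div, add_sub_assoc]
    refine le_trans (abs_add_le _ _) ?_
    rw [abs_of_nonneg (a := _ / _) (by positivity)]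
  rw [hS]
  have h2 := Finset.sum_le_sum h1
  rw [Finset.sum_add_distrib, ← Finset.sum_div] at h2
  have h3 : ∑ x ∈ A.image φ ∪ Y, (((A \ G).filter fun q => φ q = x).card : ℝ) = (A.card : ℝ) - G.card := by
    rw [← Nat.cast_sum, ← Finset.card_eq_sum_card_fiberwise, Finset.card_sdiff_of_subset hGA,
      Nat.cast_sub (Finset.card_le_card hGA)]
    intro q hq
    exact Finset.mem_union_left _ (Finset.mem_image_of_mem _ (Finset.mem_sdiff.mp hq).1)
  have h4 : ∑ x ∈ A.image φ ∪ Y, |((G.filter fun q => φ q = x).card : ℝ) / A.card - ν x| =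
      ∑ y ∈ Y, |((G.filter fun q => φ q = y).card : ℝ) / A.card - 1 / Y.card| := by
    rw [← Finset.sum_subset (Finset.subset_union_right (s₁ := A.image φ) (s₂ := Y))]
    · exact Finset.sum_congr rfl fun x hx => by rw [hν x hx]
    · intro x _ hx
      rw [hν' x hx, Finset.filter_eq_empty_iff.mpr]
      · simp
      · rintro q hq rfl; exact hx (hG q hq)
  rw [h3, h4] at h2
  linarith

lemma tv_exp {α X : Type*} [DecidableEq X] (A G : Finset α) (φ : α → X) (Y : Finset X) (hGA : G ⊆ A)
    (hG : ∀ q ∈ G, φ q ∈ Y) (K : ℕ) (hK : ∀ y ∈ Y, (G.filter fun q => φ q = y).card ≤ K)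
    (hA : 0 < A.card) (hY : 0 < Y.card) (h : X → ℝ) (M : ℝ) (h0 : ∀ y ∈ Y, 0 ≤ h y) (hM : ∀ y ∈ Y, h y ≤ M)
    (hM0 : 0 ≤ M) :
    (∑ y ∈ Y, h y) / Y.card ≤ (∑ q ∈ G, h (φ q)) / A.card +
      M * (((A.card : ℝ) - G.card) / A.card + 2 * |(K : ℝ) * Y.card / A.card - 1|) := by
  have core := tv_core A G φ Y hGA hG K hK hA hY
  have e : ∑ q ∈ G, h (φ q) = ∑ y ∈ Y, h y * (G.filter fun q => φ q = y).card := by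
    rw [← Finset.sum_fiberwise_of_maps_to hG]
    apply Finset.sum_congr rfl
    intro y _
    rw [Finset.sum_congr rfl (g := fun _ => h y) (fun q hq => by rw [(Finset.mem_filter.mp hq).2]),
      Finset.sum_const, nsmul_eq_mul, mul_comm]
  rw [e]
  have h1 : (∑ y ∈ Y, h y) / Y.card - (∑ y ∈ Y, h y * (G.filter fun q => φ q = y).card) / A.card ≤
      ∑ y ∈ Y, M * |((G.filter fun q => φ q = y).card : ℝ) / A.card - 1 / Y.card| := by
    rw [Finset.sum_div, Finset.sum_div, ← Finset.sum_sub_distrib]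
    apply Finset.sum_le_sum
    intro y hy
    have : h y / Y.card - h y * (G.filter fun q => φ q = y).card / A.card =
      h y * (1 / Y.card - ((G.filter fun q => φ q = y).card : ℝ) / A.card) := by ring
    rw [this]
    refine le_trans (mul_le_mul_of_nonneg_left (le_abs_self _) (h0 y hy)) ?_
    rw [abs_sub_comm]
    exact mul_le_mul_of_nonneg_right (hM y hy) (abs_nonneg _)
  rw [← Finset.mul_sum] at h1
  have := mul_le_mul_of_nonneg_left core hM0
  linarith

noncomputable def AA (n g : ℕ) : Finset (List (Equiv.Perm (Fin n)) × Param n) :=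
  FF n (n - 1 + 2 * (g-1)) (finRotate n) ×ˢ PP n g

open scoped Classical in
noncomputable def GG (n g : ℕ) : Finset (List (Equiv.Perm (Fin n)) × Param n) :=
  (AA n g).filter fun q => Good q.1 q.2

noncomputable def YY (n g : ℕ) : Finset (Option (List (Equiv.Perm (Fin n)))) :=
  (FF n (n - 1 + 2 * g) (finRotate n)).map Function.Embedding.some

noncomputable def phi {n : ℕ} (q : List (Equiv.Perm (Fin n)) × Param n) : Option (List (Equiv.Perm (Fin n))) :=
  lamDet n q.1 q.2

lemma mem_AA {n g : ℕ} {q : List (Equiv.Perm (Fin n)) × Param n} :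
    q ∈ AA n g ↔ q.1 ∈ Fcal n (g-1) ∧ paramOK n g q.2 := by
  rw [AA, Finset.mem_product, mem_PP, Fcal_eq]; rfl

lemma card_AA (n g : ℕ) : ((AA n g).card : ℝ) = fc n (g-1) * (PP n g).card := by
  rw [AA, Finset.card_product]; push_cast; rfl

lemma card_YY (n g : ℕ) : ((YY n g).card : ℝ) = fc n g := by
  rw [YY, Finset.card_map]; rfl

lemma mem_GG {n g : ℕ} {q : List (Equiv.Perm (Fin n)) × Param n} :
    q ∈ GG n g ↔ (q.1 ∈ Fcal n (g-1) ∧ paramOK n g q.2) ∧ Good q.1 q.2 := by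
  classical
  rw [GG, Finset.mem_filter, mem_AA]

lemma some_mem_YY {n g : ℕ} {x : List (Equiv.Perm (Fin n))} : some x ∈ YY n g ↔ x ∈ Fcal n g := by
  rw [Fcal_eq, YY]; simp

lemma none_mem_YY {n g : ℕ} : none ∉ YY n g := by
  rw [YY]; simp

lemma GG_sub (n g : ℕ) : GG n g ⊆ AA n g := fun _ h => mem_AA.mpr (mem_GG.mp h).1

lemma GG_maps {n g : ℕ} (hg : 1 ≤ g) : ∀ q ∈ GG n g, phi q ∈ YY n g := by
  intro q hq
  rw [mem_GG] at hq
  obtain ⟨x, ty, h1, h2, _⟩ := good_main hg hq.1.1 hq.1.2 hq.2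
  rw [phi, h1, some_mem_YY]; exact h2

lemma GG_fib {n g : ℕ} (hg : 1 ≤ g) : ∀ y ∈ YY n g, ((GG n g).filter fun q => phi q = y).card ≤ 2 * g := by
  intro y hy
  cases y with
  | none => exact absurd hy none_mem_YY
  | some x =>
    refine good_fibre hg x (some_mem_YY.mp hy) _ ?_
    intro q hq
    rw [Finset.mem_filter, mem_GG] at hq
    exact ⟨hq.1.1.1, hq.1.1.2, hq.1.2, hq.2⟩

noncomputable def be (n g : ℕ) : ℝ := (((AA n g).card : ℝ) - (GG n g).card) / (AA n g).card
noncomputable def rh (n g : ℕ) : ℝ := ((2 * g : ℕ) : ℝ) * (YY n g).card / (AA n g).card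

lemma dTV_le {n g : ℕ} (hg : 1 ≤ g) (hA : 0 < (AA n g).card) (hY : 0 < (YY n g).card) :
    dTV (lamStepDist n g) (unifF n g) ≤ be n g + |rh n g - 1| := by
  refine tv_gen (AA n g) (GG n g) phi (YY n g) (GG_sub n g) (GG_maps hg) (2 * g) (GG_fib hg) hA hY _ _ ?_ ?_ ?_
  · intro x
    unfold lamStepDist
    have e1 : {q : List (Equiv.Perm (Fin n)) × Param n |
        q.1 ∈ Fcal n (g - 1) ∧ paramOK n g q.2 ∧ lamDet n q.1 q.2 = x} =
        ↑((AA n g).filter fun q => phi q = x) := by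
      ext q
      rw [Finset.mem_coe, Finset.mem_filter, mem_AA, and_assoc]; rfl
    rw [e1, Set.ncard_coe_finset, Fcal_eq, Set.ncard_coe_finset, PP_coe, Set.ncard_coe_finset, card_AA]
    rfl
  · intro x hx
    cases x with
    | none => exact absurd hx none_mem_YY
    | some x =>
      rw [some_mem_YY] at hx
      simp only [unifF]
      rw [Set.indicator_of_mem hx, Fcal_eq, Set.ncard_coe_finset, card_YY]; rfl
  · intro x hx
    cases x with
    | none => rfl
    | some x =>
      rw [some_mem_YY] at hx
      simp only [unifF]
      rw [Set.indicator_of_notMem hx]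

lemma sum_YY {n g : ℕ} (f : Option (List (Equiv.Perm (Fin n))) → ℝ) :
    ∑ y ∈ YY n g, f y = ∑ l ∈ FF n (n - 1 + 2 * g) (finRotate n), f (some l) := by
  rw [YY, Finset.sum_map]; rfl

lemma PP_sum_le {n g : ℕ} (f : Param n → ℝ) (hf : ∀ p, 0 ≤ f p) :
    ∑ p ∈ PP n g, f p ≤ ∑ v ∈ Finset.range (n-1+2*g), ∑ w ∈ Finset.range (n-1+2*g), ∑ a, ∑ b, ∑ c, f ((v,w),(a,b,c)) := by
  have h1 : PP n g ⊆ (Finset.range (n-1+2*g) ×ˢ Finset.range (n-1+2*g)) ×ˢ (Finset.univ ×ˢ (Finset.univ ×ˢ Finset.univ)) := by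
    intro p hp
    rw [mem_PP] at hp
    obtain ⟨h1, h2, _⟩ := hp
    simp only [Finset.mem_product, Finset.mem_range, Finset.mem_univ, and_true]
    omega
  refine le_trans (Finset.sum_le_sum_of_subset_of_nonneg h1 fun p _ _ => hf p) ?_
  rw [Finset.sum_product, Finset.sum_product]
  apply le_of_eq
  apply Finset.sum_congr rfl; intro v _
  apply Finset.sum_congr rfl; intro w _
  rw [Finset.sum_product]
  apply Finset.sum_congr rfl; intro a _
  rw [Finset.sum_product]

lemma sum_HH_Pt {n : ℕ} (F : List (Equiv.Perm (Fin n))) (hF : F.headD 1 = 1 ∨ (F.headD 1).IsSwap) (k : ℕ) :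
    ∑ y, HH (F.headD 1) (Pt F y k) = disp (F.headD 1) / 2 := by
  rw [← sum_HH hF]
  exact Equiv.sum_comp ((prodLR (List.take k F))⁻¹ : Equiv.Perm (Fin n)) (fun s => HH (F.headD 1) s)

lemma sum_H6 {n g : ℕ} (F : List (Equiv.Perm (Fin n))) (hF : F.headD 1 = 1 ∨ (F.headD 1).IsSwap) :
    ∑ p ∈ PP n g, H6 F p ≤ 3 * ((n-1+2*g : ℕ):ℝ)^2 * n^2 * disp (F.headD 1) := by
  refine le_trans (PP_sum_le _ ?_) ?_
  · intro p
    unfold H6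
    have a1 := HH_nonneg (F.headD 1) (Pt F p.2.1 p.1.1)
    have a2 := HH_nonneg (F.headD 1) (Pt F p.2.2.1 p.1.1)
    have a3 := HH_nonneg (F.headD 1) (Pt F p.2.2.2 p.1.1)
    have a4 := HH_nonneg (F.headD 1) (Pt F p.2.1 (p.1.2-1))
    have a5 := HH_nonneg (F.headD 1) (Pt F p.2.2.1 (p.1.2-1))
    have a6 := HH_nonneg (F.headD 1) (Pt F p.2.2.2 (p.1.2-1))
    linarith
  · unfold H6
    simp only [Finset.sum_add_distrib, Finset.sum_const, sum_HH_Pt F hF, ← Finset.smul_sum]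
    simp only [Finset.card_univ, Fintype.card_fin, Finset.card_range, nsmul_eq_mul]
    apply le_of_eq
    ring

noncomputable def e0 (n v : ℕ) : ℝ := if v = 0 then 2 * (n:ℝ) else 0
noncomputable def I0 {n : ℕ} (p : Param n) : ℝ := e0 n p.1.1

lemma sum_I0 {n g : ℕ} (hg : 1 ≤ g) : ∑ p ∈ PP n g, I0 p ≤ 2 * ((n-1+2*g : ℕ):ℝ) * n^4 := by
  refine le_trans (PP_sum_le _ ?_) ?_
  · intro p; unfold I0 e0; split_ifs <;> positivity
  · unfold I0
    simp only [Finset.sum_const]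
    rw [← Finset.smul_sum, ← Finset.smul_sum, ← Finset.smul_sum, ← Finset.smul_sum]
    unfold e0
    rw [Finset.sum_ite_eq']
    rw [if_pos (by simp; omega)]
    simp only [Finset.card_univ, Fintype.card_fin, Finset.card_range, nsmul_eq_mul]
    apply le_of_eq
    ring

noncomputable def hd {n : ℕ} (y : Option (List (Equiv.Perm (Fin n)))) : ℝ := disp ((y.getD []).headD 1)

lemma sum_GG {n g : ℕ} (hg : 1 ≤ g) :
    ∑ q ∈ GG n g, hd (phi q) ≤ Dsum n (n-1+2*(g-1)) (finRotate n) * (PP n g).card +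
      fc n (g-1) * (2 * ((n-1+2*g : ℕ):ℝ) * n^4) +
      6 * ((n-1+2*g : ℕ):ℝ)^2 * n^3 * Dsum n (n-1+2*(g-1)) (finRotate n) := by
  have h1 : ∀ q ∈ GG n g, hd (phi q) ≤ disp (q.1.headD 1) + I0 q.2 + 2 * n * H6 q.1 q.2 := by
    intro q hq
    rw [mem_GG] at hq
    obtain ⟨x, ty, e1, e2, ⟨σ, e3, e4⟩, _⟩ := good_main hg hq.1.1 hq.1.2 hq.2
    rw [phi, e1]
    exact transport hg hq.1.1 hq.1.2 e2 e3 e4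
  have hH : ∀ (F : List (Equiv.Perm (Fin n))) (p : Param n), 0 ≤ H6 F p := by
    intro F p
    unfold H6
    have a1 := HH_nonneg (F.headD 1) (Pt F p.2.1 p.1.1)
    have a2 := HH_nonneg (F.headD 1) (Pt F p.2.2.1 p.1.1)
    have a3 := HH_nonneg (F.headD 1) (Pt F p.2.2.2 p.1.1)
    have a4 := HH_nonneg (F.headD 1) (Pt F p.2.1 (p.1.2-1))
    have a5 := HH_nonneg (F.headD 1) (Pt F p.2.2.1 (p.1.2-1))
    have a6 := HH_nonneg (F.headD 1) (Pt F p.2.2.2 (p.1.2-1))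
    linarith
  have hI : ∀ p : Param n, 0 ≤ I0 p := by intro p; unfold I0 e0; split_ifs <;> positivity
  refine le_trans (Finset.sum_le_sum h1) ?_
  refine le_trans (Finset.sum_le_sum_of_subset_of_nonneg (GG_sub n g) fun q _ _ => ?_) ?_
  · have := disp_nonneg (q.1.headD 1)
    have := hH q.1 q.2
    have := hI q.2
    positivity
  rw [AA, Finset.sum_product]
  have h2 : ∀ F ∈ FF n (n - 1 + 2 * (g-1)) (finRotate n),
      ∑ p ∈ PP n g, (disp (F.headD 1) + I0 p + 2 * n * H6 F p) ≤
      disp (F.headD 1) * (PP n g).card + (2 * ((n-1+2*g : ℕ):ℝ) * n^4) +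
      6 * ((n-1+2*g : ℕ):ℝ)^2 * n^3 * disp (F.headD 1) := by
    intro F hF
    rw [Finset.sum_add_distrib, Finset.sum_add_distrib, Finset.sum_const, ← Finset.mul_sum, nsmul_eq_mul]
    have hs : F.headD 1 = 1 ∨ (F.headD 1).IsSwap := by
      cases F with
      | nil => left; rfl
      | cons t l => right; exact (mem_FF.mp hF).2.1 t (by simp)
    have b1 := sum_H6 (g := g) F hs
    have b2 := sum_I0 (n := n) hg
    have b3 := mul_le_mul_of_nonneg_left b1 (show (0:ℝ) ≤ 2 * n by positivity)
    nlinarith [b3, b2]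
  refine le_trans (Finset.sum_le_sum h2) ?_
  rw [Finset.sum_add_distrib, Finset.sum_add_distrib, Finset.sum_const, ← Finset.mul_sum, ← Finset.sum_mul, nsmul_eq_mul]
  rfl

lemma be_num {n g : ℕ} : ((AA n g).card : ℝ) - (GG n g).card =
    (open scoped Classical in ∑ F ∈ FF n (n - 1 + 2 * (g - 1)) (finRotate n), ∑ p ∈ PP n g, (if Good F p then (0:ℝ) else 1)) := by
  classical
  rw [← Finset.sum_product' (f := fun F p => if Good F p then (0:ℝ) else 1)]
  rw [sub_eq_iff_eq_add, ← AA]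
  rw [Finset.card_eq_sum_ones, GG, Finset.card_filter]
  push_cast
  rw [← Finset.sum_add_distrib]
  apply Finset.sum_congr rfl
  intro q _
  split_ifs <;> norm_num

end ind


section lim
open Filter Topology

def Qh (h : ℕ) : Prop := Tendsto (fun n : ℕ => Dsum n (n-1+2*h) (finRotate n) / (fc n h * n)) atTop (𝓝 0)

lemma PP_lower (g : ℕ) : ∀ᶠ n : ℕ in atTop, ((n-1+2*g : ℕ):ℝ)^2 * (n:ℝ)^3 / 100 ≤ (PP n g).card := by
  have h1 := choose_div_tendsto 3
  have hm : Tendsto (fun n : ℕ => n - 1 + 2 * g) atTop atTop := by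
    apply tendsto_atTop_mono (f := fun n : ℕ => n - 1) (fun n => by omega)
    exact tendsto_sub_atTop_nat 1
  have h2 := (choose_div_tendsto 2).comp hm
  have h3 := h2.mul h1
  have hlt : (1:ℝ)/100 < 1 / (Nat.factorial 2 : ℝ) * (1 / (Nat.factorial 3 : ℝ)) := by
    norm_num [Nat.factorial]
  filter_upwards [h3.eventually_const_lt hlt, eventually_ge_atTop 2] with n hn hn2
  rw [card_PP]
  push_cast
  simp only [Function.comp_apply] at hn
  have p1 : (0:ℝ) < ((n-1+2*g : ℕ):ℝ)^2 := by
    have : 0 < n-1+2*g := by omega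
    positivity
  have p2 : (0:ℝ) < (n:ℝ)^3 := by positivity
  rw [div_mul_div_comm, lt_div_iff₀ (by positivity)] at hn
  push_cast at hn ⊢
  linarith

lemma be_nonneg (n g : ℕ) : 0 ≤ be n g := by
  unfold be
  apply div_nonneg _ (by positivity)
  rw [sub_nonneg]; exact_mod_cast Finset.card_le_card (GG_sub n g)

lemma m_le {n : ℕ} (g : ℕ) (hn : 1 ≤ n) : ((n-1+2*g : ℕ):ℝ) ≤ (1 + 2 * g) * n := by
  have : n - 1 + 2 * g ≤ (1 + 2 * g) * n := by nlinarith [Nat.sub_le n 1]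
  exact_mod_cast this

lemma be_le {n g : ℕ} (hg : 1 ≤ g) {ε : ℝ} (hε : 0 < ε) (hn : 1 ≤ n) (hf : 0 < fc n (g-1))
    (hP : ((n-1+2*g : ℕ):ℝ)^2 * (n:ℝ)^3 / 100 ≤ (PP n g).card) :
    be n g ≤ 100 * (2 * g / n + 4 * ε +
      8 * (1 + 2 * g) / ε * (Dsum n (n-1+2*(g-1)) (finRotate n) / (fc n (g-1) * n))) := by
  have hn' : (0:ℝ) < n := by exact_mod_cast hn
  have hb := bad_bound (n := n) hg (r := ε * n) (by positivity)
  unfold be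
  rw [be_num]
  have hm : (0:ℝ) < ((n-1+2*g : ℕ):ℝ) := by
    have : 0 < n-1+2*g := by omega
    exact_mod_cast this
  have hml := m_le g hn
  have hA : fc n (g-1) * (((n-1+2*g : ℕ):ℝ)^2 * (n:ℝ)^3 / 100) ≤ (AA n g).card := by
    rw [card_AA]; exact mul_le_mul_of_nonneg_left hP hf.le
  set m : ℝ := ((n-1+2*g : ℕ):ℝ)
  set D := Dsum n (n-1+2*(g-1)) (finRotate n) with hD
  have hD0 : 0 ≤ D := Dsum_nonneg _
  set f := fc n (g-1)
  have hA0 : 0 < f * (m^2 * (n:ℝ)^3 / 100) := by positivity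
  refine le_trans (div_le_div_of_nonneg_right hb (by positivity)) ?_
  refine le_trans (div_le_div_of_nonneg_left (by positivity) hA0 hA) ?_
  have e : m ^ 2 * (f * (2 * ↑g * ↑n ^ 2 + 4 * (ε * ↑n) * ↑n ^ 2) + 8 * (ε * ↑n)⁻¹ * ↑n ^ 2 * (m * D)) /
      (f * (m ^ 2 * ↑n ^ 3 / 100)) = 100 * (2 * g / n + 4 * ε + 8 * (m / n) / ε * (D / (f * n))) := by
    field_simp
  rw [e]
  have h1 : m / n ≤ 1 + 2 * g := by rw [div_le_iff₀ hn']; exact hml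
  gcongr

lemma be_tendsto {g : ℕ} (hg : 1 ≤ g) (hQ : Qh (g-1)) : Tendsto (fun n => be n g) atTop (𝓝 0) := by
  rw [tendsto_order]
  constructor
  · intro a ha
    exact Eventually.of_forall fun n => lt_of_lt_of_le ha (be_nonneg n g)
  · intro a ha
    set ε : ℝ := a / 800 with hε
    have hε0 : 0 < ε := by positivity
    have l1 : Tendsto (fun n : ℕ => 100 * (2 * (g:ℝ) / n + 4 * ε +
      8 * (1 + 2 * g) / ε * (Dsum n (n-1+2*(g-1)) (finRotate n) / (fc n (g-1) * n)))) atTop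
        (𝓝 (100 * (0 + 4 * ε + 8 * (1 + 2 * g) / ε * 0))) := by
      apply Tendsto.const_mul
      apply Tendsto.add
      · exact (tendsto_const_div_atTop_nhds_zero_nat _).add_const _
      · exact Tendsto.const_mul _ hQ
    have : 100 * (0 + 4 * ε + 8 * (1 + 2 * g) / ε * 0) < a := by rw [hε]; linarith
    filter_upwards [l1.eventually_lt_const this, eventually_ge_atTop 1, fc_pos_ev (g-1), PP_lower g] with n a1 a2 a3 a4
    exact lt_of_le_of_lt (be_le hg hε0 a2 a3 a4) a1

lemma rh_tendsto {g : ℕ} (hg : 1 ≤ g) : Tendsto (fun n => |rh n g - 1|) atTop (𝓝 0) := by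
  have h := fc_ratio g hg
  have e : (fun n => |rh n g - 1|) = fun n : ℕ => |(2*g*fc n g)/(fc n (g-1)*(((n-1+2*g).choose 2:ℝ)*(n.choose 3:ℝ))) - 1| := by
    funext n
    rw [rh, card_YY, card_AA, card_PP]; push_cast; rfl
  rw [e]
  have := (h.sub_const 1).abs
  simpa using this

lemma cards_pos {g : ℕ} : ∀ᶠ n in atTop, 0 < (AA n g).card ∧ 0 < (YY n g).card := by
  filter_upwards [fc_pos_ev (g-1), fc_pos_ev g, PP_lower g, eventually_ge_atTop 2] with n a1 a2 a3 a4
  constructor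
  · have : (0:ℝ) < (AA n g).card := by
      rw [card_AA]
      apply mul_pos a1
      refine lt_of_lt_of_le ?_ a3
      have : 0 < n-1+2*g := by omega
      positivity
    exact_mod_cast this
  · have : (0:ℝ) < (YY n g).card := by rw [card_YY]; exact a2
    exact_mod_cast this

lemma dTV_tendsto {g : ℕ} (hg : 1 ≤ g) (hQ : Qh (g-1)) :
    Tendsto (fun n => dTV (lamStepDist n g) (unifF n g)) atTop (𝓝 0) := by
  have h := (be_tendsto hg hQ).add (rh_tendsto hg)
  rw [add_zero] at h
  refine tendsto_of_tendsto_of_tendsto_of_le_of_le' tendsto_const_nhds h ?_ ?_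
  · refine Eventually.of_forall fun n => ?_
    unfold dTV
    exact mul_nonneg (by norm_num) (tsum_nonneg fun _ => abs_nonneg _)
  · filter_upwards [cards_pos (g := g)] with n hn
    exact dTV_le hg hn.1 hn.2

lemma Qh_step {g : ℕ} (hg : 1 ≤ g) (hQ : Qh (g-1)) : Qh g := by
  have h1 : Tendsto (fun n : ℕ => 601 * (Dsum n (n-1+2*(g-1)) (finRotate n) / (fc n (g-1) * n)) + 200 / n +
      2 * (be n g + 2 * |rh n g - 1|)) atTop (𝓝 (601 * 0 + 0 + 2 * (0 + 2 * 0))) :=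
    ((Tendsto.const_mul _ hQ).add (tendsto_const_div_atTop_nhds_zero_nat _)).add
      (Tendsto.const_mul _ ((be_tendsto hg hQ).add (Tendsto.const_mul _ (rh_tendsto hg))))
  have e0 : (601:ℝ) * 0 + 0 + 2 * (0 + 2 * 0) = 0 := by norm_num
  rw [e0] at h1
  refine tendsto_of_tendsto_of_tendsto_of_le_of_le' tendsto_const_nhds h1 ?_ ?_
  · refine Eventually.of_forall fun n => ?_
    refine div_nonneg (Dsum_nonneg _) ?_
    unfold fc; positivity
  filter_upwards [cards_pos (g := g), fc_pos_ev (g-1), PP_lower g, eventually_ge_atTop 1] with n hn hf hP hn1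
  have hn' : (0:ℝ) < n := by exact_mod_cast hn1
  have hm : (n:ℝ) ≤ ((n-1+2*g : ℕ):ℝ) := by
    have : n ≤ n-1+2*g := by omega
    exact_mod_cast this
  have key := tv_exp (AA n g) (GG n g) phi (YY n g) (GG_sub n g) (GG_maps hg) (2 * g) (GG_fib hg) hn.1 hn.2 hd (2 * n)
    (fun y _ => disp_nonneg _) (by
      intro y hy
      cases y with
      | none => exact absurd hy none_mem_YY
      | some x => rw [some_mem_YY, Fcal_eq] at hy; exact disp_headD_le hy) (by positivity)
  rw [sum_YY, ← be, ← rh, card_YY] at key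
  have key' : Dsum n (n-1+2*g) (finRotate n) / fc n g ≤ (∑ q ∈ GG n g, hd (phi q)) / (AA n g).card +
      2 * n * (be n g + 2 * |rh n g - 1|) := key
  have hs := sum_GG (n := n) hg
  have hD0 : 0 ≤ Dsum n (n-1+2*(g-1)) (finRotate n) := Dsum_nonneg _
  have hA := card_AA n g
  set m : ℝ := ((n-1+2*g : ℕ):ℝ)
  set D := Dsum n (n-1+2*(g-1)) (finRotate n) with hD
  set f := fc n (g-1)
  set P : ℝ := ((PP n g).card : ℝ)
  have hm0 : 0 < m := lt_of_lt_of_le hn' hm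
  have hP0 : 0 < P := lt_of_lt_of_le (by positivity) hP
  have hdiv : (∑ q ∈ GG n g, hd (phi q)) / (AA n g).card ≤ 601 * (D / f) + 200 := by
    rw [hA, div_le_iff₀ (by positivity)]
    refine le_trans hs ?_
    have e : (601 * (D / f) + 200) * (f * P) = D * P + 600 * D * P + 200 * f * P := by field_simp; ring
    rw [e]
    have b1 : 6 * m^2 * n^3 * D ≤ 600 * D * P := by
      have := mul_le_mul_of_nonneg_left hP (show 0 ≤ 600 * D by positivity)
      linarith
    have b2 : f * (2 * m * n^4) ≤ 200 * f * P := by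
      have := mul_le_mul_of_nonneg_left hP (show 0 ≤ 200 * f by positivity)
      have b3 : f * (2 * m * n^4) ≤ f * (2 * m^2 * n^3) := by
        apply mul_le_mul_of_nonneg_left _ hf.le
        have : m * n^3 * n ≤ m * n^3 * m := mul_le_mul_of_nonneg_left hm (by positivity)
        nlinarith
      linarith
    linarith
  rw [← div_div, ← div_div, div_le_iff₀ hn']
  have e : (601 * (D / f / n) + 200 / n + 2 * (be n g + 2 * |rh n g - 1|)) * n =
    601 * (D / f) + 200 + 2 * n * (be n g + 2 * |rh n g - 1|) := by field_simp
  rw [e]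
  linarith

lemma Qh_all (h0 : Qh 0) (h : ℕ) : Qh h := by
  induction h with
  | zero => exact h0
  | succ h ih => exact Qh_step (by omega) ih

end lim


section base

/-- shuffles -/
def Sh {α : Type*} [DecidableEq α] : List α → List α → Finset (List α)
  | [], B => {B}
  | a :: A, [] => {a :: A}
  | a :: A, b :: B => (Sh A (b :: B)).image (List.cons a) ∪ (Sh (a :: A) B).image (List.cons b)
termination_by A B => A.length + B.length

lemma Sh_nil_right {α : Type*} [DecidableEq α] (A : List α) : Sh A [] = {A} := by
  cases A <;> simp [Sh]

lemma Sh_card {α : Type*} [DecidableEq α] (A B : List α) : (Sh A B).card ≤ (A.length + B.length).choose A.length := by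
  induction A generalizing B with
  | nil => simp [Sh]
  | cons a A ihA =>
    induction B with
    | nil => simp [Sh]
    | cons b B ihB =>
      rw [Sh]
      refine le_trans (Finset.card_union_le _ _) ?_
      refine le_trans (add_le_add Finset.card_image_le Finset.card_image_le) ?_
      refine le_trans (add_le_add (ihA _) ihB) ?_
      simp only [List.length_cons]
      have e : A.length + 1 + (B.length + 1) = (A.length + (B.length + 1)) + 1 := by ring
      have e2 : A.length + 1 + B.length = A.length + (B.length + 1) := by ring
      rw [e, Nat.choose_succ_succ, e2]

lemma Sh_left {α : Type*} [DecidableEq α] {A B l : List α} (a : α) (h : l ∈ Sh A B) : a :: l ∈ Sh (a :: A) B := by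
  cases B with
  | nil => rw [Sh_nil_right] at *; simpa using h
  | cons b B =>
    rw [Sh]
    exact Finset.mem_union_left _ (Finset.mem_image_of_mem _ h)

lemma Sh_right {α : Type*} [DecidableEq α] {A B l : List α} (b : α) (h : l ∈ Sh A B) : b :: l ∈ Sh A (b :: B) := by
  cases A with
  | nil => rw [Sh] at *; simpa using h
  | cons a A =>
    rw [Sh]
    exact Finset.mem_union_right _ (Finset.mem_image_of_mem _ h)

def Phi {n d e : ℕ} (E : Fin d ⊕ Fin e ≃ Fin n) (s : Equiv.Perm (Fin d)) (r : Equiv.Perm (Fin e)) :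
    Equiv.Perm (Fin n) := E.permCongr (Equiv.sumCongr s r)

lemma Phi_inl {n d e : ℕ} (E : Fin d ⊕ Fin e ≃ Fin n) (s : Equiv.Perm (Fin d)) (r : Equiv.Perm (Fin e)) (i : Fin d) :
    Phi E s r (E (Sum.inl i)) = E (Sum.inl (s i)) := by simp [Phi]

lemma Phi_inr {n d e : ℕ} (E : Fin d ⊕ Fin e ≃ Fin n) (s : Equiv.Perm (Fin d)) (r : Equiv.Perm (Fin e)) (i : Fin e) :
    Phi E s r (E (Sum.inr i)) = E (Sum.inr (r i)) := by simp [Phi]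

lemma Phi_ext {n d e : ℕ} (E : Fin d ⊕ Fin e ≃ Fin n) {s : Equiv.Perm (Fin d)} {r : Equiv.Perm (Fin e)}
    {π : Equiv.Perm (Fin n)} (h1 : ∀ i, π (E (Sum.inl i)) = E (Sum.inl (s i)))
    (h2 : ∀ i, π (E (Sum.inr i)) = E (Sum.inr (r i))) : π = Phi E s r := by
  ext x
  obtain ⟨y, rfl⟩ := E.surjective x
  rcases y with i | i
  · rw [h1, Phi_inl]
  · rw [h2, Phi_inr]

lemma Phi_mul {n d e : ℕ} (E : Fin d ⊕ Fin e ≃ Fin n) (s s' : Equiv.Perm (Fin d)) (r r' : Equiv.Perm (Fin e)) :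
    Phi E s r * Phi E s' r' = Phi E (s * s') (r * r') := by
  apply Phi_ext
  · intro i; rw [Equiv.Perm.mul_apply, Phi_inl, Phi_inl]; rfl
  · intro i; rw [Equiv.Perm.mul_apply, Phi_inr, Phi_inr]; rfl

lemma Phi_inj {n d e : ℕ} (E : Fin d ⊕ Fin e ≃ Fin n) {s s' : Equiv.Perm (Fin d)} {r r' : Equiv.Perm (Fin e)}
    (h : Phi E s r = Phi E s' r') : s = s' ∧ r = r' := by
  constructor
  · ext i
    have := Equiv.congr_fun h (E (Sum.inl i))
    rw [Phi_inl, Phi_inl] at this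
    rw [Sum.inl.inj (E.injective this)]
  · ext i
    have := Equiv.congr_fun h (E (Sum.inr i))
    rw [Phi_inr, Phi_inr] at this
    rw [Sum.inr.inj (E.injective this)]

lemma split_list {n d e : ℕ} (E : Fin d ⊕ Fin e ≃ Fin n) (l : List (Equiv.Perm (Fin n)))
    (h : ∀ t ∈ l, (∃ s : Equiv.Perm (Fin d), s.IsSwap ∧ t = Phi E s 1) ∨ (∃ r : Equiv.Perm (Fin e), r.IsSwap ∧ t = Phi E 1 r)) :
    ∃ (A : List (Equiv.Perm (Fin d))) (B : List (Equiv.Perm (Fin e))),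
      (∀ s ∈ A, s.IsSwap) ∧ (∀ r ∈ B, r.IsSwap) ∧ l ∈ Sh (A.map fun s => Phi E s 1) (B.map fun r => Phi E 1 r) ∧
      l.length = A.length + B.length ∧ prodLR l = Phi E (prodLR A) (prodLR B) := by
  induction l with
  | nil =>
    refine ⟨[], [], by simp, by simp, by simp [Sh], rfl, ?_⟩
    simp only [prodLR_nil]
    apply Phi_ext <;> simp
  | cons t l ih =>
    obtain ⟨A, B, h1, h2, h3, h4, h5⟩ := ih fun t ht => h t (List.mem_cons_of_mem _ ht)
    rcases h t List.mem_cons_self with ⟨s, hs, rfl⟩ | ⟨r, hr, rfl⟩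
    · refine ⟨s :: A, B, ?_, h2, Sh_left _ h3, by simp [h4]; ring, ?_⟩
      · simp [hs]; exact h1
      · rw [prodLR_cons, prodLR_cons, h5, Phi_mul, mul_one]
    · refine ⟨A, r :: B, h1, ?_, Sh_right _ h3, by simp [h4]; ring, ?_⟩
      · simp [hr]; exact h2
      · rw [prodLR_cons, prodLR_cons, h5, Phi_mul, mul_one]

/-- graph of a list of transpositions -/
def Gr {n : ℕ} (l : List (Equiv.Perm (Fin n))) : SimpleGraph (Fin n) where
  Adj a b := a ≠ b ∧ Equiv.swap a b ∈ l
  symm := ⟨fun a b h => ⟨h.1.symm, by rw [Equiv.swap_comm]; exact h.2⟩⟩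
  loopless := ⟨fun a h => h.1 rfl⟩

lemma Gr_card {n : ℕ} (l : List (Equiv.Perm (Fin n))) : Nat.card (Gr l).edgeSet ≤ l.length := by
  refine le_trans ?_ (List.toFinset_card_le l)
  rw [← Set.ncard_coe_finset]
  refine Set.ncard_le_ncard_of_injOn (Sym2.lift ⟨fun a b => Equiv.swap a b, fun a b => Equiv.swap_comm a b⟩) ?_ ?_
  · intro e he
    induction e with
    | _ a b =>
      simp only [SimpleGraph.mem_edgeSet] at he
      simp only [Sym2.lift_mk, List.coe_toFinset]
      exact he.2
  · intro e he e' he' h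
    induction e with
    | _ a b =>
    induction e' with
    | _ a' b' =>
      simp only [SimpleGraph.mem_edgeSet] at he he'
      simp only [Sym2.lift_mk] at h
      rw [Sym2.eq_iff]
      exact swap_eq_swap he'.1 h

lemma Gr_reach {n : ℕ} (l l' : List (Equiv.Perm (Fin n))) (hs : ∀ t ∈ l', t.IsSwap) (hl : ∀ t ∈ l', t ∈ l) (x : Fin n) :
    (Gr l).Reachable x (prodLR l' x) := by
  induction l' generalizing x with
  | nil => simp [prodLR_nil]
  | cons t l' ih =>
    rw [prodLR_cons, Equiv.Perm.mul_apply]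
    refine SimpleGraph.Reachable.trans ?_ (ih (fun t ht => hs t (List.mem_cons_of_mem _ ht))
      (fun t ht => hl t (List.mem_cons_of_mem _ ht)) (t x))
    by_cases hx : t x = x
    · rw [hx]
    apply SimpleGraph.Adj.reachable
    refine ⟨fun h => hx h.symm, ?_⟩
    have e : Equiv.swap x (t x) = t := by
      obtain ⟨a, b, hab, rfl⟩ := hs t List.mem_cons_self
      by_cases h1 : x = a
      · subst h1; rw [Equiv.swap_apply_left]
      by_cases h2 : x = b
      · subst h2; rw [Equiv.swap_apply_right, Equiv.swap_comm]
      rw [Equiv.swap_apply_of_ne_of_ne h1 h2] at hx; exact absurd rfl hx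
    rw [e]; exact hl t List.mem_cons_self

lemma rot_reach {n k : ℕ} (G : SimpleGraph (Fin n)) (f : Fin k → Fin n)
    (h : ∀ i, G.Reachable (f i) (f (finRotate k i))) (i j : Fin k) : G.Reachable (f i) (f j) := by
  have key : ∀ m : ℕ, ∀ hm : m < k, G.Reachable (f ⟨0, by omega⟩) (f ⟨m, hm⟩) := by
    intro m
    induction m with
    | zero => intro hm; exact SimpleGraph.Reachable.refl _
    | succ m ih =>
      intro hm
      refine (ih (by omega)).trans ?_
      have h1 := h ⟨m, by omega⟩
      have : finRotate k ⟨m, by omega⟩ = ⟨m+1, hm⟩ := by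
        apply Fin.ext
        rw [finRotate_val]; simp only; rw [if_neg (by omega)]
      rwa [this] at h1
  exact (key i i.2).symm.trans (key j j.2)

lemma preserve {n d e : ℕ} (hn : 2 ≤ n) (E : Fin d ⊕ Fin e ≃ Fin n) (l : List (Equiv.Perm (Fin n)))
    (hs : ∀ t ∈ l, t.IsSwap) (hlen : l.length = n - 2)
    (hp : prodLR l = Phi E (finRotate d) (finRotate e)) :
    ∀ t ∈ l, (∃ s : Equiv.Perm (Fin d), s.IsSwap ∧ t = Phi E s 1) ∨ (∃ r : Equiv.Perm (Fin e), r.IsSwap ∧ t = Phi E 1 r) := by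
  have hnc : ¬ (Gr l).Connected := by
    intro hc
    have h1 := hc.card_vert_le_card_edgeSet_add_one
    have h2 := Gr_card l
    rw [Nat.card_fin] at h1
    omega
  have hr := Gr_reach l l hs (fun _ h => h)
  rw [hp] at hr
  have r1 := rot_reach (Gr l) (fun i : Fin d => E (Sum.inl i)) (fun i => by
    have := hr (E (Sum.inl i)); rwa [Phi_inl] at this)
  have r2 := rot_reach (Gr l) (fun i : Fin e => E (Sum.inr i)) (fun i => by
    have := hr (E (Sum.inr i)); rwa [Phi_inr] at this)
  have hno : ∀ i j, ¬ (Gr l).Reachable (E (Sum.inl i)) (E (Sum.inr j)) := by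
    intro i j hij
    apply hnc
    have : Nonempty (Fin n) := ⟨⟨0, by omega⟩⟩
    refine SimpleGraph.Connected.mk ?_
    have key : ∀ x, (Gr l).Reachable (E (Sum.inl i)) x := by
      intro x
      obtain ⟨y, rfl⟩ := E.surjective x
      rcases y with i' | j'
      · exact r1 i i'
      · exact hij.trans (r2 j j')
    exact fun x y => (key x).symm.trans (key y)
  intro t ht
  obtain ⟨a, b, hab, rfl⟩ := hs t ht
  have had : (Gr l).Adj a b := ⟨hab, ht⟩
  obtain ⟨y, rfl⟩ := E.surjective a
  obtain ⟨z, rfl⟩ := E.surjective b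
  have hyz : y ≠ z := fun h => hab (by rw [h])
  rcases y with i | i <;> rcases z with j | j
  · left
    refine ⟨Equiv.swap i j, ⟨i, j, fun h => hyz (by rw [h]), rfl⟩, ?_⟩
    apply Phi_ext
    · intro k
      rw [Equiv.swap_apply_def, Equiv.swap_apply_def]
      simp only [EmbeddingLike.apply_eq_iff_eq, Sum.inl.injEq]
      split_ifs <;> rfl
    · intro k
      rw [Equiv.swap_apply_of_ne_of_ne (by simp) (by simp)]; rfl
  · exact absurd had.reachable (hno _ _)
  · exact absurd had.symm.reachable (hno _ _)
  · right
    refine ⟨Equiv.swap i j, ⟨i, j, fun h => hyz (by rw [h]), rfl⟩, ?_⟩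
    apply Phi_ext
    · intro k
      rw [Equiv.swap_apply_of_ne_of_ne (by simp) (by simp)]; rfl
    · intro k
      rw [Equiv.swap_apply_def, Equiv.swap_apply_def]
      simp only [EmbeddingLike.apply_eq_iff_eq, Sum.inr.injEq]
      split_ifs <;> rfl

lemma two_cycle {n d e : ℕ} (hd : 1 ≤ d) (he : 1 ≤ e) (hde : d + e = n) (E : Fin d ⊕ Fin e ≃ Fin n) :
    (FF n (n-2) (Phi E (finRotate d) (finRotate e))).card ≤
      (n-2).choose (d-1) * ((FF d (d-1) (finRotate d)).card * (FF e (e-1) (finRotate e)).card) := by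
  have hsub : FF n (n-2) (Phi E (finRotate d) (finRotate e)) ⊆
      (FF d (d-1) (finRotate d) ×ˢ FF e (e-1) (finRotate e)).biUnion fun q =>
        Sh (q.1.map fun s => Phi E s 1) (q.2.map fun r => Phi E 1 r) := by
    intro l hl
    rw [mem_FF] at hl
    obtain ⟨h1, h2, h3⟩ := hl
    obtain ⟨A, B, hA, hB, hS, hlen, hprod⟩ := split_list E l (preserve (by omega) E l h2 h1 h3)
    rw [h3] at hprod
    obtain ⟨p1, p2⟩ := Phi_inj E hprod
    have l1 := length_ge hA p1.symm
    have l2 := length_ge hB p2.symm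
    rw [Finset.mem_biUnion]
    refine ⟨(A, B), ?_, hS⟩
    rw [Finset.mem_product, mem_FF, mem_FF]
    exact ⟨⟨by simp only; omega, hA, p1.symm⟩, ⟨by simp only; omega, hB, p2.symm⟩⟩
  refine le_trans (Finset.card_le_card hsub) ?_
  refine le_trans (Finset.card_biUnion_le_card_mul _ _ ((n-2).choose (d-1)) ?_) ?_
  · rintro ⟨A, B⟩ hq
    rw [Finset.mem_product, mem_FF, mem_FF] at hq
    obtain ⟨⟨a1, _⟩, ⟨b1, _⟩⟩ := hq
    refine le_trans (Sh_card _ _) ?_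
    simp only at a1 b1
    rw [List.length_map, List.length_map, a1, b1]
    apply le_of_eq; congr 1; omega
  · rw [Finset.card_product, mul_comm]

/-- the two cycles of `ζ * swap p q` -/
lemma two_cycle_eq {n : ℕ} {p q : Fin n} (hpq : p < q) :
    ∃ E : Fin (q - p : ℕ) ⊕ Fin (n - (q - p) : ℕ) ≃ Fin n,
      finRotate n * Equiv.swap p q = Phi E (finRotate _) (finRotate _) := by
  have hq := q.2
  have hpq' : (p:ℕ) < q := hpq
  let f : Fin (q - p : ℕ) ⊕ Fin (n - (q - p) : ℕ) → Fin n :=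
    Sum.elim (fun i => ⟨p + 1 + i, by omega⟩) (fun j => if (j:ℕ) ≤ p then ⟨j, by omega⟩ else ⟨j + (q - p), by omega⟩)
  have hf1 : ∀ i, ((f (Sum.inl i) : Fin n) : ℕ) = p + 1 + i := fun i => rfl
  have hf2 : ∀ j : Fin (n - (q - p) : ℕ), (j:ℕ) ≤ p → ((f (Sum.inr j) : Fin n) : ℕ) = j := by
    intro j hj; simp only [f, Sum.elim_inr]; rw [if_pos hj]
  have hf3 : ∀ j : Fin (n - (q - p) : ℕ), ¬ (j:ℕ) ≤ p → ((f (Sum.inr j) : Fin n) : ℕ) = j + (q - p) := by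
    intro j hj; simp only [f, Sum.elim_inr]; rw [if_neg hj]
  have hinj : Function.Injective f := by
    intro x y h
    have h := congrArg (fun z : Fin n => (z : ℕ)) h
    rcases x with i | i <;> rcases y with j | j
    · rw [hf1, hf1] at h; congr 1; apply Fin.ext; omega
    · exfalso
      by_cases hj : (j:ℕ) ≤ p
      · rw [hf1, hf2 j hj] at h; omega
      · rw [hf1, hf3 j hj] at h; omega
    · exfalso
      by_cases hi : (i:ℕ) ≤ p
      · rw [hf1, hf2 i hi] at h; omega
      · rw [hf1, hf3 i hi] at h; omega
    · congr 1; apply Fin.ext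
      by_cases hi : (i:ℕ) ≤ p <;> by_cases hj : (j:ℕ) ≤ p
      · rw [hf2 i hi, hf2 j hj] at h; omega
      · rw [hf2 i hi, hf3 j hj] at h; omega
      · rw [hf3 i hi, hf2 j hj] at h; omega
      · rw [hf3 i hi, hf3 j hj] at h; omega
  have hbij : Function.Bijective f := by
    rw [Fintype.bijective_iff_injective_and_card]
    refine ⟨hinj, ?_⟩
    simp; omega
  refine ⟨Equiv.ofBijective f hbij, ?_⟩
  apply Phi_ext
  · intro i
    rw [Equiv.ofBijective_apply, Equiv.ofBijective_apply, Equiv.Perm.mul_apply]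
    apply Fin.ext
    rw [finRotate_val, hf1, finRotate_val]
    by_cases hi : (i:ℕ) + 1 = q - p
    · have e : f (Sum.inl i) = q := by apply Fin.ext; rw [hf1]; omega
      rw [e, Equiv.swap_apply_right, if_neg (by omega), if_pos hi]
    · rw [Equiv.swap_apply_of_ne_of_ne, hf1, if_neg (by omega), if_neg hi]
      · rfl
      · intro h; have := congrArg (fun z : Fin n => (z : ℕ)) h; simp only [hf1] at this; omega
      · intro h; have := congrArg (fun z : Fin n => (z : ℕ)) h; simp only [hf1] at this; omega
  · intro j
    rw [Equiv.ofBijective_apply, Equiv.ofBijective_apply, Equiv.Perm.mul_apply]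
    apply Fin.ext
    rw [finRotate_val]
    have hr := finRotate_val j
    by_cases hj : (j:ℕ) = p
    · have e : f (Sum.inr j) = p := by apply Fin.ext; rw [hf2 j hj.le]; omega
      rw [e, Equiv.swap_apply_left]
      by_cases hq1 : (q:ℕ) + 1 = n
      · rw [if_pos hq1]
        rw [if_pos (by omega)] at hr
        rw [hf2 _ (by omega), hr]
      · rw [if_neg hq1]
        rw [if_neg (by omega)] at hr
        rw [hf3 _ (by omega), hr]; omega
    · have hne : ∀ z : Fin n, (z:ℕ) = p ∨ (z:ℕ) = q → f (Sum.inr j) ≠ z := by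
        intro z hz h
        have := congrArg (fun z : Fin n => (z : ℕ)) h
        by_cases hjp : (j:ℕ) ≤ p
        · rw [hf2 j hjp] at this; omega
        · rw [hf3 j hjp] at this; omega
      rw [Equiv.swap_apply_of_ne_of_ne (hne p (Or.inl rfl)) (hne q (Or.inr rfl))]
      by_cases hjp : (j:ℕ) ≤ p
      · rw [hf2 j hjp, if_neg (by omega)]
        rw [if_neg (by omega)] at hr
        rw [hf2 _ (by omega), hr]
      · rw [hf3 j hjp]
        by_cases hq1 : (j:ℕ) + (q - p) + 1 = n
        · rw [if_pos hq1]
          rw [if_pos (by omega)] at hr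
          rw [hf2 _ (by omega), hr]
        · rw [if_neg hq1]
          rw [if_neg (by omega)] at hr
          rw [hf3 _ (by omega), hr]; omega

lemma card_two {n : ℕ} {p q : Fin n} (hpq : p < q) :
    (FF n (n-2) (finRotate n * Equiv.swap p q)).card ≤
      (n-2).choose ((q:ℕ)-p-1) * ((FF (q-p) ((q:ℕ)-p-1) (finRotate _)).card * (FF (n-(q-p)) (n-((q:ℕ)-p)-1) (finRotate _)).card) := by
  obtain ⟨E, hE⟩ := two_cycle_eq hpq
  have hpq' : (p:ℕ) < q := hpq
  have hq := q.2
  rw [hE]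
  exact two_cycle (by omega) (by omega) (by omega) E

end base


section base2
open Filter Topology

lemma Dsum_succ {n m : ℕ} (π : Equiv.Perm (Fin n)) :
    Dsum n (m+1) π = ∑ t ∈ SW n, disp t * (FF n m (π * t)).card := by
  unfold Dsum FF
  rw [Finset.sum_filter, sum_Lst_succ, Finset.sum_comm]
  apply Finset.sum_congr rfl
  intro t ht
  rw [Finset.card_filter]
  push_cast
  rw [Finset.mul_sum]
  apply Finset.sum_congr rfl
  intro l _
  have htt : t * t = 1 := by
    obtain ⟨a, b, _, rfl⟩ := mem_SW.mp ht
    exact Equiv.swap_mul_self a b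
  have : prodLR (t :: l) = π ↔ prodLR l = π * t := by
    rw [prodLR_cons]
    constructor
    · rintro rfl; rw [mul_assoc, htt, mul_one]
    · intro h; rw [h, mul_assoc, htt, mul_one]
  simp only [this, List.headD_cons, mul_ite, mul_one, mul_zero]

lemma sum_SW_le {n : ℕ} (f : Equiv.Perm (Fin n) → ℝ) (φ : ℕ → ℝ) (hφ : ∀ d, 0 ≤ φ d)
    (h : ∀ p q : Fin n, p < q → f (Equiv.swap p q) ≤ φ (q - p)) :
    ∑ t ∈ SW n, f t ≤ ∑ d ∈ Finset.Ico 1 n, ((n - d : ℕ) : ℝ) * φ d := by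
  have e : SW n = (Finset.univ.filter fun x : Fin n × Fin n => x.1 < x.2).image fun x => Equiv.swap x.1 x.2 := by
    ext t
    rw [mem_SW, Finset.mem_image]
    constructor
    · rintro ⟨a, b, hab, rfl⟩
      rcases lt_or_gt_of_ne hab with h' | h'
      · exact ⟨(a, b), by simpa using h', rfl⟩
      · exact ⟨(b, a), by simpa using h', Equiv.swap_comm _ _⟩
    · rintro ⟨x, hx, rfl⟩
      exact ⟨x.1, x.2, (by simpa using hx : x.1 < x.2).ne, rfl⟩
  rw [e, Finset.sum_image]
  · refine le_trans (Finset.sum_le_sum (g := fun x : Fin n × Fin n => φ (x.2 - x.1)) fun x hx => h x.1 x.2 (by simpa using hx)) ?_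
    rw [← Finset.sum_fiberwise_of_maps_to (g := fun x : Fin n × Fin n => (x.2 - x.1 : ℕ)) (t := Finset.Ico 1 n)]
    · apply Finset.sum_le_sum
      intro d hd
      rw [Finset.sum_congr rfl (g := fun _ => φ d) (fun x hx => by rw [(Finset.mem_filter.mp hx).2]),
        Finset.sum_const, nsmul_eq_mul]
      apply mul_le_mul_of_nonneg_right _ (hφ d)
      rw [Finset.mem_Ico] at hd
      norm_cast
      rw [← Finset.card_range (n - d)]
      refine Finset.card_le_card_of_injOn (fun x => (x.1 : ℕ)) ?_ ?_
      · intro x hx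
        simp only [Finset.coe_filter, Finset.mem_filter, Finset.mem_univ, true_and, Set.mem_ofPred_eq] at hx
        have := x.2.2
        have h1 := Fin.lt_def.mp hx.1
        simp only [Finset.coe_range, Set.mem_Iio]
        omega
      · intro x hx y hy hxy
        simp only [Finset.coe_filter, Finset.mem_filter, Finset.mem_univ, true_and, Set.mem_ofPred_eq] at hx hy
        have h1 := Fin.lt_def.mp hx.1
        have h2 := Fin.lt_def.mp hy.1
        simp only at hxy
        apply Prod.ext
        · exact Fin.ext hxy
        · apply Fin.ext; omega
    · intro x hx
      have h1 := Fin.lt_def.mp (by simpa using hx : x.1 < x.2)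
      have := x.2.2
      rw [Finset.mem_Ico]; omega
  · intro x hx y hy hxy
    obtain ⟨h1, h2⟩ := swap_inj_lt (by simpa using hx) (by simpa using hy) hxy
    exact Prod.ext h1 h2

lemma fc_zero_le {d : ℕ} (hd : 1 ≤ d) : ((FF d (d-1) (finRotate d)).card : ℝ) ≤ (d:ℝ)^d / (d:ℝ)^2 := by
  rcases Nat.lt_or_ge d 2 with h | h
  · have : d = 1 := by omega
    subst this
    have : (FF 1 (1-1) (finRotate 1)).card ≤ 1 := by
      rw [Finset.card_le_one]
      intro a ha b hb
      rw [mem_FF] at ha hb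
      rw [List.length_eq_zero_iff.mp ha.1, List.length_eq_zero_iff.mp hb.1]
    have h2 : ((FF 1 (1-1) (finRotate 1)).card : ℝ) ≤ 1 := by exact_mod_cast this
    simpa using h2
  · have h1 := fc_zero h
    unfold fc at h1
    rw [mul_zero, add_zero] at h1
    rw [h1, le_div_iff₀ (by positivity), ← pow_add, Nat.sub_add_cancel h]

lemma stirling_eq {n : ℕ} (hn : 1 ≤ n) :
    (n.factorial : ℝ) = Stirling.stirlingSeq n * (Real.sqrt (2 * n) * ((n:ℝ)^n / Real.exp n)) := by
  unfold Stirling.stirlingSeq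
  have hn' : (0:ℝ) < n := by exact_mod_cast hn
  have : ((n:ℝ) / Real.exp 1)^n = (n:ℝ)^n / Real.exp n := by
    rw [div_pow, ← Real.exp_nat_mul, mul_one]
  rw [this, div_mul_cancel₀]
  positivity

lemma stirling_le {n : ℕ} (hn : 1 ≤ n) : Stirling.stirlingSeq n * Real.sqrt 2 ≤ 3 := by
  have h := Stirling.stirlingSeq'_antitone (Nat.zero_le (n-1))
  simp only [Function.comp_apply, Nat.succ_eq_add_one, Nat.sub_add_cancel hn, zero_add] at h
  rw [Stirling.stirlingSeq_one] at h
  have h2 : (0:ℝ) < Real.sqrt 2 := by positivity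
  have := mul_le_mul_of_nonneg_right h h2.le
  rw [div_mul_cancel₀ _ h2.ne'] at this
  have := Real.exp_one_lt_d9
  linarith

lemma binom_bound {d e : ℕ} (hd : 1 ≤ d) (he : 1 ≤ e) :
    ((d+e).factorial : ℝ) * ((d:ℝ)^d * (e:ℝ)^e) ≤
      (d.factorial * e.factorial) * ((d+e:ℕ):ℝ)^(d+e) * (1 / Real.sqrt d + 1 / Real.sqrt e) := by
  have hd' : (0:ℝ) < d := by exact_mod_cast hd
  have he' : (0:ℝ) < e := by exact_mod_cast he
  rw [stirling_eq hd, stirling_eq he, stirling_eq (show 1 ≤ d + e by omega)]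
  have hS := stirling_le (show 1 ≤ d + e by omega)
  have s1 := Stirling.sqrt_pi_le_stirlingSeq (n := d) (by omega)
  have s2 := Stirling.sqrt_pi_le_stirlingSeq (n := e) (by omega)
  have hp : 0 < Real.sqrt Real.pi := Real.sqrt_pos.mpr Real.pi_pos
  have s3 : 3 ≤ Stirling.stirlingSeq d * Stirling.stirlingSeq e := by
    have := mul_le_mul s1 s2 hp.le (hp.le.trans s1)
    rw [Real.mul_self_sqrt Real.pi_pos.le] at this
    linarith [Real.pi_gt_three]
  set a := Stirling.stirlingSeq (d+e)
  set b := Stirling.stirlingSeq d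
  set c := Stirling.stirlingSeq e
  have hE : Real.exp ((d+e:ℕ):ℝ) = Real.exp d * Real.exp e := by push_cast; rw [Real.exp_add]
  rw [hE, Real.sqrt_mul (by norm_num), Real.sqrt_mul (by norm_num), Real.sqrt_mul (by norm_num)]
  have hsq : Real.sqrt ((d+e:ℕ):ℝ) ≤ Real.sqrt d + Real.sqrt e := by
    push_cast
    rw [Real.sqrt_le_left (by positivity)]
    have i1 := Real.sq_sqrt hd'.le
    have i2 := Real.sq_sqrt he'.le
    have : 0 ≤ Real.sqrt d * Real.sqrt e := by positivity
    nlinarith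
  have p1 : 0 < Real.sqrt d := Real.sqrt_pos.mpr hd'
  have p2 : 0 < Real.sqrt e := Real.sqrt_pos.mpr he'
  have q2 : Real.sqrt 2 * Real.sqrt 2 = 2 := Real.mul_self_sqrt (by norm_num)
  set x := Real.sqrt d
  set y := Real.sqrt e
  set z := Real.sqrt ((d+e:ℕ):ℝ)
  set w := Real.sqrt 2
  have hz : 0 ≤ z := Real.sqrt_nonneg _
  set N := ((d+e:ℕ):ℝ)^(d+e)
  have hN : 0 ≤ N := by positivity
  set Ed := Real.exp d
  set Ee := Real.exp e
  have hEd : 0 < Ed := Real.exp_pos _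
  have hEe : 0 < Ee := Real.exp_pos _
  have key : a * w * z ≤ b * c * (w * w) * (x + y) := by
    rw [q2]
    have k1 : a * w * z ≤ 3 * z := mul_le_mul_of_nonneg_right hS hz
    have k2 : 3 * z ≤ 3 * (x + y) := by linarith
    have k3 : 3 * (x + y) ≤ b * c * (x + y) := mul_le_mul_of_nonneg_right s3 (by positivity)
    have k4 : 0 ≤ b * c * (x + y) := le_trans (by positivity) k3
    linarith
  have e1 : a * (w * z * (N / (Ed * Ee))) * ((d:ℝ)^d * (e:ℝ)^e) = (a * w * z) * (N * ((d:ℝ)^d * (e:ℝ)^e) / (Ed * Ee)) := by ring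
  have e2 : b * (w * x * ((d:ℝ)^d / Ed)) * (c * (w * y * ((e:ℝ)^e / Ee))) * N * (1 / x + 1 / y) =
    (b * c * (w * w) * (x + y)) * (N * ((d:ℝ)^d * (e:ℝ)^e) / (Ed * Ee)) := by field_simp; ring
  rw [e1, e2]
  exact mul_le_mul_of_nonneg_right key (by positivity)

lemma choose_term {d e : ℕ} (hd : 1 ≤ d) (he : 1 ≤ e) :
    (((d+e-2).choose (d-1) : ℕ) : ℝ) * (((d+e:ℕ):ℝ) * ((d+e:ℕ) - 1)) * (d.factorial * e.factorial) = (d+e).factorial * (d * e) := by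
  obtain ⟨d, rfl⟩ : ∃ k, d = k + 1 := ⟨d - 1, by omega⟩
  obtain ⟨e, rfl⟩ : ∃ k, e = k + 1 := ⟨e - 1, by omega⟩
  have h1 : d + 1 + (e + 1) - 2 = d + e := by omega
  have h2 : d + 1 + (e + 1) = d + e + 1 + 1 := by omega
  rw [h1, h2, Nat.add_sub_cancel]
  have h := Nat.add_choose_mul_factorial_mul_factorial d e
  rw [← Nat.choose_symm_add] at h
  have h' : (((d+e).choose d : ℕ):ℝ) * d.factorial * e.factorial = (d+e).factorial := by exact_mod_cast h
  rw [Nat.factorial_succ (d+e+1), Nat.factorial_succ (d+e), Nat.factorial_succ d, Nat.factorial_succ e]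
  push_cast
  rw [← h']
  ring

noncomputable def hh (n d : ℕ) : ℝ := 2 * d * ((n-2).choose (d-1) * ((d:ℝ)^d / (d:ℝ)^2 * (((n-d:ℕ):ℝ)^(n-d) / ((n-d:ℕ):ℝ)^2)))

lemma hh_nonneg (n d : ℕ) : 0 ≤ hh n d := by unfold hh; positivity

lemma Dsum_le_hh {n : ℕ} (hn : 2 ≤ n) :
    Dsum n (n-1) (finRotate n) ≤ ∑ d ∈ Finset.Ico 1 n, ((n - d : ℕ) : ℝ) * hh n d := by
  obtain ⟨m, rfl⟩ : ∃ m, n = m + 2 := ⟨n - 2, by omega⟩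
  have : m + 2 - 1 = m + 1 := by omega
  rw [this, Dsum_succ]
  refine sum_SW_le _ _ (hh_nonneg _) ?_
  intro p q hpq
  have hpq' : (p:ℕ) < q := hpq
  have hq := q.2
  have h1 := card_two hpq
  have h2 := fc_zero_le (d := q - p) (by omega)
  have h3 := fc_zero_le (d := m + 2 - (q - p)) (by omega)
  rw [disp_swap, abs_of_nonneg (by rw [sub_nonneg]; exact_mod_cast hpq'.le)]
  unfold hh
  rw [← Nat.cast_sub hpq'.le]
  apply mul_le_mul_of_nonneg_left _ (by positivity)
  have h1' : ((FF (m+2) (m+2-2) (finRotate (m+2) * Equiv.swap p q)).card : ℝ) ≤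
     ((m+2-2).choose ((q:ℕ)-p-1) : ℝ) * (((FF (q-p) ((q:ℕ)-p-1) (finRotate _)).card : ℝ) * ((FF (m+2-(q-p)) (m+2-((q:ℕ)-p)-1) (finRotate _)).card : ℝ)) := by
    exact_mod_cast h1
  refine le_trans h1' ?_
  apply mul_le_mul_of_nonneg_left _ (by positivity)
  exact mul_le_mul h2 h3 (by positivity) (by positivity)

lemma hh_le {n d : ℕ} (hd : 1 ≤ d) (hdn : d < n) :
    ((n - d : ℕ) : ℝ) * hh n d ≤ 2 * (n:ℝ)^n / (n * (n - 1)) * (1 / Real.sqrt d + 1 / Real.sqrt ((n-d:ℕ):ℝ)) := by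
  obtain ⟨e, rfl⟩ : ∃ e, n = d + e := ⟨n - d, by omega⟩
  have he : 1 ≤ e := by omega
  have hs : d + e - d = e := by omega
  unfold hh
  rw [hs]
  have h1 := binom_bound hd he
  have h2 := choose_term hd he
  have hd' : (0:ℝ) < d := by exact_mod_cast hd
  have he' : (0:ℝ) < e := by exact_mod_cast he
  have hn' : (0:ℝ) < ((d+e:ℕ):ℝ) := by push_cast; positivity
  have hd1 : (1:ℝ) ≤ d := by exact_mod_cast hd
  have hn1 : (0:ℝ) < ((d+e:ℕ):ℝ) - 1 := by push_cast; linarith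
  have f1 : (0:ℝ) < d.factorial * e.factorial := by positivity
  set c : ℝ := ((d+e-2).choose (d-1) : ℝ)
  set s := 1 / Real.sqrt d + 1 / Real.sqrt (e:ℝ)
  set N : ℝ := ((d+e:ℕ):ℝ)
  set ff : ℝ := (d.factorial * e.factorial : ℝ)
  have hc : c = (d+e).factorial * (d * e) / (N * (N - 1) * ff) := by
    rw [eq_div_iff (by positivity)]; linarith
  have e1 : (e:ℝ) * (2 * d * (c * ((d:ℝ)^d / (d:ℝ)^2 * ((e:ℝ)^e / (e:ℝ)^2)))) =
      2 * (((d+e).factorial : ℝ) * ((d:ℝ)^d * (e:ℝ)^e)) / (N * (N-1) * ff) := by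
    rw [hc]; field_simp
  have e2 : 2 * N ^ (d+e) / (N * (N-1)) * s = 2 * (ff * N^(d+e) * s) / (N * (N-1) * ff) := by
    field_simp
  rw [e1, e2]
  apply div_le_div_of_nonneg_right _ (by positivity)
  linarith

lemma sum_inv_sqrt (N : ℕ) : ∑ d ∈ Finset.Ico 1 (N+1), 1 / Real.sqrt d ≤ 2 * Real.sqrt N := by
  induction N with
  | zero => simp
  | succ N ih =>
    rw [Finset.sum_Ico_succ_top (by omega)]
    have p : 0 < Real.sqrt ((N+1:ℕ):ℝ) := Real.sqrt_pos.mpr (by positivity)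
    have q : 0 ≤ Real.sqrt (N:ℝ) := Real.sqrt_nonneg _
    have i1 := Real.sq_sqrt (show (0:ℝ) ≤ ((N+1:ℕ):ℝ) by positivity)
    have i2 := Real.sq_sqrt (show (0:ℝ) ≤ (N:ℝ) by positivity)
    have : 1 / Real.sqrt ((N+1:ℕ):ℝ) ≤ 2 * Real.sqrt ((N+1:ℕ):ℝ) - 2 * Real.sqrt N := by
      rw [div_le_iff₀ p]
      push_cast at i1 p ⊢
      nlinarith [sq_nonneg (Real.sqrt ((N:ℝ)+1) - Real.sqrt N)]
    linarith

lemma Qh_zero : Qh 0 := by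
  unfold Qh
  have lim : Tendsto (fun n : ℕ => 16 / Real.sqrt n) atTop (𝓝 0) := by
    apply Tendsto.const_div_atTop
    exact Real.tendsto_sqrt_atTop.comp tendsto_natCast_atTop_atTop
  refine tendsto_of_tendsto_of_tendsto_of_le_of_le' tendsto_const_nhds lim ?_ ?_
  · refine Eventually.of_forall fun n => ?_
    refine div_nonneg (Dsum_nonneg _) ?_
    unfold fc; positivity
  filter_upwards [eventually_ge_atTop 2] with n hn
  rw [mul_zero, add_zero, fc_zero hn]
  have hn' : (2:ℝ) ≤ n := by exact_mod_cast hn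
  have hb : Dsum n (n-1) (finRotate n) ≤ 2 * (n:ℝ)^n / (n * (n - 1)) * (4 * Real.sqrt n) := by
    refine le_trans (Dsum_le_hh hn) ?_
    refine le_trans (Finset.sum_le_sum fun d hd => hh_le (Finset.mem_Ico.mp hd).1 (Finset.mem_Ico.mp hd).2) ?_
    rw [← Finset.mul_sum]
    apply mul_le_mul_of_nonneg_left
    · rw [Finset.sum_add_distrib]
      have h1 := sum_inv_sqrt (n-1)
      rw [Nat.sub_add_cancel (by omega)] at h1
      have h2 : ∑ d ∈ Finset.Ico 1 n, 1 / Real.sqrt ((n-d:ℕ):ℝ) = ∑ d ∈ Finset.Ico 1 n, 1 / Real.sqrt (d:ℝ) := by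
        refine Finset.sum_bij' (fun d _ => n - d) (fun d _ => n - d) ?_ ?_ ?_ ?_ ?_
        · intro d hd; rw [Finset.mem_Ico] at *; omega
        · intro d hd; rw [Finset.mem_Ico] at *; omega
        · intro d hd; rw [Finset.mem_Ico] at *; omega
        · intro d hd; rw [Finset.mem_Ico] at *; omega
        · intro d hd; rfl
      rw [h2]
      have h3 : Real.sqrt ((n-1:ℕ):ℝ) ≤ Real.sqrt n := by
        apply Real.sqrt_le_sqrt; exact_mod_cast Nat.sub_le n 1
      linarith
    · apply div_nonneg (by positivity)
      apply mul_nonneg <;> linarith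
  have hpw : (n:ℝ)^n = (n:ℝ)^(n-2) * (n:ℝ)^2 := by rw [← pow_add, Nat.sub_add_cancel hn]
  have hn0 : (0:ℝ) < n := by linarith
  have hn1 : (0:ℝ) < (n:ℝ) - 1 := by linarith
  have hpos : (0:ℝ) < (n:ℝ)^(n-2) := by positivity
  rw [div_le_iff₀ (by positivity)]
  refine le_trans hb ?_
  rw [hpw]
  have hs : 0 < Real.sqrt n := Real.sqrt_pos.mpr hn0
  have i := Real.sq_sqrt hn0.le
  have e1 : 2 * ((n:ℝ)^(n-2) * (n:ℝ)^2) / (n * (n - 1)) * (4 * Real.sqrt n) =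
    (n:ℝ)^(n-2) * (8 * n * Real.sqrt n / (n - 1)) := by field_simp; ring
  have e2 : 16 / Real.sqrt n * ((n:ℝ)^(n-2) * n) = (n:ℝ)^(n-2) * (16 * Real.sqrt n) := by
    have : (n:ℝ) = Real.sqrt n * Real.sqrt n := (Real.mul_self_sqrt hn0.le).symm
    have e3 : 16 / Real.sqrt n * ((n:ℝ)^(n-2) * n) = (n:ℝ)^(n-2) * (16 * (n / Real.sqrt n)) := by ring
    rw [e3, Real.div_sqrt]
  rw [e1, e2]
  apply mul_le_mul_of_nonneg_left _ hpos.le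
  rw [div_le_iff₀ hn1]
  nlinarith

end base2

theorem stmt4 (g : ℕ) (hg : 1 ≤ g) :
    Filter.Tendsto (fun n => dTV (lamStepDist n g) (unifF n g))
      Filter.atTop (nhds 0) := by
  exact dTV_tendsto hg (Qh_all Qh_zero (g-1))
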